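/- arXiv:2310.18041 — 3 statements merged into one kernel-verified Lean document; each statement's English description precedes it below -/
import Mathlib

section
/- Let I = (−ρ, ρ), (0, ρ) or [0, ρ), where 0 < ρ ≤ ∞, let k and m be positive integers, and let f : I^m → ℝ. (1) The entrywise transform f[−] sends, for every n ≥ k, every m-tuple (B^{(1)}, …, B^{(m)}) of n×n real symmetric matrices with entries in I each having exactly k negative eigenvalues, to a matrix with exactly k negative eigenvalues, if and only if f(x) = c·x_{p₀} for some constant c > 0 and some p₀ ∈ [1 : m], or, when k = 1, possibly f(x) = −c for some constant c > 0. (2) The entrywise transform f[−] sends, for every n ≥ k, every m-tuple of n×n real symmetric matrices with entries in I each having at most k negative eigenvalues, to a matrix with at most k negative eigenvalues, if and only if f(x) = c·x_{p₀} + d for some p₀ ∈ [1 : m], with either c = 0 and d ∈ ℝ, or c > 0 and d ≥ 0. -/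
/-- The number of negative eigenvalues (with multiplicity) of a real symmetric
(Hermitian) matrix; junk value `0` if the matrix is not Hermitian. -/
noncomputable def negEigCount {n : Type*} [Fintype n] [DecidableEq n]
    (A : Matrix n n ℝ) : ℕ :=
  if hA : A.IsHermitian then Nat.card {i // hA.eigenvalues i < 0} else 0

open Matrix Finset

section NegativeIndex

lemma isHermitian_of_isSymm {n : Type*} {A : Matrix n n ℝ} (hA : A.IsSymm) : A.IsHermitian := by
  rw [Matrix.IsHermitian, Matrix.conjTranspose_eq_transpose_of_trivial]
  exact hA

variable {n : Type*} [Fintype n] [DecidableEq n]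

lemma exists_orthogonal_diagonalization {A : Matrix n n ℝ} (hA : A.IsHermitian) :
    ∃ V : Matrix n n ℝ, V * Vᵀ = 1 ∧ A = Vᵀ * Matrix.diagonal hA.eigenvalues * V := by
  refine ⟨(hA.eigenvectorUnitary : Matrix n n ℝ)ᵀ, ?_, ?_⟩
  · have h := Unitary.coe_star_mul_self hA.eigenvectorUnitary
    rw [Matrix.star_eq_conjTranspose, Matrix.conjTranspose_eq_transpose_of_trivial] at h
    simpa using h
  · have h := hA.spectral_theorem
    rw [Unitary.conjStarAlgAut_apply, Matrix.star_eq_conjTranspose,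
      Matrix.conjTranspose_eq_transpose_of_trivial] at h
    simpa using h

lemma dotProduct_diagonalized (V : Matrix n n ℝ) (d x : n → ℝ) :
    x ⬝ᵥ (Vᵀ * Matrix.diagonal d * V) *ᵥ x = ∑ i, d i * (V *ᵥ x) i ^ 2 := by
  rw [← Matrix.mulVec_mulVec, ← Matrix.mulVec_mulVec, Matrix.dotProduct_mulVec,
    Matrix.vecMul_transpose]
  simp only [dotProduct, Matrix.mulVec_diagonal]
  exact Finset.sum_congr rfl fun i _ => by ring

lemma negEigCount_eq_card {A : Matrix n n ℝ} (hA : A.IsHermitian) :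
    negEigCount A = Fintype.card {i // hA.eigenvalues i < 0} := by
  rw [negEigCount, dif_pos hA, Nat.card_eq_fintype_card]

/-- The quadratic form is nonnegative on the kernel of some linear map to a space of dimension
`negEigCount A`. -/
lemma exists_nonneg_on_ker {A : Matrix n n ℝ} (hA : A.IsSymm) :
    ∃ S : (n → ℝ) →ₗ[ℝ] (Fin (negEigCount A) → ℝ), ∀ x, S x = 0 → 0 ≤ x ⬝ᵥ A *ᵥ x := by
  have hA' := isHermitian_of_isSymm hA
  obtain ⟨V, -, hV⟩ := exists_orthogonal_diagonalization hA'
  have e : Fin (negEigCount A) ≃ {i // hA'.eigenvalues i < 0} :=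
    Fintype.equivOfCardEq (by rw [Fintype.card_fin, negEigCount_eq_card hA'])
  refine ⟨LinearMap.funLeft ℝ ℝ (fun i => (e i : n)) ∘ₗ V.mulVecLin, fun x hx => ?_⟩
  have hform := dotProduct_diagonalized V hA'.eigenvalues x
  rw [← hV] at hform
  rw [hform]
  refine Finset.sum_nonneg fun i _ => ?_
  by_cases hi : hA'.eigenvalues i < 0
  · have h := congrFun hx (e.symm ⟨i, hi⟩)
    simp only [LinearMap.comp_apply, LinearMap.funLeft_apply, Matrix.mulVecLin_apply,
      Equiv.apply_symm_apply, Pi.zero_apply] at h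
    simp [h]
  · exact mul_nonneg (not_lt.mp hi) (sq_nonneg _)

lemma exists_neg_on_range {A : Matrix n n ℝ} (hA : A.IsSymm) :
    ∃ T : (Fin (negEigCount A) → ℝ) →ₗ[ℝ] (n → ℝ), ∀ y ≠ 0, T y ⬝ᵥ A *ᵥ T y < 0 := by
  have hA' := isHermitian_of_isSymm hA
  obtain ⟨V, hV1, hV⟩ := exists_orthogonal_diagonalization hA'
  have e : Fin (negEigCount A) ≃ {i // hA'.eigenvalues i < 0} :=
    Fintype.equivOfCardEq (by rw [Fintype.card_fin, negEigCount_eq_card hA'])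
  let E : Matrix n (Fin (negEigCount A)) ℝ :=
    Matrix.of fun i j => if i = (e j : n) then 1 else 0
  refine ⟨Vᵀ.mulVecLin ∘ₗ E.mulVecLin, fun y hy => ?_⟩
  have hform := dotProduct_diagonalized V hA'.eigenvalues (Vᵀ *ᵥ (E *ᵥ y))
  rw [← hV, Matrix.mulVec_mulVec _ V, hV1, Matrix.one_mulVec] at hform
  simp only [LinearMap.comp_apply, Matrix.mulVecLin_apply]
  rw [hform]
  have hpos : ∀ i, 0 ≤ hA'.eigenvalues i → (E *ᵥ y) i = 0 := by
    intro i hi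
    simp only [Matrix.mulVec, dotProduct]
    refine Finset.sum_eq_zero fun j _ => ?_
    have : i ≠ (e j : n) := by
      rintro rfl
      exact absurd (e j).2 (not_lt.mpr hi)
    simp [E, this]
  have hneg : ∀ j, (E *ᵥ y) (e j) = y j := by
    intro j
    simp [E, Matrix.mulVec, dotProduct, Subtype.coe_inj]
  obtain ⟨j, hj⟩ := Function.ne_iff.mp hy
  refine Finset.sum_neg' (fun i _ => ?_) ⟨(e j : n), Finset.mem_univ _, ?_⟩
  · rcases lt_or_ge (hA'.eigenvalues i) 0 with hi | hi
    · exact mul_nonpos_of_nonpos_of_nonneg hi.le (sq_nonneg _)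
    · simp [hpos i hi]
  · rw [hneg]
    exact mul_neg_of_neg_of_pos (e j).2 (pow_two_pos_of_ne_zero hj)

lemma negEigCount_le_of_nonneg_on_ker {A : Matrix n n ℝ} (hA : A.IsSymm) {r : Type*} [Fintype r]
    (S : (n → ℝ) →ₗ[ℝ] (r → ℝ)) (hS : ∀ x, S x = 0 → 0 ≤ x ⬝ᵥ A *ᵥ x) :
    negEigCount A ≤ Fintype.card r := by
  obtain ⟨T, hT⟩ := exists_neg_on_range hA
  have hinj : Function.Injective (S ∘ₗ T) := by
    rw [injective_iff_map_eq_zero]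
    intro y hy
    by_contra hne
    exact absurd (hS _ hy) (not_le.mpr (hT y hne))
  simpa using LinearMap.finrank_le_finrank_of_injective hinj

lemma card_le_negEigCount_of_neg_on_range {A : Matrix n n ℝ} (hA : A.IsSymm) {r : Type*}
    [Fintype r] (T : (r → ℝ) →ₗ[ℝ] (n → ℝ)) (hT : ∀ y ≠ 0, T y ⬝ᵥ A *ᵥ T y < 0) :
    Fintype.card r ≤ negEigCount A := by
  obtain ⟨S, hS⟩ := exists_nonneg_on_ker hA
  have hinj : Function.Injective (S ∘ₗ T) := by
    rw [injective_iff_map_eq_zero]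
    intro y hy
    by_contra hne
    exact absurd (hS _ hy) (not_le.mpr (hT y hne))
  simpa using LinearMap.finrank_le_finrank_of_injective hinj

lemma card_le_negEigCount_of_orthogonal {A : Matrix n n ℝ} (hA : A.IsSymm) {r : Type*}
    [Fintype r] (z : r → n → ℝ) (hneg : ∀ l, z l ⬝ᵥ A *ᵥ z l < 0)
    (hortho : ∀ l l', l ≠ l' → z l ⬝ᵥ A *ᵥ z l' = 0) :
    Fintype.card r ≤ negEigCount A := by
  refine card_le_negEigCount_of_neg_on_range hA (Fintype.linearCombination ℝ z) fun y hy => ?_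
  have hform : Fintype.linearCombination ℝ z y ⬝ᵥ A *ᵥ Fintype.linearCombination ℝ z y =
      ∑ l, y l ^ 2 * (z l ⬝ᵥ A *ᵥ z l) := by
    simp only [Fintype.linearCombination_apply, Matrix.mulVec_sum, sum_dotProduct,
      dotProduct_sum, Matrix.mulVec_smul, smul_dotProduct, dotProduct_smul, smul_eq_mul]
    refine Finset.sum_congr rfl fun l _ => ?_
    rw [Finset.sum_eq_single l (fun l' _ h => by rw [hortho l' l h]; ring) (by simp)]
    ring
  obtain ⟨l, hl⟩ := Function.ne_iff.mp hy
  rw [hform]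
  exact Finset.sum_neg' (fun i _ => mul_nonpos_of_nonneg_of_nonpos (sq_nonneg _) (hneg i).le)
    ⟨l, Finset.mem_univ _, mul_neg_of_pos_of_neg (pow_two_pos_of_ne_zero hl) (hneg l)⟩

lemma negEigCount_le_of_form_le {n' : Type*} [Fintype n'] [DecidableEq n'] {A : Matrix n n ℝ}
    {A' : Matrix n' n' ℝ} (hA : A.IsSymm) (hA' : A'.IsSymm) (L : (n → ℝ) →ₗ[ℝ] (n' → ℝ)) {c : ℝ}
    (hc : 0 ≤ c) (h : ∀ x, c * (L x ⬝ᵥ A' *ᵥ L x) ≤ x ⬝ᵥ A *ᵥ x) :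
    negEigCount A ≤ negEigCount A' := by
  obtain ⟨S, hS⟩ := exists_nonneg_on_ker hA'
  simpa using negEigCount_le_of_nonneg_on_ker hA (S ∘ₗ L)
    fun x hx => (mul_nonneg hc (hS _ hx)).trans (h x)

lemma negEigCount_reindex_le {n' : Type*} [Fintype n'] [DecidableEq n'] {A : Matrix n n ℝ}
    (hA : A.IsSymm) (e : n' ≃ n) : negEigCount (A.submatrix e e) ≤ negEigCount A := by
  refine negEigCount_le_of_form_le (hA.submatrix e) hA (LinearMap.funLeft ℝ ℝ e.symm)
    zero_le_one fun x => le_of_eq ?_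
  rw [one_mul, Matrix.submatrix_mulVec_equiv, ← comp_equiv_symm_dotProduct]
  rfl

lemma negEigCount_reindex {n' : Type*} [Fintype n'] [DecidableEq n'] {A : Matrix n n ℝ}
    (hA : A.IsSymm) (e : n' ≃ n) : negEigCount (A.submatrix e e) = negEigCount A := by
  refine le_antisymm (negEigCount_reindex_le hA e) ?_
  simpa using negEigCount_reindex_le (hA.submatrix e) e.symm

/-- `∑ₗ cₗ uₗ uₗᵀ`. -/
def rankOneSum {Λ ι : Type*} [Fintype Λ] (c : Λ → ℝ) (u : Λ → ι → ℝ) : Matrix ι ι ℝ :=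
  Matrix.of fun i j => ∑ l, c l * (u l i * u l j)

lemma rankOneSum_apply {Λ ι : Type*} [Fintype Λ] (c : Λ → ℝ) (u : Λ → ι → ℝ) (i j : ι) :
    rankOneSum c u i j = ∑ l, c l * (u l i * u l j) := rfl

lemma rankOneSum_isSymm {Λ ι : Type*} [Fintype Λ] (c : Λ → ℝ) (u : Λ → ι → ℝ) :
    (rankOneSum c u).IsSymm :=
  Matrix.IsSymm.ext fun i j => by
    simp only [rankOneSum_apply]
    exact Finset.sum_congr rfl fun l _ => by ring

omit [DecidableEq n] in
lemma dotProduct_rankOneSum {Λ : Type*} [Fintype Λ] (c : Λ → ℝ) (u : Λ → n → ℝ) (x y : n → ℝ) :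
    x ⬝ᵥ rankOneSum c u *ᵥ y = ∑ l, c l * ((u l ⬝ᵥ x) * (u l ⬝ᵥ y)) := by
  have h : rankOneSum c u *ᵥ y = ∑ l, (c l * (u l ⬝ᵥ y)) • u l := by
    ext i
    simp only [Matrix.mulVec, dotProduct, rankOneSum_apply, Finset.sum_mul, Finset.mul_sum,
      Finset.sum_apply, Pi.smul_apply, smul_eq_mul]
    rw [Finset.sum_comm]
    exact Finset.sum_congr rfl fun l _ => Finset.sum_congr rfl fun j _ => by ring
  rw [h, dotProduct_sum]
  refine Finset.sum_congr rfl fun l _ => ?_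
  rw [dotProduct_smul, smul_eq_mul, dotProduct_comm x]
  ring

lemma negEigCount_rankOneSum_le {Λ : Type*} [Fintype Λ] (c : Λ → ℝ) (u : Λ → n → ℝ) :
    negEigCount (rankOneSum c u) ≤ Fintype.card {l // c l < 0} := by
  refine negEigCount_le_of_nonneg_on_ker (rankOneSum_isSymm c u)
    (Matrix.mulVecLin (Matrix.of fun (l : {l // c l < 0}) i => u l i)) fun x hx => ?_
  rw [dotProduct_rankOneSum]
  refine Finset.sum_nonneg fun l _ => ?_
  by_cases hl : c l < 0
  · have h : u l ⬝ᵥ x = 0 := congrFun hx ⟨l, hl⟩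
    simp [h]
  · exact mul_nonneg (not_lt.mp hl) (mul_self_nonneg _)

lemma card_le_negEigCount_rankOneSum {Λ r : Type*} [Fintype Λ] [Fintype r] (c : Λ → ℝ)
    (u : Λ → n → ℝ) (e : r → Λ) (he : Function.Injective e) (hneg : ∀ i, c (e i) < 0)
    (z : r → n → ℝ) (hdiag : ∀ i, u (e i) ⬝ᵥ z i ≠ 0)
    (hoff : ∀ i l, l ≠ e i → u l ⬝ᵥ z i = 0) :
    Fintype.card r ≤ negEigCount (rankOneSum c u) := by
  refine card_le_negEigCount_of_orthogonal (rankOneSum_isSymm c u) z (fun i => ?_)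
    fun i i' hne => ?_
  · rw [dotProduct_rankOneSum, Finset.sum_eq_single (e i)
      (fun l _ h => by rw [hoff i l h]; ring) (by simp)]
    exact mul_neg_of_neg_of_pos (hneg i) (mul_self_pos.mpr (hdiag i))
  · rw [dotProduct_rankOneSum]
    refine Finset.sum_eq_zero fun l _ => ?_
    by_cases hl : l = e i
    · rw [hoff i' l (by rw [hl]; exact fun h => hne (he h))]; ring
    · rw [hoff i l hl]; ring

lemma negEigCount_rankOneSum {Λ r : Type*} [Fintype Λ] [Fintype r] (c : Λ → ℝ)
    (u : Λ → n → ℝ) (e : r → Λ) (he : Function.Injective e) (hneg : ∀ i, c (e i) < 0)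
    (hnonneg : ∀ l, c l < 0 → ∃ i, e i = l) (z : r → n → ℝ) (hdiag : ∀ i, u (e i) ⬝ᵥ z i ≠ 0)
    (hoff : ∀ i l, l ≠ e i → u l ⬝ᵥ z i = 0) :
    negEigCount (rankOneSum c u) = Fintype.card r := by
  refine le_antisymm ((negEigCount_rankOneSum_le c u).trans (Fintype.card_le_of_surjective
    (fun i => (⟨e i, hneg i⟩ : {l // c l < 0})) fun l => ?_))
    (card_le_negEigCount_rankOneSum c u e he hneg z hdiag hoff)
  obtain ⟨i, hi⟩ := hnonneg l l.2
  exact ⟨i, Subtype.ext hi⟩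

end NegativeIndex

section IncrementEquation

lemma eq_mul_of_additive_nonneg {g : ℝ → ℝ} {η : ℝ} (hη : 0 < η)
    (hadd : ∀ s t, 0 ≤ s → 0 ≤ t → s + t ≤ η → g (s + t) = g s + g t)
    (hnn : ∀ t, 0 ≤ t → t ≤ η → 0 ≤ g t) {t : ℝ} (ht : 0 ≤ t) (htη : t ≤ η) :
    g t = g η / η * t := by
  set c := g η / η with hc
  have hcη : c * η = g η := div_mul_cancel₀ _ hη.ne'
  have hle : ∀ t, 0 ≤ t → t ≤ η → g t ≤ g η := fun t h0 h1 => by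
    have h := hadd t (η - t) h0 (by linarith) (by linarith)
    rw [add_sub_cancel] at h
    linarith [hnn (η - t) (by linarith) (by linarith)]
  have hc0 : 0 ≤ c := div_nonneg (hnn η hη.le le_rfl) hη.le
  have hbound : ∀ n : ℕ, ∀ t, 0 ≤ t → t ≤ η → |g t - c * t| ≤ g η / 2 ^ n := by
    intro n
    induction n with
    | zero =>
      intro t h0 h1
      have h2 := hle t h0 h1
      have h3 := hnn t h0 h1
      have h4 : c * t ≤ c * η := mul_le_mul_of_nonneg_left h1 hc0
      have h5 : 0 ≤ c * t := mul_nonneg hc0 h0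
      rw [pow_zero, div_one, abs_le]
      constructor <;> linarith
    | succ n ih =>
      have hsmall : ∀ t, 0 ≤ t → t + t ≤ η → |g t - c * t| ≤ g η / 2 ^ (n + 1) := by
        intro t h0 h1
        have h2 := ih (t + t) (by linarith) h1
        rw [hadd t t h0 h0 h1, show g t + g t - c * (t + t) = 2 * (g t - c * t) by ring,
          abs_mul, abs_two] at h2
        rw [pow_succ, ← div_div]
        linarith
      intro t h0 h1
      rcases le_total (t + t) η with h2 | h2
      · exact hsmall t h0 h2
      · have h3 := hsmall (η - t) (by linarith) (by linarith)
        have h4 := hadd t (η - t) h0 (by linarith) (by linarith)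
        rw [add_sub_cancel] at h4
        rwa [show g (η - t) - c * (η - t) = -(g t - c * t) by
          linear_combination -h4 - hcη, abs_neg] at h3
  have hlim : Filter.Tendsto (fun n : ℕ => g η / 2 ^ n) Filter.atTop (nhds 0) := by
    simpa [div_eq_mul_inv] using
      (tendsto_inv_atTop_zero.comp (tendsto_pow_atTop_atTop_of_one_lt one_lt_two)).const_mul (g η)
  have h0 : |g t - c * t| ≤ 0 := ge_of_tendsto' hlim fun n => hbound n t ht htη
  linarith [abs_nonpos_iff.mp h0]

/-- The properties shared by `(-ρ, ρ)`, `(0, ρ)` and `[0, ρ)` that the argument uses. -/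
structure IsTestDomain (I : Set ℝ) : Prop where
  nonempty : I.Nonempty
  ordConnected : I.OrdConnected
  exists_abs_lt : ∀ x ∈ I, ∃ y ∈ I, |x| < y
  mem_of_pos_of_le : ∀ x ∈ I, ∀ y, 0 < y → y ≤ x → y ∈ I

lemma IsTestDomain.exists_pos {I : Set ℝ} (hI : IsTestDomain I) : ∃ x ∈ I, 0 < x := by
  obtain ⟨x, hx⟩ := hI.nonempty
  obtain ⟨y, hy, hxy⟩ := hI.exists_abs_lt x hx
  exact ⟨y, hy, (abs_nonneg x).trans_lt hxy⟩

lemma IsTestDomain.exists_common_slope {I : Set ℝ} (hI : IsTestDomain I) {Φ : ℝ → ℝ}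
    (hΦ : ∀ r t r', 0 < r → 0 < r' → 0 ≤ t → r + t ∈ I → r' + t ∈ I →
      Φ (r + t) - Φ r = Φ (r' + t) - Φ r')
    (hmono : ∀ r t, 0 < r → 0 ≤ t → r + t ∈ I → Φ r ≤ Φ (r + t)) :
    ∃ c, 0 ≤ c ∧ ∀ ψ : ℝ → ℝ,
      (∀ s r t, s ∈ I → 0 ≤ t → s + t ∈ I → 0 < r → 0 < r + s → r + t ∈ I →
        ψ (s + t) - ψ s = Φ (r + t) - Φ r) →
      ∀ s ∈ I, ∀ s' ∈ I, ψ s' - ψ s = c * (s' - s) := by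
  obtain ⟨q, hq, hq0⟩ := hI.exists_pos
  set η := q / 2 with hη
  have hη0 : 0 < η := half_pos hq0
  have hmem : ∀ t, 0 ≤ t → t ≤ η → η + t ∈ I := fun t h0 h1 =>
    hI.mem_of_pos_of_le q hq _ (by linarith) (by linarith)
  set g : ℝ → ℝ := fun t => Φ (η + t) - Φ η with hg
  have hg0 : ∀ t, 0 ≤ t → t ≤ η → 0 ≤ g t := fun t h0 h1 =>
    sub_nonneg.mpr (hmono η t hη0 h0 (hmem t h0 h1))
  have hglin : ∀ t, 0 ≤ t → t ≤ η → g t = g η / η * t := fun t h0 h1 => by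
    refine eq_mul_of_additive_nonneg hη0 (fun s t hs ht hst => ?_) hg0 h0 h1
    have h := hΦ η t (η + s) hη0 (by linarith) ht (hmem t ht (by linarith))
      (by rw [add_assoc]; exact hmem _ (by linarith) hst)
    simp only [hg]
    rw [h, add_assoc]
    ring
  set c := g η / η with hc
  refine ⟨c, div_nonneg (hg0 η hη0.le le_rfl) hη0.le, fun ψ hψ => ?_⟩
  have key : ∀ s ∈ I, ∀ s' ∈ I, s ≤ s' → ψ s' - ψ s = c * (s' - s) := by
    intro s hs s' hs' hss'
    obtain ⟨R, hR, hsR, hs'R⟩ : ∃ R ∈ I, |s| < R ∧ |s'| < R := by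
      obtain ⟨y, hy, h1⟩ := hI.exists_abs_lt s hs
      obtain ⟨y', hy', h2⟩ := hI.exists_abs_lt s' hs'
      rcases le_total y y' with h | h
      · exact ⟨y', hy', h1.trans_le h, h2⟩
      · exact ⟨y, hy, h1, h2.trans_le h⟩
    have hR0 : 0 < R := (abs_nonneg s).trans_lt hsR
    obtain ⟨R', hR', hRR'⟩ := hI.exists_abs_lt R hR
    rw [abs_of_pos hR0] at hRR'
    set ε := min η (R' - R) with hε
    have hε0 : 0 < ε := lt_min hη0 (sub_pos.mpr hRR')
    have hstep : ∀ a b, a ∈ I → b ∈ I → |a| < R → a ≤ b → b - a ≤ ε →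
        ψ b - ψ a = c * (b - a) := by
      intro a b ha hb haR hab hbε
      have h1 : b - a ≤ η := hbε.trans (min_le_left _ _)
      have h2 : b - a ≤ R' - R := hbε.trans (min_le_right _ _)
      have hRt : R + (b - a) ∈ I := hI.mem_of_pos_of_le R' hR' _ (by linarith) (by linarith)
      have h := hψ a R (b - a) ha (by linarith) (by simpa using hb) hR0
        (by linarith [(abs_lt.mp haR).1]) hRt
      rw [add_sub_cancel, hΦ R (b - a) η hR0 hη0 (by linarith) hRt
        (hmem _ (by linarith) h1)] at h
      rw [h, ← hglin _ (by linarith) h1]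
    have hind : ∀ n : ℕ, ∀ b ∈ I, s ≤ b → b ≤ s' → b - s ≤ n * ε → ψ b - ψ s = c * (b - s) := by
      intro n
      induction n with
      | zero =>
        intro b hb h1 h2 h3
        rw [Nat.cast_zero, zero_mul] at h3
        rw [show b = s by linarith]
        ring
      | succ n ih =>
        intro b hb h1 h2 h3
        push_cast at h3
        have hm1 : s ≤ max s (b - ε) := le_max_left _ _
        have hm2 : max s (b - ε) ≤ b := max_le h1 (by linarith)
        have hm3 : b - ε ≤ max s (b - ε) := le_max_right _ _
        have hmI : max s (b - ε) ∈ I := hI.ordConnected.out hs hb ⟨hm1, hm2⟩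
        have hm4 : max s (b - ε) - s ≤ n * ε := by
          rw [sub_le_iff_le_add]
          refine max_le (by nlinarith [Nat.cast_nonneg (α := ℝ) n]) (by linarith)
        have hmR : |max s (b - ε)| < R :=
          abs_lt.mpr ⟨(abs_lt.mp hsR).1.trans_le hm1,
            (hm2.trans h2).trans_lt (abs_lt.mp hs'R).2⟩
        have e1 := ih _ hmI hm1 (hm2.trans h2) hm4
        have e2 := hstep _ b hmI hb hmR hm2 (by linarith)
        linear_combination e1 + e2
    obtain ⟨n, hn⟩ := exists_nat_ge ((s' - s) / ε)
    exact hind n s' hs' hss' le_rfl ((div_le_iff₀ hε0).mp hn)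
  intro s hs s' hs'
  rcases le_total s s' with h | h
  · exact key s hs s' hs' h
  · linear_combination -(key s' hs' s hs h)

/-- A function on `I^σ` whose increments in nonnegative directions do not depend on the base point
and are nonnegative is affine with nonnegative slopes. -/
lemma IsTestDomain.affine_of_increments {I : Set ℝ} (hI : IsTestDomain I) {σ : Type*} [Fintype σ]
    [DecidableEq σ] {f : (σ → ℝ) → ℝ}
    (hf : ∀ x y δ : σ → ℝ, (∀ p, 0 ≤ δ p) → (∀ p, x p ∈ I) → (∀ p, (x + δ) p ∈ I) →
      (∀ p, y p ∈ I) → (∀ p, (y + δ) p ∈ I) → (∀ p, 0 < x p + y p) →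
      f (x + δ) - f x = f (y + δ) - f y ∧ 0 ≤ f (x + δ) - f x) :
    ∃ (c : σ → ℝ) (d : ℝ), (∀ p, 0 ≤ c p) ∧
      ∀ x : σ → ℝ, (∀ p, x p ∈ I) → f x = ∑ p, c p * x p + d := by
  obtain ⟨q, hq, hq0⟩ := hI.exists_pos
  have hupd : ∀ (x : σ → ℝ) p s, (∀ p, x p ∈ I) → s ∈ I → ∀ j, Function.update x p s j ∈ I := by
    intro x p s hx hs j
    rcases eq_or_ne j p with rfl | hj
    · simpa using hs
    · simpa [hj] using hx j
  have hadd : ∀ (x : σ → ℝ) p s t,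
      Function.update x p (s + t) = Function.update x p s + Pi.single p t := by
    intro x p s t
    ext j
    rcases eq_or_ne j p with rfl | hj
    · simp
    · simp [hj]
  have hslice : ∀ (x y : σ → ℝ) p s r t, (∀ j, x j ∈ I) → (∀ j, y j ∈ I) →
      (∀ j, 0 < x j + y j) → s ∈ I → s + t ∈ I → r ∈ I → r + t ∈ I → 0 ≤ t → 0 < s + r →
      f (Function.update x p (s + t)) - f (Function.update x p s) =
        f (Function.update y p (r + t)) - f (Function.update y p r) ∧
      0 ≤ f (Function.update x p (s + t)) - f (Function.update x p s) := by
    intro x y p s r t hx hy hxy hs hst hr hrt ht hsr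
    rw [hadd, hadd]
    refine hf _ _ _ (fun j => ?_) (hupd _ _ _ hx hs) (fun j => ?_) (hupd _ _ _ hy hr)
      (fun j => ?_) (fun j => ?_)
    · rcases eq_or_ne j p with rfl | hj
      · simpa using ht
      · simp [hj]
    · rw [← hadd]; exact hupd _ _ _ hx hst j
    · rw [← hadd]; exact hupd _ _ _ hy hrt j
    · rcases eq_or_ne j p with rfl | hj
      · simpa using hsr
      · simpa [hj] using hxy j
  have hmem : ∀ r t, 0 < r → 0 ≤ t → r + t ∈ I → r ∈ I := fun r t hr ht h =>
    hI.mem_of_pos_of_le _ h _ hr (by linarith)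
  have hslope : ∀ p, ∃ c, 0 ≤ c ∧ ∀ x : σ → ℝ, (∀ j, x j ∈ I) → ∀ s ∈ I, ∀ s' ∈ I,
      f (Function.update x p s') - f (Function.update x p s) = c * (s' - s) := by
    intro p
    obtain ⟨c, hc, h⟩ := hI.exists_common_slope
      (Φ := fun t => f (Function.update (fun _ => q) p t))
      (fun r t r' hr hr' ht hrt hrt' => (hslice _ _ p r r' t (fun _ => hq) (fun _ => hq)
        (fun _ => add_pos hq0 hq0) (hmem r t hr ht hrt) hrt (hmem r' t hr' ht hrt') hrt' ht
        (add_pos hr hr')).1)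
      (fun r t hr ht hrt => sub_nonneg.mp (hslice _ (fun _ => q) p r r t (fun _ => hq)
        (fun _ => hq) (fun _ => add_pos hq0 hq0) (hmem r t hr ht hrt) hrt (hmem r t hr ht hrt) hrt
        ht (add_pos hr hr)).2)
    refine ⟨c, hc, fun x hx => h (fun s => f (Function.update x p s)) ?_⟩
    intro s r t hs ht hst hr hrs hrt
    choose y hy hxy using fun j => hI.exists_abs_lt (x j) (hx j)
    have hy0 : ∀ j, 0 < y j := fun j => (abs_nonneg _).trans_lt (hxy j)
    have h1 := (hslice x y p s r t hx hy
      (fun j => by linarith [neg_abs_le (x j), hxy j]) hs hst (hmem r t hr ht hrt) hrt ht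
      (by linarith)).1
    have h2 := (hslice y (fun _ => q) p r r t hy (fun _ => hq) (fun j => add_pos (hy0 j) hq0)
      (hmem r t hr ht hrt) hrt (hmem r t hr ht hrt) hrt ht (add_pos hr hr)).1
    exact h1.trans h2
  choose c hc hfc using hslope
  refine ⟨c, f (fun _ => q) - ∑ p, c p * q, hc, fun x hx => ?_⟩
  have hpart : ∀ s : Finset σ,
      f (s.piecewise x fun _ => q) = f (fun _ => q) + ∑ p ∈ s, c p * (x p - q) := by
    intro s
    induction s using Finset.induction_on with
    | empty => simp
    | insert j s hj ih =>
      have hz : ∀ i, s.piecewise x (fun _ => q) i ∈ I := fun i => by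
        by_cases hi : i ∈ s
        · simpa [hi] using hx i
        · simpa [hi] using hq
      have h := hfc j _ hz q hq (x j) (hx j)
      have hself : Function.update (s.piecewise x fun _ => q) j q = s.piecewise x fun _ => q :=
        Function.update_eq_self_iff.mpr (by simp [hj])
      rw [hself, ih] at h
      rw [Finset.piecewise_insert, Finset.sum_insert hj]
      linear_combination h
  have h := hpart Finset.univ
  rw [Finset.piecewise_univ] at h
  rw [h]
  simp only [mul_sub, Finset.sum_sub_distrib]
  ring

end IncrementEquation

section TestMatrices

/-- The vectors `1` and `e_(i,false) - e_(i,true)`. -/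
def pairVec {ι : Type*} [DecidableEq ι] : Option ι → ι × Bool → ℝ
  | none, _ => 1
  | some i, (j, s) => if i = j then bif s then -1 else 1 else 0

variable {ι : Type*} [Fintype ι] [DecidableEq ι]

lemma pairVec_dotProduct_some (o : Option ι) (i : ι) :
    pairVec o ⬝ᵥ pairVec (some i) = if o = some i then 2 else 0 := by
  rcases o with _ | j
  · simp [dotProduct, pairVec, Fintype.sum_prod_type]
  · rcases eq_or_ne j i with rfl | h
    · simp [dotProduct, pairVec, Fintype.sum_prod_type]
      norm_num
    · simp [dotProduct, pairVec, Fintype.sum_prod_type, h]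

lemma pairVec_dotProduct_none (o : Option ι) :
    pairVec o ⬝ᵥ pairVec none = if o = none then (Fintype.card ι : ℝ) * 2 else 0 := by
  rcases o with _ | j
  · simp [dotProduct, pairVec]
  · simp [dotProduct, pairVec, Fintype.sum_prod_type]

/-- `α 𝟏𝟏ᵀ + ∑ᵢ βᵢ vᵢvᵢᵀ` where `vᵢ` is the difference of the two basis vectors of the pair `i`. -/
def pairMatrix (α : ℝ) (β : ι → ℝ) : Matrix (ι × Bool) (ι × Bool) ℝ :=
  rankOneSum (fun o : Option ι => o.elim α β) pairVec

lemma pairMatrix_apply (α : ℝ) (β : ι → ℝ) (a b : ι × Bool) :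
    pairMatrix α β a b =
      α + if a.1 = b.1 then (if a.2 = b.2 then β a.1 else -β a.1) else 0 := by
  obtain ⟨i, s⟩ := a
  obtain ⟨j, t⟩ := b
  rw [pairMatrix, rankOneSum_apply, Fintype.sum_option]
  rcases eq_or_ne i j with rfl | h
  · cases s <;> cases t <;> simp [pairVec]
  · simp [pairVec, h, h.symm]

lemma negEigCount_pairMatrix {α : ℝ} (hα : 0 ≤ α) (β : ι → ℝ) :
    negEigCount (pairMatrix α β) = Fintype.card {i // β i < 0} := by
  refine negEigCount_rankOneSum _ _ (fun i : {i // β i < 0} => some (i : ι))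
    (fun i j h => Subtype.ext (Option.some_injective _ h)) (fun i => i.2) ?_
    (fun i => pairVec (some i)) (fun i => by simp [pairVec_dotProduct_some])
    (fun i l h => by simp [pairVec_dotProduct_some, h])
  rintro (_ | i) h
  · exact absurd h (not_lt.mpr hα)
  · exact ⟨⟨i, h⟩, rfl⟩

lemma card_le_negEigCount_pairMatrix {α : ℝ} {β : ι → ℝ} (hβ : ∀ i, β i < 0) :
    Fintype.card ι ≤ negEigCount (pairMatrix α β) :=
  card_le_negEigCount_rankOneSum _ _ some (Option.some_injective _) hβ
    (fun i => pairVec (some i)) (fun i => by simp [pairVec_dotProduct_some])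
    (fun i l h => by simp [pairVec_dotProduct_some, h])

lemma card_succ_le_negEigCount_pairMatrix [Nonempty ι] {α : ℝ} {β : ι → ℝ} (hα : α < 0)
    (hβ : ∀ i, β i < 0) : Fintype.card ι + 1 ≤ negEigCount (pairMatrix α β) := by
  rw [← Fintype.card_option]
  refine card_le_negEigCount_rankOneSum _ _ id Function.injective_id
    (by rintro (_ | i); exacts [hα, hβ i]) pairVec ?_ ?_
  · rintro (_ | i)
    · simp [pairVec_dotProduct_none]
    · simp [pairVec_dotProduct_some]
  · rintro (_ | i) l h
    · simpa [pairVec_dotProduct_none] using h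
    · simpa [pairVec_dotProduct_some] using h

variable {G : Type*} [Fintype G] [DecidableEq G]

/-- The indicator vectors of the blocks, together with the vectors `pairVec` repeated in each
block. -/
def blockVec : G ⊕ Option ι → G × (ι × Bool) → ℝ
  | .inl g, a => if g = a.1 then 1 else 0
  | .inr o, a => pairVec o a.2

/-- `I ⊗ δ 𝟏𝟏ᵀ + 𝟏𝟏ᵀ ⊗ pairMatrix α β`. -/
def blockMatrix (δ α : ℝ) (β : ι → ℝ) : Matrix (G × (ι × Bool)) (G × (ι × Bool)) ℝ :=
  rankOneSum (Sum.elim (fun _ : G => δ) (fun o : Option ι => o.elim α β)) blockVec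

lemma blockMatrix_apply (δ α : ℝ) (β : ι → ℝ) (a b : G × (ι × Bool)) :
    blockMatrix δ α β a b = (if a.1 = b.1 then δ else 0) + pairMatrix α β a.2 b.2 := by
  rw [blockMatrix, rankOneSum_apply, Fintype.sum_sum_type]
  congr 1
  simp [blockVec]
  rcases eq_or_ne a.1 b.1 with h | h <;> simp [h, eq_comm]

lemma negEigCount_blockMatrix [Nonempty G] {δ α : ℝ} (hδ : 0 ≤ δ) (hα : 0 ≤ α) (β : ι → ℝ) :
    negEigCount (blockMatrix (G := G) δ α β) = Fintype.card {i // β i < 0} := by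
  obtain ⟨g₀⟩ := ‹Nonempty G›
  let z : {i // β i < 0} → G × (ι × Bool) → ℝ :=
    fun i a => if a.1 = g₀ then pairVec (some (i : ι)) a.2 else 0
  have hz : ∀ (o : Option ι) (i : {i // β i < 0}),
      blockVec (.inr o) ⬝ᵥ z i = pairVec o ⬝ᵥ pairVec (some (i : ι)) := by
    intro o i
    rw [dotProduct, Fintype.sum_prod_type, Finset.sum_eq_single g₀]
    · simp [z, blockVec, dotProduct]
    · intro g _ hg
      simp [z, hg]
    · simp
  have hzg : ∀ (g : G) (i : {i // β i < 0}), blockVec (.inl g) ⬝ᵥ z i = 0 := by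
    intro g i
    have h := pairVec_dotProduct_some none (i : ι)
    simp only [dotProduct, pairVec, one_mul, reduceCtorEq, if_false] at h
    rw [dotProduct, Fintype.sum_prod_type]
    refine Finset.sum_eq_zero fun g' _ => ?_
    by_cases hg : g' = g₀
    · simp only [z, blockVec, hg, if_true, ← Finset.mul_sum]
      exact mul_eq_zero_of_right _ h
    · simp [z, hg]
  refine negEigCount_rankOneSum _ _ (fun i : {i // β i < 0} => .inr (some (i : ι)))
    (fun i j h => Subtype.ext (Option.some_injective _ (Sum.inr_injective h))) (fun i => i.2) ?_
    z (fun i => by rw [hz]; simp [pairVec_dotProduct_some]) ?_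
  · rintro (g | _ | i) h
    · exact absurd h (not_lt.mpr hδ)
    · exact absurd h (not_lt.mpr hα)
    · exact ⟨⟨i, h⟩, rfl⟩
  · rintro i (g | o) h
    · exact hzg g i
    · rw [hz, pairVec_dotProduct_some, if_neg]
      exact fun ho => h (congrArg _ ho)

/-- If the blocks of `F` carry, on the pair `i₀`, the values `a', b'` on the block diagonal and
`a, b` off it, a negative value of `(a' - a) ± (b' - b)` produces many negative eigenvalues. -/
lemma card_le_negEigCount_of_blocks {r : Type*} [Fintype r] [DecidableEq r]
    {F : Matrix ((r × Bool) × (ι × Bool)) ((r × Bool) × (ι × Bool)) ℝ} (hF : F.IsSymm) (i₀ : ι)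
    {a b a' b' τ : ℝ} (hτ : τ * τ = 1)
    (hdiag : ∀ g t t', F (g, i₀, t) (g, i₀, t') = if t = t' then a' else b')
    (hoff : ∀ g h t t', g ≠ h → F (g, i₀, t) (h, i₀, t') = if t = t' then a else b)
    (hlt : (a' - a) + τ * (b' - b) < 0) : Fintype.card r ≤ negEigCount F := by
  let z : r → (r × Bool) × (ι × Bool) → ℝ := fun l x =>
    if l = x.1.1 then if i₀ = x.2.1 then (bif x.1.2 then -1 else 1) * (bif x.2.2 then τ else 1)
      else 0 else 0
  have hform : ∀ l l', z l ⬝ᵥ F *ᵥ z l' = ∑ s : Bool, ∑ t : Bool, ∑ s' : Bool, ∑ t' : Bool,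
      ((bif s then -1 else 1) * (bif t then τ else 1)) * (F ((l, s), i₀, t) ((l', s'), i₀, t') *
        ((bif s' then -1 else 1) * (bif t' then τ else 1))) := by
    intro l l'
    simp only [dotProduct, Matrix.mulVec, z, Fintype.sum_prod_type, Finset.mul_sum,
      ite_mul, mul_ite, zero_mul, mul_zero]
    simp
  refine card_le_negEigCount_of_orthogonal hF z (fun l => ?_) fun l l' hne => ?_
  · have h : z l ⬝ᵥ F *ᵥ z l = 4 * ((a' - a) + τ * (b' - b)) := by
      rw [hform]
      simp only [Fintype.sum_bool, cond_true, cond_false, hdiag,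
        hoff (l, true) (l, false) _ _ (by simp), hoff (l, false) (l, true) _ _ (by simp)]
      simp
      linear_combination (2 * (a' - a)) * hτ
    rw [h]
    linarith
  · rw [hform]
    have h : ∀ s s' t t', F ((l, s), i₀, t) ((l', s'), i₀, t') = if t = t' then a else b :=
      fun s s' t t' => hoff _ _ _ _ (by simp [hne])
    simp only [Fintype.sum_bool, cond_true, cond_false, h]
    ring

end TestMatrices

section Preservers

variable {σ : Type*}

/-- Applied to tuples of matrices over `I` with exactly `k` negative eigenvalues, the entrywise
transform by `f` gives a matrix with at most `k` negative eigenvalues. -/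
def PreservesNegLE (I : Set ℝ) (k : ℕ) (f : (σ → ℝ) → ℝ) : Prop :=
  ∀ (ι : Type) [Fintype ι] [DecidableEq ι] (B : σ → Matrix ι ι ℝ),
    (∀ p, (B p).IsSymm ∧ (∀ i j, B p i j ∈ I) ∧ negEigCount (B p) = k) →
    negEigCount (Matrix.of fun i j => f fun p => B p i j) ≤ k

lemma isSymm_entrywise {ι : Type*} {f : (σ → ℝ) → ℝ} {B : σ → Matrix ι ι ℝ}
    (hB : ∀ p, (B p).IsSymm) : (Matrix.of fun i j => f fun p => B p i j).IsSymm :=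
  Matrix.IsSymm.ext fun i j => congrArg f (funext fun p => (hB p).apply i j)

lemma IsTestDomain.exists_small {I : Set ℝ} (hI : IsTestDomain I) {x a : ℝ} (hx : x ∈ I)
    (hx0 : 0 < x) (ha : 0 < a) : ∃ ε, 0 < ε ∧ ε < a ∧ x + ε ∈ I := by
  obtain ⟨y, hy, hxy⟩ := hI.exists_abs_lt x hx
  rw [abs_of_pos hx0] at hxy
  have h : 0 < min (a / 2) (y - x) := lt_min (half_pos ha) (sub_pos.mpr hxy)
  have h1 := min_le_left (a / 2) (y - x)
  have h2 := min_le_right (a / 2) (y - x)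
  exact ⟨_, h, by linarith, hI.mem_of_pos_of_le y hy _ (by linarith) (by linarith)⟩

/-- A vector with prescribed first coordinate, small other coordinates, and exactly `k` negative
coordinates. -/
lemma exists_weights {k : ℕ} (hk : 1 ≤ k) (b : ℝ) {ε : ℝ} (hε : 0 < ε) :
    ∃ β : Fin (k + 1) → ℝ, β 0 = b ∧ (∀ i, i ≠ 0 → |β i| ≤ ε) ∧
      Fintype.card {i // β i < 0} = k := by
  let i₀ : Fin (k + 1) := if b < 0 then Fin.last k else 0
  have hlast : Fin.last k ≠ 0 := by
    rw [Ne, Fin.ext_iff, Fin.val_last, Fin.val_zero]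
    omega
  refine ⟨fun i => if i = 0 then b else if i = i₀ then 0 else -ε, by simp, fun i hi => ?_, ?_⟩
  · simp only [if_neg hi]
    split_ifs
    · simpa using hε.le
    · rw [abs_neg, abs_of_pos hε]
  · have h : ∀ i, (if i = 0 then b else if i = i₀ then 0 else -ε) < 0 ↔ i ≠ i₀ := by
      intro i
      by_cases hb : b < 0
      · rcases eq_or_ne i 0 with rfl | hi
        · simp [i₀, hb, hlast.symm]
        · by_cases hl : i = Fin.last k <;> simp [i₀, hb, hi, hl, hε, hlast]
      · rcases eq_or_ne i 0 with rfl | hi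
        · simp [i₀, hb]
        · simp [i₀, hb, hi, hε]
    simp only [h]
    rw [Fintype.card_subtype_compl]
    simp

/-- The basic inequality between increments of a preserver. -/
lemma PreservesNegLE.increments {I : Set ℝ} (hI : IsTestDomain I) {k : ℕ} (hk : 1 ≤ k)
    {f : (σ → ℝ) → ℝ} (hf : PreservesNegLE I k f) {x y δ : σ → ℝ} (hδ : ∀ p, 0 ≤ δ p)
    (hx : ∀ p, x p ∈ I) (hxδ : ∀ p, (x + δ) p ∈ I) (hy : ∀ p, y p ∈ I)
    (hyδ : ∀ p, (y + δ) p ∈ I) (hxy : ∀ p, 0 < x p + y p) {τ : ℝ} (hτ : τ * τ = 1) :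
    0 ≤ (f (x + δ) - f x) + τ * (f (y + δ) - f y) := by
  by_contra! hlt
  set α : σ → ℝ := fun p => (x p + y p) / 2 with hα
  have hα0 : ∀ p, 0 < α p := fun p => half_pos (hxy p)
  have hαδ : ∀ p, α p + δ p ∈ I := by
    intro p
    have h0 : 0 < α p + δ p := add_pos_of_pos_of_nonneg (hα0 p) (hδ p)
    rcases le_total (x p) (y p) with h | h
    · refine hI.mem_of_pos_of_le _ (hyδ p) _ h0 ?_
      simp only [hα, Pi.add_apply]; linarith
    · refine hI.mem_of_pos_of_le _ (hxδ p) _ h0 ?_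
      simp only [hα, Pi.add_apply]; linarith
  choose ε hε0 hεα hεI using fun p =>
    hI.exists_small (hαδ p) (add_pos_of_pos_of_nonneg (hα0 p) (hδ p)) (hα0 p)
  choose β hβ0 hβε hβk using fun p => exists_weights hk ((x p - y p) / 2) (hε0 p)
  let B : σ → Matrix ((Fin (k + 1) × Bool) × (Fin (k + 1) × Bool))
    ((Fin (k + 1) × Bool) × (Fin (k + 1) × Bool)) ℝ := fun p => blockMatrix (δ p) (α p) (β p)
  have hsymm : ∀ p, (B p).IsSymm := fun p => rankOneSum_isSymm _ _
  have hentry : ∀ p g h t t', B p (g, 0, t) (h, 0, t') =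
      (if g = h then δ p else 0) + (if t = t' then x p else y p) := by
    intro p g h t t'
    simp only [B, blockMatrix_apply, pairMatrix_apply, hβ0, if_true]
    congr 1
    split_ifs <;> simp only [hα] <;> ring
  have hmem : ∀ p a b, B p a b ∈ I := by
    rintro p ⟨g, i, t⟩ ⟨h, j, t'⟩
    have hsmall : ∀ w, |w| ≤ ε p → (if g = h then δ p else 0) + (α p + w) ∈ I := by
      intro w hw
      have h1 := (abs_le.mp hw).1
      have h2 := (abs_le.mp hw).2
      have h3 := hεα p
      have h4 := hδ p
      refine hI.mem_of_pos_of_le _ (hεI p) _ ?_ ?_ <;> split_ifs <;> linarith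
    by_cases hij : i = j
    · subst hij
      by_cases hi : i = 0
      · subst hi
        rw [hentry]
        have h1 := hx p
        have h2 := hy p
        have h3 := hxδ p
        have h4 := hyδ p
        rw [Pi.add_apply, add_comm] at h3 h4
        split_ifs <;> simpa
      · simp only [B, blockMatrix_apply, pairMatrix_apply, if_true]
        apply hsmall
        split_ifs
        · exact hβε p i hi
        · rw [abs_neg]; exact hβε p i hi
    · simp only [B, blockMatrix_apply, pairMatrix_apply, hij, if_false]
      apply hsmall
      simpa using (hε0 p).le
  have hle := hf _ B fun p => ⟨hsymm p, hmem p,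
    (negEigCount_blockMatrix (hδ p) (hα0 p).le (β p)).trans (hβk p)⟩
  have hge := card_le_negEigCount_of_blocks (r := Fin (k + 1)) (isSymm_entrywise (f := f) hsymm) 0
    (a := f x) (b := f y) (a' := f (x + δ)) (b' := f (y + δ)) hτ ?_ ?_ hlt
  · rw [Fintype.card_fin] at hge
    omega
  · intro g t t'
    simp only [Matrix.of_apply, hentry, if_true]
    split_ifs <;> exact congrArg f (add_comm _ _)
  · intro g h t t' hgh
    simp only [Matrix.of_apply, hentry, hgh, if_false, zero_add]
    split_ifs <;> rfl

variable [Fintype σ]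

lemma PreservesNegLE.affine [DecidableEq σ] {I : Set ℝ} (hI : IsTestDomain I) {k : ℕ} (hk : 1 ≤ k)
    {f : (σ → ℝ) → ℝ} (hf : PreservesNegLE I k f) :
    ∃ (c : σ → ℝ) (d : ℝ), (∀ p, 0 ≤ c p) ∧
      ∀ x : σ → ℝ, (∀ p, x p ∈ I) → f x = ∑ p, c p * x p + d := by
  refine hI.affine_of_increments fun x y δ hδ hx hxδ hy hyδ hxy => ?_
  have h1 := hf.increments hI hk hδ hx hxδ hy hyδ hxy (τ := 1) (by norm_num)
  have h2 := hf.increments hI hk hδ hx hxδ hy hyδ hxy (τ := -1) (by norm_num)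
  have h3 := hf.increments hI hk hδ hy hyδ hx hxδ (fun p => by rw [add_comm]; exact hxy p)
    (τ := -1) (by norm_num)
  exact ⟨by linarith, by linarith⟩

lemma pairMatrix_mem {ι : Type*} [Fintype ι] [DecidableEq ι] {I : Set ℝ} (hI : IsTestDomain I)
    {α : ℝ} (hα : 0 < α) (hαI : 2 * α ∈ I) {β : ι → ℝ} (hβ : ∀ i, |β i| < α) (a b : ι × Bool) :
    pairMatrix α β a b ∈ I := by
  have h := abs_lt.mp (hβ a.1)
  rw [pairMatrix_apply]
  refine hI.mem_of_pos_of_le _ hαI _ ?_ ?_ <;> split_ifs <;> linarith [h.1, h.2]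

lemma sum_mul_pairMatrix_add {ι : Type*} [Fintype ι] [DecidableEq ι] (c : σ → ℝ) (d α : ℝ)
    (β : σ → ι → ℝ) (a b : ι × Bool) :
    ∑ p, c p * pairMatrix α (β p) a b + d =
      pairMatrix ((∑ p, c p) * α + d) (fun i => ∑ p, c p * β p i) a b := by
  simp only [pairMatrix_apply, mul_add, Finset.sum_add_distrib, ← Finset.sum_mul]
  split_ifs
  · ring
  · simp only [mul_neg, Finset.sum_neg_distrib]
    ring
  · simp

/-- A preserver is an affine function of a single variable. -/
lemma PreservesNegLE.exists_affine [DecidableEq σ] {I : Set ℝ} (hI : IsTestDomain I) {k : ℕ} (hk : 1 ≤ k)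
    [Nonempty σ] {f : (σ → ℝ) → ℝ} (hf : PreservesNegLE I k f) :
    ∃ (p₀ : σ) (c d : ℝ), (∀ x : σ → ℝ, (∀ p, x p ∈ I) → f x = c * x p₀ + d) ∧
      (c = 0 ∨ (0 < c ∧ 0 ≤ d)) := by
  obtain ⟨c, d, hc, hfc⟩ := hf.affine hI hk
  obtain ⟨q, hq, hq0⟩ := hI.exists_pos
  have key : ∀ {ι : Type} [Fintype ι] [DecidableEq ι] (α : ℝ) (β : σ → ι → ℝ), 0 < α →
      2 * α ∈ I → (∀ p i, |β p i| < α) → (∀ p, Fintype.card {i // β p i < 0} = k) →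
      negEigCount (pairMatrix ((∑ p, c p) * α + d) (fun i => ∑ p, c p * β p i)) ≤ k := by
    intro ι _ _ α β hα hαI hβ hcard
    have h := hf _ (fun p => pairMatrix α (β p)) fun p =>
      ⟨rankOneSum_isSymm _ _, pairMatrix_mem hI hα hαI (hβ p),
        (negEigCount_pairMatrix hα.le _).trans (hcard p)⟩
    convert h using 2
    ext a b
    rw [Matrix.of_apply, hfc _ fun p => pairMatrix_mem hI hα hαI (hβ p) a b,
      sum_mul_pairMatrix_add]
  by_cases hall : ∀ p, c p = 0
  · exact ⟨Classical.arbitrary σ, 0, d, fun x hx => by rw [hfc x hx]; simp [hall], Or.inl rfl⟩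
  push Not at hall
  obtain ⟨p₀, hp₀⟩ := hall
  have hp₀' : 0 < c p₀ := lt_of_le_of_ne (hc p₀) (Ne.symm hp₀)
  have hother : ∀ p, p ≠ p₀ → c p = 0 := by
    intro p hp
    by_contra hcp
    have hcp' : 0 < c p := lt_of_le_of_ne (hc p) (Ne.symm hcp)
    let β : σ → Bool × Fin k → ℝ := fun p' i => if i.1 = decide (p' = p₀) then -(q / 4) else 0
    have hβneg : ∀ p' i, β p' i < 0 ↔ i.1 = decide (p' = p₀) := by
      intro p' i
      by_cases h : i.1 = decide (p' = p₀) <;> simp [β, h, hq0]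
    have hβle : ∀ p' i, β p' i ≤ 0 := by
      intro p' i
      simp only [β]
      split_ifs <;> linarith
    have hcard : ∀ s : Bool, Fintype.card {i : Bool × Fin k // i.1 = s} = k := by
      intro s
      have e : {i : Bool × Fin k // i.1 = s} ≃ Fin k :=
        { toFun := fun i => i.1.2
          invFun := fun j => ⟨(s, j), rfl⟩
          left_inv := by rintro ⟨⟨_, j⟩, rfl⟩; rfl
          right_inv := fun _ => rfl }
      rw [Fintype.card_congr e, Fintype.card_fin]
    have hle := key (q / 2) β (by linarith) (by rwa [mul_div_cancel₀ q two_ne_zero])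
      (fun p' i => by simp only [β]; split_ifs <;> rw [abs_lt] <;> constructor <;> linarith)
      (fun p' => by simp only [hβneg]; exact hcard _)
    have hge := card_le_negEigCount_pairMatrix (α := (∑ p, c p) * (q / 2) + d)
      (β := fun i => ∑ p, c p * β p i) (by
        rintro ⟨s, i⟩
        refine Finset.sum_neg' (fun p' _ => mul_nonpos_of_nonneg_of_nonpos (hc p') (hβle _ _)) ?_
        cases s
        · exact ⟨p, Finset.mem_univ _,
            mul_neg_of_pos_of_neg hcp' ((hβneg _ _).mpr (by simp [hp]))⟩
        · exact ⟨p₀, Finset.mem_univ _, mul_neg_of_pos_of_neg hp₀' ((hβneg _ _).mpr (by simp))⟩)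
    rw [Fintype.card_prod, Fintype.card_bool, Fintype.card_fin] at hge
    omega
  have hsum : ∀ w : σ → ℝ, ∑ p, c p * w p = c p₀ * w p₀ := fun w =>
    Finset.sum_eq_single p₀ (fun p _ hp => by rw [hother p hp, zero_mul]) (by simp)
  refine ⟨p₀, c p₀, d, fun x hx => by rw [hfc x hx, hsum], Or.inr ⟨hp₀', ?_⟩⟩
  by_contra! hd
  have hcsum : ∑ p, c p = c p₀ := by simpa using hsum fun _ => 1
  set α := min (q / 2) (-d / c p₀ / 2) with hα
  have hdc : 0 < -d / c p₀ := div_pos (neg_pos.mpr hd) hp₀'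
  have hα0 : 0 < α := lt_min (half_pos hq0) (half_pos hdc)
  have hαq : α ≤ q / 2 := min_le_left _ _
  have hαd : c p₀ * α + d < 0 := by
    have h : α < -d / c p₀ := (min_le_right _ _).trans_lt (half_lt_self hdc)
    rw [lt_div_iff₀ hp₀'] at h
    linarith
  have hle := key (ι := Fin k) α (fun _ _ => -(α / 2)) hα0
    (hI.mem_of_pos_of_le q hq _ (by linarith) (by linarith))
    (fun _ _ => by rw [abs_neg, abs_of_pos (half_pos hα0)]; linarith)
    (fun _ => by
      have h : -(α / 2) < 0 := by linarith
      simp [h])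
  rw [hcsum] at hle
  have : Nonempty (Fin k) := ⟨⟨0, hk⟩⟩
  have hge := card_succ_le_negEigCount_pairMatrix (ι := Fin k) hαd
    (β := fun _ => ∑ p, c p * -(α / 2)) (fun _ => by
      rw [hsum fun _ => -(α / 2)]
      exact mul_neg_of_pos_of_neg hp₀' (by linarith))
  rw [Fintype.card_fin] at hge
  omega

end Preservers

section Shift

/-- For `true` and `false` the vectors `1` and `1 + e`, where `e` is the indicator of an additional
basis vector; the other vectors are those of `pairVec`. -/
def shiftVec {κ : Type*} [DecidableEq κ] : Bool ⊕ κ → Bool ⊕ κ × Bool → ℝ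
  | .inl false, .inl s => bif s then 2 else 1
  | .inl false, .inr _ => 1
  | .inl true, _ => 1
  | .inr _, .inl _ => 0
  | .inr j, .inr x => pairVec (some j) x

/-- There are matrices with `k + 1` negative eigenvalues, one of which is lost when a prescribed
positive constant is added to all entries. -/
lemma IsTestDomain.exists_shift_matrix {I : Set ℝ} (hI : IsTestDomain I) (k : ℕ) {η : ℝ}
    (hη : 0 < η) :
    ∃ B : Matrix (Bool ⊕ Fin k × Bool) (Bool ⊕ Fin k × Bool) ℝ,
      B.IsSymm ∧ (∀ i j, B i j ∈ I) ∧ negEigCount B = k + 1 ∧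
      ∀ c d, 0 < c → c * η ≤ d → negEigCount (Matrix.of fun i j => c * B i j + d) ≤ k := by
  obtain ⟨q, hq, hq0⟩ := hI.exists_pos
  set t := q / 5 with ht
  have ht0 : 0 < t := by positivity
  set s := min (t / 4) η with hs
  have hs0 : 0 < s := lt_min (by positivity) hη
  have hst : s ≤ t / 4 := min_le_left _ _
  have hsη : s ≤ η := min_le_right _ _
  let w : Bool ⊕ Fin k → ℝ := Sum.elim (fun b => bif b then -s else t) fun _ => -(t / 4)
  have hentry : ∀ x y, ∑ j : Fin k, w (.inr j) * (shiftVec (.inr j) x * shiftVec (.inr j) y) ∈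
      Set.Icc (-(t / 4)) (t / 4) := by
    have ht4 : 0 ≤ t / 4 := by positivity
    rintro (b | x) (b' | y)
    · simp [shiftVec, ht4]
    · simp [shiftVec, ht4]
    · simp [shiftVec, ht4]
    · have h := pairMatrix_apply 0 (fun _ : Fin k => -(t / 4)) x y
      rw [pairMatrix, rankOneSum_apply, Fintype.sum_option] at h
      simp only [Option.elim, zero_mul, zero_add] at h
      simp only [w, shiftVec, Sum.elim_inr]
      rw [h]
      split_ifs <;> constructor <;> linarith
  refine ⟨rankOneSum w shiftVec, rankOneSum_isSymm _ _, fun x y => ?_, ?_, fun c d hc hcd => ?_⟩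
  · have h := hentry x y
    rw [rankOneSum_apply, Fintype.sum_sum_type]
    refine hI.mem_of_pos_of_le q hq _ ?_ ?_ <;>
    · rcases x with (_ | _) | x <;> rcases y with (_ | _) | y <;>
      simp only [w, shiftVec, Fintype.sum_bool, Sum.elim_inl, cond_true, cond_false] at h ⊢ <;>
      linarith [h.1, h.2]
  · let z : Option (Fin k) → Bool ⊕ Fin k × Bool → ℝ := fun o =>
      o.elim (Sum.elim (fun b => bif b then -1 else 2) fun _ => 0)
        fun j => Sum.elim (fun _ => 0) (pairVec (some j))
    have hdot : ∀ (o : Option (Fin k)) (j : Fin k),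
        ∑ x, pairVec o x * pairVec (some j) x = if o = some j then 2 else 0 :=
      pairVec_dotProduct_some
    have hdot' : ∀ j : Fin k, ∑ x, pairVec (some j) x = 0 := fun j => by
      simpa [pairVec] using hdot none j
    have h := negEigCount_rankOneSum w shiftVec
      (fun o : Option (Fin k) => o.elim (.inl true) .inr) ?_ ?_ ?_ z ?_ ?_
    · rw [h, Fintype.card_option, Fintype.card_fin]
    · rintro (_ | i) (_ | j) h <;> simp_all
    · rintro (_ | i) <;> simp [w, hs0, ht0]
    · rintro ((_ | _) | j) h
      · exact absurd h (not_lt.mpr ht0.le)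
      · exact ⟨none, rfl⟩
      · exact ⟨some j, rfl⟩
    · rintro (_ | i)
      · simp [dotProduct, z, shiftVec]
        norm_num
      · simp [dotProduct, z, shiftVec, hdot]
    · rintro (_ | i) ((_ | _) | j) h
      · simp [dotProduct, z, shiftVec]
      · exact absurd rfl h
      · simp [dotProduct, z, shiftVec]
      · simp [dotProduct, z, shiftVec, hdot']
      · simp [dotProduct, z, shiftVec, hdot']
      · have hij : j ≠ i := fun hji => h (congrArg _ hji)
        simp [dotProduct, z, shiftVec, hdot, hij]
  · have hsum : (Matrix.of fun i j => c * rankOneSum w shiftVec i j + d) = rankOneSum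
        (Sum.elim (fun b => bif b then d - c * s else c * t) fun _ => -(c * (t / 4)))
        (shiftVec (κ := Fin k)) := by
      ext x y
      simp only [Matrix.of_apply, rankOneSum_apply, Fintype.sum_sum_type, w, Sum.elim_inl,
        Sum.elim_inr, Fintype.sum_bool, cond_true, cond_false, shiftVec, mul_add, Finset.mul_sum,
        neg_mul, mul_neg, ← mul_assoc]
      ring
    rw [hsum]
    refine (negEigCount_rankOneSum_le _ _).trans ?_
    have hneg : -(c * (t / 4)) < 0 := neg_neg_of_pos (by positivity)
    refine (Fintype.card_le_of_surjective (fun j : Fin k => ⟨.inr j, hneg⟩) ?_).trans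
      (Fintype.card_fin k).le
    rintro ⟨(_ | _) | j, h⟩
    · exact absurd h (not_lt.mpr (mul_pos hc ht0).le)
    · exact absurd h (not_lt.mpr
        (sub_nonneg.mpr ((mul_le_mul_of_nonneg_left hsη hc.le).trans hcd)))
    · exact ⟨j, rfl⟩

end Shift

section Domains

variable {ρ : EReal}

lemma isTestDomain_symmetric (hρ : 0 < ρ) :
    IsTestDomain {x : ℝ | -ρ < (x : EReal) ∧ (x : EReal) < ρ} where
  nonempty := ⟨0, by simpa using hρ, by simpa using hρ⟩
  ordConnected := ⟨fun _ hx _ hy _ hz =>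
    ⟨hx.1.trans_le (EReal.coe_le_coe_iff.mpr hz.1),
      (EReal.coe_le_coe_iff.mpr hz.2).trans_lt hy.2⟩⟩
  exists_abs_lt := by
    rintro x ⟨hx1, hx2⟩
    have h : ((|x| : ℝ) : EReal) < ρ := by
      rcases abs_cases x with ⟨h, -⟩ | ⟨h, -⟩ <;> rw [h]
      · exact hx2
      · rw [EReal.coe_neg]
        exact EReal.neg_lt_comm.mp hx1
    obtain ⟨y, hxy, hy⟩ := EReal.lt_iff_exists_real_btwn.mp h
    rw [EReal.coe_lt_coe_iff] at hxy
    refine ⟨y, ⟨?_, hy⟩, hxy⟩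
    have hy0 : (0 : ℝ) < y := (abs_nonneg x).trans_lt hxy
    have hneg : -ρ < 0 := by simpa using hρ
    exact hneg.trans (EReal.coe_pos.mpr hy0)
  mem_of_pos_of_le := by
    rintro x ⟨hx1, hx2⟩ y hy hyx
    refine ⟨?_, (EReal.coe_le_coe_iff.mpr hyx).trans_lt hx2⟩
    have hneg : -ρ < 0 := by simpa using hρ
    exact hneg.trans (EReal.coe_pos.mpr hy)

lemma isTestDomain_pos (hρ : 0 < ρ) : IsTestDomain {x : ℝ | 0 < x ∧ (x : EReal) < ρ} where
  nonempty := by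
    obtain ⟨x, hx0, hx⟩ := EReal.lt_iff_exists_real_btwn.mp hρ
    exact ⟨x, by exact_mod_cast hx0, hx⟩
  ordConnected := ⟨fun _ hx _ hy _ hz =>
    ⟨hx.1.trans_le hz.1, (EReal.coe_le_coe_iff.mpr hz.2).trans_lt hy.2⟩⟩
  exists_abs_lt := by
    rintro x ⟨hx1, hx2⟩
    obtain ⟨y, hxy, hy⟩ := EReal.lt_iff_exists_real_btwn.mp hx2
    rw [EReal.coe_lt_coe_iff] at hxy
    exact ⟨y, ⟨hx1.trans hxy, hy⟩, by rwa [abs_of_pos hx1]⟩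
  mem_of_pos_of_le := fun _ hx _ hy hyx => ⟨hy, (EReal.coe_le_coe_iff.mpr hyx).trans_lt hx.2⟩

lemma isTestDomain_nonneg (hρ : 0 < ρ) : IsTestDomain {x : ℝ | 0 ≤ x ∧ (x : EReal) < ρ} where
  nonempty := ⟨0, le_rfl, by simpa using hρ⟩
  ordConnected := ⟨fun _ hx _ hy _ hz =>
    ⟨hx.1.trans hz.1, (EReal.coe_le_coe_iff.mpr hz.2).trans_lt hy.2⟩⟩
  exists_abs_lt := by
    rintro x ⟨hx1, hx2⟩
    obtain ⟨y, hxy, hy⟩ := EReal.lt_iff_exists_real_btwn.mp hx2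
    rw [EReal.coe_lt_coe_iff] at hxy
    exact ⟨y, ⟨hx1.trans hxy.le, hy⟩, by rwa [abs_of_nonneg hx1]⟩
  mem_of_pos_of_le := fun _ hx _ hy hyx => ⟨hy.le, (EReal.coe_le_coe_iff.mpr hyx).trans_lt hx.2⟩

end Domains

section Transforms

variable {n : Type*} [Fintype n] [DecidableEq n]

lemma negEigCount_le_card {A : Matrix n n ℝ} (hA : A.IsSymm) :
    negEigCount A ≤ Fintype.card n :=
  negEigCount_le_of_nonneg_on_ker hA LinearMap.id fun x hx => by
    rw [LinearMap.id_apply] at hx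
    simp [hx]

lemma negEigCount_affine_le {A : Matrix n n ℝ} (hA : A.IsSymm) {c d : ℝ} (hc : 0 ≤ c)
    (hd : 0 ≤ d) : negEigCount (Matrix.of fun i j => c * A i j + d) ≤ negEigCount A := by
  refine negEigCount_le_of_form_le (Matrix.IsSymm.ext fun i j => ?_) hA LinearMap.id hc fun x => ?_
  · simp [hA.apply i j]
  · have h : (Matrix.of fun i j => c * A i j + d) *ᵥ x = c • (A *ᵥ x) + fun _ => d * ∑ j, x j := by
      ext i
      simp [Matrix.mulVec, dotProduct, add_mul, Finset.sum_add_distrib, Finset.mul_sum, mul_assoc]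
    rw [h, dotProduct_add, dotProduct_smul, LinearMap.id_apply, smul_eq_mul]
    refine le_add_of_nonneg_right ?_
    rw [dotProduct, ← Finset.sum_mul, mul_left_comm]
    exact mul_nonneg hd (mul_self_nonneg _)

lemma negEigCount_mul_left {A : Matrix n n ℝ} (hA : A.IsSymm) {c : ℝ} (hc : 0 < c) :
    negEigCount (Matrix.of fun i j => c * A i j) = negEigCount A := by
  have hcA : (Matrix.of fun i j => c * A i j).IsSymm :=
    Matrix.IsSymm.ext fun i j => by simp [hA.apply i j]
  refine le_antisymm (by simpa using negEigCount_affine_le hA hc.le le_rfl) ?_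
  have h := negEigCount_affine_le hcA (inv_nonneg.mpr hc.le) le_rfl
  simp only [Matrix.of_apply, inv_mul_cancel_left₀ hc.ne', add_zero] at h
  exact h

omit [Fintype n] [DecidableEq n] in
lemma const_eq_rankOneSum (d : ℝ) :
    (Matrix.of fun _ _ : n => d) = rankOneSum (fun _ : Unit => d) fun _ _ => 1 := by
  ext i j
  simp [rankOneSum_apply]

lemma negEigCount_const_le_one (d : ℝ) : negEigCount (Matrix.of fun _ _ : n => d) ≤ 1 := by
  rw [const_eq_rankOneSum]
  exact (negEigCount_rankOneSum_le _ _).trans (Fintype.card_subtype_le _)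

lemma negEigCount_const_of_nonneg {d : ℝ} (hd : 0 ≤ d) :
    negEigCount (Matrix.of fun _ _ : n => d) = 0 := by
  rw [const_eq_rankOneSum, ← Nat.le_zero]
  refine (negEigCount_rankOneSum_le _ _).trans ?_
  simp [not_lt.mpr hd]

lemma negEigCount_const_of_neg [Nonempty n] {d : ℝ} (hd : d < 0) :
    negEigCount (Matrix.of fun _ _ : n => d) = 1 := by
  rw [const_eq_rankOneSum]
  exact negEigCount_rankOneSum (fun _ : Unit => d) (fun _ _ => 1) id Function.injective_id
    (fun _ => hd) (fun l _ => ⟨l, rfl⟩) (fun _ _ => 1) (by simp [dotProduct])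
    (fun i l h => absurd (Subsingleton.elim l i) h)

/-- Statements about entrywise transforms of matrices indexed by `Fin n` hold for all finite index
types. -/
lemma negEigCount_entrywise_of_fin {σ : Type*} {I : Set ℝ} {k : ℕ} {f : (σ → ℝ) → ℝ}
    {P : ℕ → Prop} [Nonempty σ]
    (H : ∀ n : ℕ, k ≤ n → ∀ B : σ → Matrix (Fin n) (Fin n) ℝ,
      (∀ p, (B p).IsSymm ∧ (∀ i j, B p i j ∈ I) ∧ negEigCount (B p) = k) →
      P (negEigCount (Matrix.of fun i j => f fun p => B p i j)))
    (B : σ → Matrix n n ℝ)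
    (hB : ∀ p, (B p).IsSymm ∧ (∀ i j, B p i j ∈ I) ∧ negEigCount (B p) = k) :
    P (negEigCount (Matrix.of fun i j => f fun p => B p i j)) := by
  have e : Fin (Fintype.card n) ≃ n := (Fintype.equivFin n).symm
  have hk : k ≤ Fintype.card n := by
    obtain ⟨p⟩ := ‹Nonempty σ›
    exact (hB p).2.2 ▸ negEigCount_le_card (hB p).1
  have h := H _ hk (fun p => (B p).submatrix e e) fun p =>
    ⟨(hB p).1.submatrix e, fun i j => (hB p).2.1 _ _,
      (negEigCount_reindex (hB p).1 e).trans (hB p).2.2⟩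
  rwa [← negEigCount_reindex (isSymm_entrywise fun p => (hB p).1) e]

end Transforms

/-- Corollary 4.3: for `I` one of `(-ρ,ρ)`, `(0,ρ)`, `[0,ρ)` and positive integers
`k`, `m`:
(1) `f[-]` sends `m`-tuples of matrices in `S_n^(k)(I)` to `S_n^(k)` for all `n ≥ k` iff
`f(x) = c x_{p₀}` with `c > 0`, or `k = 1` and `f ≡ -c` with `c > 0`;
(2) `f[-]` sends `m`-tuples of matrices in `S̄_n^(k)(I)` to `S̄_n^(k)` for all `n ≥ k` iff
`f(x) = c x_{p₀} + d` with either `c = 0` and `d ∈ ℝ`, or `c > 0` and `d ≥ 0`. -/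
theorem multivar_preserver_corollary (ρ : EReal) (hρ : 0 < ρ) (I : Set ℝ)
    (hI : I = {x : ℝ | -ρ < (x : EReal) ∧ (x : EReal) < ρ} ∨
          I = {x : ℝ | 0 < x ∧ (x : EReal) < ρ} ∨
          I = {x : ℝ | 0 ≤ x ∧ (x : EReal) < ρ})
    (k m : ℕ) (hk : 1 ≤ k) (hm : 1 ≤ m) (f : (Fin m → ℝ) → ℝ) :
    ((∀ n : ℕ, k ≤ n → ∀ B : Fin m → Matrix (Fin n) (Fin n) ℝ,
        (∀ p, (B p).IsSymm ∧ (∀ i j, B p i j ∈ I) ∧ negEigCount (B p) = k) →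
        ((Matrix.of fun i j => f fun p => B p i j).IsSymm ∧
         negEigCount (Matrix.of fun i j => f fun p => B p i j) = k)) ↔
      ((∃ (p₀ : Fin m) (c : ℝ), 0 < c ∧
          ∀ x : Fin m → ℝ, (∀ p, x p ∈ I) → f x = c * x p₀) ∨
       (k = 1 ∧ ∃ c : ℝ, 0 < c ∧ ∀ x : Fin m → ℝ, (∀ p, x p ∈ I) → f x = -c))) ∧
    ((∀ n : ℕ, k ≤ n → ∀ B : Fin m → Matrix (Fin n) (Fin n) ℝ,
        (∀ p, (B p).IsSymm ∧ (∀ i j, B p i j ∈ I) ∧ negEigCount (B p) ≤ k) →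
        ((Matrix.of fun i j => f fun p => B p i j).IsSymm ∧
         negEigCount (Matrix.of fun i j => f fun p => B p i j) ≤ k)) ↔
      (∃ (p₀ : Fin m) (c d : ℝ),
        (∀ x : Fin m → ℝ, (∀ p, x p ∈ I) → f x = c * x p₀ + d) ∧
        (c = 0 ∨ (0 < c ∧ 0 ≤ d)))) := by
  have hdom : IsTestDomain I := by
    rcases hI with rfl | rfl | rfl
    exacts [isTestDomain_symmetric hρ, isTestDomain_pos hρ, isTestDomain_nonneg hρ]
  have : Nonempty (Fin m) := ⟨⟨0, hm⟩⟩
  refine ⟨⟨fun H => ?_, ?_⟩, ⟨fun H => ?_, ?_⟩⟩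
  · have H' := fun n hn B hB => (H n hn B hB).2
    have hle : PreservesNegLE I k f := fun ι _ _ B hB =>
      (negEigCount_entrywise_of_fin (P := (· = k)) H' B hB).le
    obtain ⟨p₀, c, d, hf, hc⟩ := hle.exists_affine hdom hk
    obtain ⟨l, rfl⟩ : ∃ l, k = l + 1 := ⟨k - 1, by omega⟩
    rcases hc with rfl | ⟨hc, hd⟩
    · right
      obtain ⟨B, hBs, hBI, hBk, -⟩ := hdom.exists_shift_matrix l one_pos
      have h := negEigCount_entrywise_of_fin (P := (· = l + 1)) H' (fun _ => B)
        fun _ => ⟨hBs, hBI, hBk⟩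
      have hconst : (Matrix.of fun i j => f fun _ => B i j) = Matrix.of fun _ _ => d := by
        ext i j
        rw [Matrix.of_apply, hf _ fun _ => hBI i j, zero_mul, zero_add, Matrix.of_apply]
      rw [hconst] at h
      have hd : d < 0 := by
        by_contra! hd
        rw [negEigCount_const_of_nonneg hd] at h
        omega
      refine ⟨?_, -d, neg_pos.mpr hd, fun x hx => by rw [hf x hx]; ring⟩
      rw [negEigCount_const_of_neg hd] at h
      exact h.symm
    · left
      refine ⟨p₀, c, hc, fun x hx => ?_⟩
      suffices hd0 : d = 0 by rw [hf x hx, hd0, add_zero]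
      by_contra hd0
      have hdpos : 0 < d := lt_of_le_of_ne hd (Ne.symm hd0)
      obtain ⟨B, hBs, hBI, hBk, hshift⟩ := hdom.exists_shift_matrix l (div_pos hdpos hc)
      have h := negEigCount_entrywise_of_fin (P := (· = l + 1)) H' (fun _ => B)
        fun _ => ⟨hBs, hBI, hBk⟩
      have haff : (Matrix.of fun i j => f fun _ => B i j) =
          Matrix.of fun i j => c * B i j + d := by
        ext i j
        rw [Matrix.of_apply, hf _ fun _ => hBI i j, Matrix.of_apply]
      rw [haff] at h
      have h' := hshift c d hc (mul_div_cancel₀ d hc.ne').le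
      omega
  · rintro (⟨p₀, c, hc, hf⟩ | ⟨rfl, c, hc, hf⟩) n hn B hB
    · refine ⟨isSymm_entrywise fun p => (hB p).1, ?_⟩
      have h : (Matrix.of fun i j => f fun p => B p i j) = Matrix.of fun i j => c * B p₀ i j := by
        ext i j
        exact hf _ fun p => (hB p).2.1 i j
      rw [h, negEigCount_mul_left (hB p₀).1 hc, (hB p₀).2.2]
    · refine ⟨isSymm_entrywise fun p => (hB p).1, ?_⟩
      have h : (Matrix.of fun i j => f fun p => B p i j) = Matrix.of fun _ _ => -c := by
        ext i j
        exact hf _ fun p => (hB p).2.1 i j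
      have : Nonempty (Fin n) := ⟨⟨0, hn⟩⟩
      rw [h, negEigCount_const_of_neg (neg_lt_zero.mpr hc)]
  · refine PreservesNegLE.exists_affine hdom hk fun ι _ _ B hB =>
      negEigCount_entrywise_of_fin (P := (· ≤ k)) (fun n hn B hB => ?_) B hB
    exact (H n hn B fun p => ⟨(hB p).1, (hB p).2.1, (hB p).2.2.le⟩).2
  · rintro ⟨p₀, c, d, hf, hc⟩ n hn B hB
    refine ⟨isSymm_entrywise fun p => (hB p).1, ?_⟩
    have h : (Matrix.of fun i j => f fun p => B p i j) =
        Matrix.of fun i j => c * B p₀ i j + d := by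
      ext i j
      exact hf _ fun p => (hB p).2.1 i j
    rw [h]
    rcases hc with rfl | ⟨hc, hd⟩
    · simp only [zero_mul, zero_add]
      exact (negEigCount_const_le_one d).trans hk
    · exact (negEigCount_affine_le (hB p₀).1 hc.le hd).trans (hB p₀).2.2
end

section
/- Let I = (−ρ, ρ), (0, ρ) or [0, ρ), where 0 < ρ ≤ ∞, let 𝐤 = (k₁, …, k_m) ∈ ℤ₊^m, set k_max := max{1, k₁, …, k_m}, and let l be a non-negative integer. Suppose f : I^m → ℝ is such that for every n ≥ k_max and every m-tuple (B^{(1)}, …, B^{(m)}) with B^{(p)} an n×n real symmetric matrix with entries in I having exactly k_p negative eigenvalues for each p, the matrix f[B^{(1)}, …, B^{(m)}] has at most l negative eigenvalues. Then f is represented on I^m by a convergent power series Σ_{α ∈ ℤ₊^m} c_α x^α with c_α ≥ 0 for all α ∈ ℤ₊^m \ {𝟎}. -/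
open Filter Topology

/-- The quadratic form of `A` in an orthonormal eigenbasis. -/
lemma exists_orthogonal_quadForm {n : Type*} [Fintype n] [DecidableEq n] {A : Matrix n n ℝ}
    (hA : A.IsHermitian) : ∃ U : Matrix n n ℝ, U.transpose * U = 1 ∧ ∀ u : n → ℝ,
      ∑ i, ∑ j, u i * u j * A i j = ∑ i, hA.eigenvalues i * (U.transpose.mulVec u i) ^ 2 := by
  refine ⟨hA.eigenvectorUnitary, ?_, fun u => ?_⟩
  · simpa [Matrix.star_eq_conjTranspose] using! Unitary.coe_star_mul_self hA.eigenvectorUnitary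
  · have h1 : ∑ i, ∑ j, u i * u j * A i j = u ⬝ᵥ A.mulVec u := by
      simp only [dotProduct, Matrix.mulVec, Finset.mul_sum]
      exact Finset.sum_congr rfl fun i _ => Finset.sum_congr rfl fun j _ => by ring
    have h2 := hA.spectral_theorem
    rw [Unitary.conjStarAlgAut_apply] at h2
    rw [h1]
    conv_lhs => rw [h2]
    rw [← Matrix.mulVec_mulVec, ← Matrix.mulVec_mulVec, Matrix.dotProduct_mulVec,
      ← Matrix.mulVec_transpose]
    simp only [dotProduct, Matrix.mulVec_diagonal, Matrix.star_eq_conjTranspose,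
      Matrix.conjTranspose_eq_transpose_of_trivial]
    refine Finset.sum_congr rfl fun i _ => ?_
    simp
    ring

/-- A subspace on which the quadratic form is negative definite bounds `negEigCount` from below. -/
lemma card_le_negEigCount {n d : Type*} [Fintype n] [DecidableEq n] [Fintype d]
    {A : Matrix n n ℝ} (hA : A.IsHermitian) (W : (d → ℝ) →ₗ[ℝ] (n → ℝ))
    (hW : ∀ c, c ≠ 0 → ∑ i, ∑ j, W c i * W c j * A i j < 0) :
    Fintype.card d ≤ negEigCount A := by
  classical
  obtain ⟨U, -, hU⟩ := exists_orthogonal_quadForm hA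
  rw [negEigCount, dif_pos hA, Nat.card_eq_fintype_card]
  by_contra! hlt
  let T : (d → ℝ) →ₗ[ℝ] ({i // hA.eigenvalues i < 0} → ℝ) :=
    (LinearMap.funLeft ℝ ℝ Subtype.val) ∘ₗ U.transpose.mulVecLin ∘ₗ W
  have hker : LinearMap.ker T ≠ ⊥ := LinearMap.ker_ne_bot_of_finrank_lt (by simpa using hlt)
  obtain ⟨c, hc, hc0⟩ := (Submodule.ne_bot_iff _).1 hker
  have h := hW c hc0
  rw [hU] at h
  refine absurd h (not_lt.2 (Finset.sum_nonneg fun i _ => ?_))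
  by_cases hi : hA.eigenvalues i < 0
  · have : U.transpose.mulVec (W c) i = 0 := congrFun (LinearMap.mem_ker.1 hc) ⟨i, hi⟩
    simp [this]
  · exact mul_nonneg (not_lt.1 hi) (sq_nonneg _)

/-- If the quadratic form is nonnegative on the kernel of a linear map, then `negEigCount` is at
most the dimension of the target. -/
lemma negEigCount_le_card_s18 {n d : Type*} [Fintype n] [DecidableEq n] [Fintype d]
    {A : Matrix n n ℝ} (hA : A.IsHermitian) (T : (n → ℝ) →ₗ[ℝ] (d → ℝ))
    (hT : ∀ u, T u = 0 → 0 ≤ ∑ i, ∑ j, u i * u j * A i j) :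
    negEigCount A ≤ Fintype.card d := by
  classical
  obtain ⟨U, hU1, hU⟩ := exists_orthogonal_quadForm hA
  rw [negEigCount, dif_pos hA, Nat.card_eq_fintype_card]
  by_contra! hlt
  let E : ({i // hA.eigenvalues i < 0} → ℝ) →ₗ[ℝ] (n → ℝ) :=
    { toFun := fun c i => if h : hA.eigenvalues i < 0 then c ⟨i, h⟩ else 0
      map_add' := fun a b => by ext i; by_cases h : hA.eigenvalues i < 0 <;> simp [h]
      map_smul' := fun a b => by ext i; by_cases h : hA.eigenvalues i < 0 <;> simp [h] }
  have hker : LinearMap.ker (T ∘ₗ U.mulVecLin ∘ₗ E) ≠ ⊥ :=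
    LinearMap.ker_ne_bot_of_finrank_lt (by simpa using hlt)
  obtain ⟨c, hc, hc0⟩ := (Submodule.ne_bot_iff _).1 hker
  have h := hT (U.mulVec (E c)) (LinearMap.mem_ker.1 hc)
  rw [hU] at h
  simp only [Matrix.mulVec_mulVec, hU1, Matrix.one_mulVec] at h
  obtain ⟨i, hi⟩ := Function.ne_iff.1 hc0
  refine absurd h (not_le.2 (Finset.sum_neg' (fun j _ => ?_) ⟨i.1, Finset.mem_univ _, ?_⟩))
  · by_cases hj : hA.eigenvalues j < 0
    · exact mul_nonpos_of_nonpos_of_nonneg hj.le (sq_nonneg _)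
    · simp [E, hj]
  · have : E c i.1 = c i := by simp [E, i.2]
    rw [this]
    exact mul_neg_of_neg_of_pos i.2 (by have : c i ≠ 0 := hi
                                        positivity)

lemma negEigCount_eq_card_filter_roots {n : Type*} [Fintype n] [DecidableEq n] {A : Matrix n n ℝ}
    (hA : A.IsHermitian) : negEigCount A = (A.charpoly.roots.filter (· < 0)).card := by
  classical
  rw [negEigCount, dif_pos hA, hA.roots_charpoly_eq_eigenvalues, Nat.card_eq_fintype_card,
    Fintype.card_subtype, Multiset.filter_map, Multiset.card_map]
  rfl

lemma negEigCount_submatrix {n d : Type*} [Fintype n] [DecidableEq n] [Fintype d] [DecidableEq d]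
    {A : Matrix n n ℝ} (hA : A.IsHermitian) (e : d ≃ n) :
    negEigCount (A.submatrix e e) = negEigCount A := by
  rw [negEigCount_eq_card_filter_roots hA, negEigCount_eq_card_filter_roots (hA.submatrix e)]
  have h := Matrix.charpoly_reindex e.symm A
  rw [Matrix.reindex_apply, Equiv.symm_symm] at h
  rw [h]

/-- `L` copies of the kernel `P` placed on the diagonal, padded with `κ` two-point blocks, the first
`k` of which contribute one negative direction each; all entries are shifted by `a`. -/
def padKernel {X : Type} (L κ k : ℕ) (a ε : ℝ) (P : X → X → ℝ) :
    Matrix (Fin L × X ⊕ Fin κ × Bool) (Fin L × X ⊕ Fin κ × Bool) ℝ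
  | .inl x, .inl y => a + if x.1 = y.1 then P x.2 y.2 else 0
  | .inr s, .inr t => a + if s.1 = t.1 ∧ (s.1 : ℕ) < k then (if s.2 = t.2 then -ε else ε) else 0
  | .inl _, .inr _ => a
  | .inr _, .inl _ => a

lemma padKernel_isSymm {X : Type} (L κ k : ℕ) (a ε : ℝ) {P : X → X → ℝ}
    (hP : ∀ x y, P x y = P y x) : (padKernel L κ k a ε P).IsSymm := by
  ext (x | x) (y | y)
  · simp only [Matrix.transpose_apply, padKernel, hP x.2, eq_comm]
  · rfl
  · rfl
  · simp only [Matrix.transpose_apply, padKernel]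
    by_cases h : x.1 = y.1
    · simp [h, eq_comm]
    · simp [h, Ne.symm h]

lemma padKernel_mem {X : Type} {L κ k : ℕ} {a ε : ℝ} {P : X → X → ℝ} {I : Set ℝ} (ha : a ∈ I)
    (h1 : a - ε ∈ I) (h2 : a + ε ∈ I) (hP : ∀ x y, a + P x y ∈ I) (i j) :
    padKernel L κ k a ε P i j ∈ I := by
  rcases i with x | x <;> rcases j with y | y <;> simp only [padKernel]
  · split_ifs
    · exact hP _ _
    · simpa
  · exact ha
  · exact ha
  · split_ifs
    · exact h1
    · exact h2
    · simpa

lemma quadForm_padKernel {X : Type} [Fintype X] (L κ k : ℕ) (a ε : ℝ) (P : X → X → ℝ)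
    (u : Fin L × X ⊕ Fin κ × Bool → ℝ) :
    ∑ i, ∑ j, u i * u j * padKernel L κ k a ε P i j =
      a * (∑ i, u i) ^ 2 + ∑ c, ∑ x, ∑ y, u (.inl (c, x)) * u (.inl (c, y)) * P x y
      - ε * ∑ j : Fin κ, if (j : ℕ) < k then (u (.inr (j, true)) - u (.inr (j, false))) ^ 2 else 0 := by
  have hsplit : ∀ i j, u i * u j * padKernel L κ k a ε P i j =
      a * (u i * u j) + u i * u j * padKernel L κ k 0 ε P i j := by
    rintro (i | i) (j | j) <;> simp only [padKernel] <;> ring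
  simp_rw [hsplit, Finset.sum_add_distrib, ← Finset.mul_sum, ← Finset.sum_mul]
  have hX : ∀ c x, ∑ i, ∑ y, u (.inl (c, x)) * u (.inl (i, y)) * (0 + if c = i then P x y else 0)
      = ∑ y, u (.inl (c, x)) * u (.inl (c, y)) * P x y := by
    intro c x
    rw [Finset.sum_eq_single c (fun b _ hb => by simp [hb.symm]) (by simp)]
    simp
  have hY : ∀ c s, ∑ i, ∑ t, u (.inr (c, s)) * u (.inr (i, t)) *
        (0 + if c = i ∧ (c : ℕ) < k then (if s = t then -ε else ε) else 0)
      = ∑ t, u (.inr (c, s)) * u (.inr (c, t)) *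
        (if (c : ℕ) < k then (if s = t then -ε else ε) else 0) := by
    intro c s
    rw [Finset.sum_eq_single c (fun b _ hb => by simp [hb.symm]) (by simp)]
    simp
  rw [Fintype.sum_sum_type (f := fun i => ∑ j, u i * u j * padKernel L κ k 0 ε P i j)]
  simp_rw [Fintype.sum_sum_type (f := fun j => u _ * u j * padKernel L κ k 0 ε P _ j)]
  simp only [padKernel, mul_zero, Finset.sum_const_zero, add_zero, zero_add (Finset.sum _ _),
    Fintype.sum_prod_type, hX, hY]
  rw [sq, sub_eq_add_neg, add_assoc]
  congr 2
  rw [Finset.mul_sum, ← Finset.sum_neg_distrib]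
  refine Finset.sum_congr rfl fun c _ => ?_
  by_cases h : (c : ℕ) < k <;> simp [h]
  ring

lemma negEigCount_padKernel {X : Type} [Fintype X] [DecidableEq X] {L κ k : ℕ} {a ε : ℝ}
    {P : X → X → ℝ} (hk : k ≤ κ) (ha : 0 < a) (hε : 0 < ε) (hsymm : ∀ x y, P x y = P y x)
    (hP : ∀ u : X → ℝ, 0 ≤ ∑ x, ∑ y, u x * u y * P x y) :
    negEigCount (padKernel L κ k a ε P) = k := by
  have hA : (padKernel L κ k a ε P).IsHermitian := by
    simpa [Matrix.IsHermitian] using! padKernel_isSymm L κ k a ε hsymm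
  have hcard : Fintype.card {j : Fin κ // (j : ℕ) < k} = k := by
    rw [Fintype.card_subtype]
    simp [Fin.card_filter_val_lt, hk]
  apply le_antisymm
  · let T : (Fin L × X ⊕ Fin κ × Bool → ℝ) →ₗ[ℝ] ({j : Fin κ // (j : ℕ) < k} → ℝ) :=
      LinearMap.pi fun j => LinearMap.proj (.inr (j.1, true)) - LinearMap.proj (.inr (j.1, false))
    refine (negEigCount_le_card_s18 hA T fun u hu => ?_).trans_eq hcard
    have h0 : ∑ j : Fin κ, (if (j : ℕ) < k then
        (u (.inr (j, true)) - u (.inr (j, false))) ^ 2 else 0) = 0 := by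
      refine Finset.sum_eq_zero fun j _ => ?_
      split_ifs with h
      · have : u (.inr (j, true)) - u (.inr (j, false)) = 0 := congrFun hu ⟨j, h⟩
        simp [this]
      · rfl
    have := Finset.sum_nonneg fun c (_ : c ∈ Finset.univ) => hP fun x => u (.inl (c, x))
    rw [quadForm_padKernel, h0, mul_zero, sub_zero]
    positivity
  · let W : ({j : Fin κ // (j : ℕ) < k} → ℝ) →ₗ[ℝ] (Fin L × X ⊕ Fin κ × Bool → ℝ) :=
      LinearMap.pi fun i => match i with
        | .inl _ => 0
        | .inr s => if h : (s.1 : ℕ) < k then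
            (if s.2 then (1 : ℝ) else -1) • LinearMap.proj ⟨s.1, h⟩ else 0
    refine hcard.symm.trans_le (card_le_negEigCount hA W fun c hc => ?_)
    rw [quadForm_padKernel]
    have h1 : ∑ i, W c i = 0 := by
      rw [Fintype.sum_sum_type, Fintype.sum_prod_type, Fintype.sum_prod_type]
      simp only [W, LinearMap.pi_apply, LinearMap.zero_apply, Finset.sum_const_zero, zero_add]
      refine Finset.sum_eq_zero fun j _ => ?_
      by_cases h : (j : ℕ) < k <;> simp [h]
    have h2 : ∀ x, W c (.inl x) = 0 := fun x => rfl
    simp only [h1, h2]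
    obtain ⟨j, hj⟩ := Function.ne_iff.1 hc
    have h3 : 0 < ∑ j : Fin κ, if (j : ℕ) < k then
        (W c (.inr (j, true)) - W c (.inr (j, false))) ^ 2 else 0 := by
      refine Finset.sum_pos' (fun i _ => by positivity) ⟨j.1, Finset.mem_univ _, ?_⟩
      have : c j ≠ 0 := hj
      have e1 : W c (.inr (j.1, true)) = c j := by simp [W, j.2]
      have e2 : W c (.inr (j.1, false)) = - c j := by simp [W, j.2]
      rw [if_pos j.2, e1, e2]
      have : c j - -c j ≠ 0 := by intro h; apply this; linarith
      positivity
    have := mul_pos hε h3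
    simp only [zero_mul, Finset.sum_const_zero]
    linarith

/-- If `f[-]` maps tuples with prescribed negative inertia to matrices with boundedly many negative
eigenvalues, then `f` of a positive shift of positive semidefinite kernels is conditionally
positive. -/
lemma sum_nonneg_of_negEigCount_le {I : Set ℝ} {m : ℕ} {k : Fin m → ℕ} {l : ℕ}
    {f : (Fin m → ℝ) → ℝ}
    (hf : ∀ n : ℕ, max (Finset.univ.sup k) 1 ≤ n →
        ∀ B : Fin m → Matrix (Fin n) (Fin n) ℝ,
        (∀ p, (B p).IsSymm ∧ (∀ i j, B p i j ∈ I) ∧ negEigCount (B p) = k p) →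
        negEigCount (Matrix.of fun i j => f fun p => B p i j) ≤ l)
    {X : Type} [Fintype X] [DecidableEq X] (a ε : Fin m → ℝ) (P : Fin m → X → X → ℝ) (v : X → ℝ)
    (ha : ∀ p, 0 < a p ∧ a p ∈ I) (hε : ∀ p, 0 < ε p ∧ a p - ε p ∈ I ∧ a p + ε p ∈ I)
    (hsymm : ∀ p x y, P p x y = P p y x)
    (hP : ∀ p, ∀ u : X → ℝ, 0 ≤ ∑ x, ∑ y, u x * u y * P p x y)
    (hmem : ∀ p x y, a p + P p x y ∈ I) (hv : ∑ x, v x = 0) :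
    0 ≤ ∑ x, ∑ y, v x * v y * f fun p => a p + P p x y := by
  by_contra! hneg
  set κ := max (Finset.univ.sup k) 1
  let B := fun p => padKernel (l + 1) κ (k p) (a p) (ε p) (P p)
  let e := (Fintype.equivFin (Fin (l + 1) × X ⊕ Fin κ × Bool)).symm
  have hBs : ∀ p, (B p).IsSymm := fun p => padKernel_isSymm _ _ _ _ _ (hsymm p)
  have hBh : ∀ p, (B p).IsHermitian := fun p => by
    simpa [Matrix.IsHermitian] using! hBs p
  have hle := hf (Fintype.card (Fin (l + 1) × X ⊕ Fin κ × Bool))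
    (by simp only [Fintype.card_sum, Fintype.card_prod, Fintype.card_fin, Fintype.card_bool]; omega)
    (fun p => (B p).submatrix e e) (fun p => ⟨(hBs p).submatrix e,
      fun i j => padKernel_mem (ha p).2 (hε p).2.1 (hε p).2.2 (hmem p) _ _, by
      rw [negEigCount_submatrix (hBh p)]
      exact negEigCount_padKernel
        ((Finset.le_sup (Finset.mem_univ p)).trans (le_max_left _ _)) (ha p).1 (hε p).1 (hsymm p)
        (hP p)⟩)
  let F : Matrix (Fin (l + 1) × X ⊕ Fin κ × Bool) (Fin (l + 1) × X ⊕ Fin κ × Bool) ℝ :=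
    Matrix.of fun i j => f fun p => B p i j
  have hF : F.IsHermitian := by
    ext i j
    simp only [Matrix.conjTranspose_apply, F, Matrix.of_apply, star_trivial]
    congr 1
    ext p
    exact (hBs p).apply i j
  have hle' : negEigCount F ≤ l := by
    rw [← negEigCount_submatrix hF e]
    exact hle
  let W : (Fin (l + 1) → ℝ) →ₗ[ℝ] (Fin (l + 1) × X ⊕ Fin κ × Bool → ℝ) :=
    LinearMap.pi fun i => match i with
      | .inl x => v x.2 • LinearMap.proj x.1
      | .inr _ => 0
  have hge := card_le_negEigCount hF W fun c hc => ?_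
  · simp at hge
    omega
  have e1 : ∀ x y, W c (.inl x) * W c (.inl y) * F (.inl x) (.inl y) =
      c x.1 * c y.1 * (v x.2 * v y.2 * if x.1 = y.1 then f fun p => a p + P p x.2 y.2 else f a) := by
    intro x y
    simp only [W, LinearMap.pi_apply, LinearMap.smul_apply, LinearMap.proj_apply, smul_eq_mul, F,
      Matrix.of_apply, B, padKernel]
    split_ifs with h
    · ring
    · simp only [add_zero]; ring
  have e2 : ∀ s, W c (.inr s) = 0 := fun s => rfl
  have e3 : ∀ i j : Fin (l + 1), ∑ x, ∑ y, c i * c j * (v x * v y *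
      if i = j then f fun p => a p + P p x y else f a) =
      if i = j then c i ^ 2 * ∑ x, ∑ y, v x * v y * f fun p => a p + P p x y else 0 := by
    intro i j
    split_ifs with h
    · subst h
      simp_rw [← Finset.mul_sum, sq]
    · have : ∀ x, ∑ y, v x * v y * f a = 0 := fun x => by
        rw [← Finset.sum_mul, ← Finset.mul_sum, hv]; simp
      simp_rw [← Finset.mul_sum, this]
      simp
  simp only [Fintype.sum_sum_type, e1, e2, zero_mul, mul_zero, Finset.sum_const_zero, add_zero,
    Fintype.sum_prod_type]
  have e4 : ∀ i : Fin (l + 1), ∑ x, ∑ j, ∑ y, c i * c j * (v x * v y *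
      if i = j then f fun p => a p + P p x y else f a) =
      c i ^ 2 * ∑ x, ∑ y, v x * v y * f fun p => a p + P p x y := by
    intro i
    rw [Finset.sum_comm]
    simp_rw [e3]
    simp
  simp_rw [e4, ← Finset.sum_mul]
  refine mul_neg_of_pos_of_neg ?_ hneg
  obtain ⟨j, hj⟩ := Function.ne_iff.1 hc
  exact Finset.sum_pos' (fun i _ => sq_nonneg _) ⟨j, Finset.mem_univ _, by
    have : c j ≠ 0 := hj
    positivity⟩

/-- Conditional positivity of `f` along positive shifts of positive semidefinite kernels. -/
def ShiftCondPos {m : ℕ} (I : Set ℝ) (f : (Fin m → ℝ) → ℝ) : Prop :=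
  ∀ (X : Type) [Fintype X] [DecidableEq X] (a : Fin m → ℝ) (P : Fin m → X → X → ℝ) (v : X → ℝ),
    (∀ p, 0 < a p) → (∀ p, a p ∈ I) → (∀ p x y, P p x y = P p y x) →
    (∀ p, ∀ u : X → ℝ, 0 ≤ ∑ x, ∑ y, u x * u y * P p x y) →
    (∀ p x y, a p + P p x y ∈ I) → ∑ x, v x = 0 →
    0 ≤ ∑ x, ∑ y, v x * v y * f fun p => a p + P p x y

/-- Positive definite functions on a group in which every element is an involution. -/
def PsdFun {G : Type} [Fintype G] [CommGroup G] (φ : G → ℝ) : Prop :=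
  ∀ u : G → ℝ, 0 ≤ ∑ x, ∑ y, u x * u y * φ (x * y)

section PsdFun

variable {G : Type} [Fintype G] [CommGroup G]

lemma PsdFun.hom (χ : G →* ℝ) : PsdFun χ := by
  intro u
  have : ∑ x, ∑ y, u x * u y * χ (x * y) = (∑ x, u x * χ x) ^ 2 := by
    rw [sq, Finset.sum_mul_sum]
    refine Finset.sum_congr rfl fun x _ => Finset.sum_congr rfl fun y _ => ?_
    rw [map_mul]; ring
  rw [this]
  positivity

lemma PsdFun.add {φ ψ : G → ℝ} (hφ : PsdFun φ) (hψ : PsdFun ψ) : PsdFun fun z => φ z + ψ z := by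
  intro u
  simp only [mul_add, Finset.sum_add_distrib]
  exact add_nonneg (hφ u) (hψ u)

lemma PsdFun.const_mul {φ : G → ℝ} (hφ : PsdFun φ) {c : ℝ} (hc : 0 ≤ c) :
    PsdFun fun z => c * φ z := by
  intro u
  have : ∑ x, ∑ y, u x * u y * (c * φ (x * y)) = c * ∑ x, ∑ y, u x * u y * φ (x * y) := by
    simp only [Finset.mul_sum]
    exact Finset.sum_congr rfl fun x _ => Finset.sum_congr rfl fun y _ => by ring
  rw [this]
  exact mul_nonneg hc (hφ u)

lemma PsdFun.sum {ι : Type} (s : Finset ι) {φ : ι → G → ℝ} (hφ : ∀ i, PsdFun (φ i)) :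
    PsdFun fun z => ∑ i ∈ s, φ i z := by
  classical
  induction s using Finset.induction_on with
  | empty => intro u; simp
  | insert i s hi ih =>
    simp only [Finset.sum_insert hi]
    exact (hφ i).add ih

lemma ShiftCondPos.sum_char_nonneg {m : ℕ} {I : Set ℝ} {f : (Fin m → ℝ) → ℝ}
    (hf : ShiftCondPos I f) [DecidableEq G] (hG : ∀ x : G, x * x = 1) (a : Fin m → ℝ)
    (φ : Fin m → G → ℝ) (χ : G →* ℝ) (ha : ∀ p, 0 < a p) (haI : ∀ p, a p ∈ I)
    (hφ : ∀ p, PsdFun (φ p)) (hmem : ∀ p z, a p + φ p z ∈ I) (hχ : ∑ z, χ z = 0) :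
    0 ≤ ∑ z, χ z * f fun p => a p + φ p z := by
  have h := hf G a (fun p x y => φ p (x * y)) χ ha haI (fun p x y => by rw [mul_comm]) hφ
    (fun p x y => hmem p _) hχ
  have h2 : ∀ x : G, ∑ y, χ x * χ y * f (fun p => a p + φ p (x * y)) =
      ∑ z, χ z * f fun p => a p + φ p z := by
    intro x
    rw [← Equiv.sum_comp (Equiv.mulLeft x) fun y => χ x * χ y * f (fun p => a p + φ p (x * y))]
    refine Finset.sum_congr rfl fun z _ => ?_
    simp only [Equiv.coe_mulLeft, ← mul_assoc, hG, one_mul, ← map_mul]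
  simp_rw [h2] at h
  rw [Finset.sum_const, nsmul_eq_mul] at h
  exact nonneg_of_mul_nonneg_right h (by simpa using Fintype.card_pos)

end PsdFun

/-- The embedding of the signs `±1` into the reals. -/
noncomputable def unitSign : ℤˣ →* ℝ := (Int.castRingHom ℝ).toMonoidHom.comp (Units.coeHom ℤ)

@[simp] lemma unitSign_neg_one : unitSign (-1) = -1 := by simp [unitSign]

lemma sum_intUnits {M : Type*} [AddCommMonoid M] (F : ℤˣ → M) : ∑ z, F z = F 1 + F (-1) := by
  rw [UnitsInt.univ, Finset.sum_pair (by decide)]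

lemma ite_eq_one_eq (z : ℤˣ) : (if z = 1 then (1 : ℝ) else 0) = 1 / 2 * (1 + unitSign z) := by
  rcases Int.units_eq_one_or z with rfl | rfl
  · simp; norm_num
  · rw [if_neg (by decide)]; simp

lemma sum_prod_unitSign {ι : Type} [Fintype ι] [DecidableEq ι] [Nonempty ι] :
    ∑ z : ι → ℤˣ, ∏ i, unitSign (z i) = 0 := by
  rw [← Fintype.piFinset_univ, ← Finset.prod_univ_sum (fun _ => Finset.univ) fun _ z => unitSign z]
  obtain ⟨i⟩ := ‹Nonempty ι›
  exact Finset.prod_eq_zero (Finset.mem_univ i) (by rw [sum_intUnits]; simp)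

/-- All mixed finite differences of positive order of `f` on `(0, ρ)ᵐ` with nonnegative steps are
nonnegative. -/
def DiffNonneg {m : ℕ} (ρ : EReal) (f : (Fin m → ℝ) → ℝ) : Prop :=
  ∀ (ι : Type) [Fintype ι] [DecidableEq ι] [Nonempty ι] (h : ι → Fin m → ℝ) (a : Fin m → ℝ),
    (∀ i p, 0 ≤ h i p) → (∀ p, 0 < a p) → (∀ p, ((a p + ∑ i, h i p : ℝ) : EReal) < ρ) →
    0 ≤ ∑ z : ι → ℤˣ, (∏ i, unitSign (z i)) * f fun p => a p + ∑ i, if z i = 1 then h i p else 0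

lemma sum_ite_mem_Icc {ι : Type} [Fintype ι] {h : ι → ℝ} (hh : ∀ i, 0 ≤ h i) (z : ι → ℤˣ) :
    0 ≤ ∑ i, (if z i = 1 then h i else 0) ∧ ∑ i, (if z i = 1 then h i else 0) ≤ ∑ i, h i := by
  constructor
  · exact Finset.sum_nonneg fun i _ => by split_ifs <;> simp [hh]
  · exact Finset.sum_le_sum fun i _ => by split_ifs <;> simp [hh]

lemma ShiftCondPos.diffNonneg {m : ℕ} {ρ : EReal} {I : Set ℝ} {f : (Fin m → ℝ) → ℝ}
    (hf : ShiftCondPos I f) (hI : ∀ x : ℝ, 0 < x → (x : EReal) < ρ → x ∈ I) :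
    DiffNonneg ρ f := by
  intro ι _ _ _ h a hh ha hρ
  have hmem : ∀ p (z : ι → ℤˣ), a p + ∑ i, (if z i = 1 then h i p else 0) ∈ I := by
    intro p z
    have := sum_ite_mem_Icc (fun i => hh i p) z
    exact hI _ (by linarith [ha p]) (lt_of_le_of_lt (by exact_mod_cast by linarith) (hρ p))
  have := hf.sum_char_nonneg (G := ι → ℤˣ) (fun x => by ext i; simp) a
    (fun p z => ∑ i, if z i = 1 then h i p else 0)
    (∏ i, unitSign.comp (Pi.evalMonoidHom (fun _ : ι => ℤˣ) i)) ha
    (fun p => by simpa using! hmem p fun _ => -1) (fun p => ?_) hmem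
    (by simpa [MonoidHom.finsetProd_apply] using! sum_prod_unitSign)
  · simpa [MonoidHom.finsetProd_apply] using this
  · refine PsdFun.sum _ fun i => ?_
    have : (fun z : ι → ℤˣ => if z i = 1 then h i p else 0) = fun z => h i p * (1 / 2 *
        ((1 : (ι → ℤˣ) →* ℝ) z + unitSign.comp (Pi.evalMonoidHom (fun _ : ι => ℤˣ) i) z)) := by
      ext z
      have := ite_eq_one_eq (z i)
      simp only [MonoidHom.one_apply, MonoidHom.comp_apply, Pi.evalMonoidHom_apply, ← this]
      simp
    rw [this]
    exact (((PsdFun.hom 1).add (PsdFun.hom _)).const_mul (by norm_num)).const_mul (hh i p)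

lemma ShiftCondPos.diffNonneg_slice {m : ℕ} {T : EReal} {I : Set ℝ} {f : (Fin m → ℝ) → ℝ}
    (hf : ShiftCondPos I f) (A B : Fin m → ℝ) (hA : ∀ p, 0 < A p) (hAI : ∀ p, A p ∈ I)
    (hB : ∀ p, 0 ≤ B p) (hAB : ∀ p (t : ℝ), 0 < t → (t : EReal) < T →
      A p + t * B p ∈ I ∧ A p - t * B p ∈ I) (η : ℤˣ →* ℝ) :
    DiffNonneg T fun y : Fin 1 → ℝ =>
      f (fun p => A p + y 0 * B p) + η (-1) * f (fun p => A p - y 0 * B p) := by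
  intro ι _ _ _ h a hh ha hT
  have hmem : ∀ p (z : ℤˣ × (ι → ℤˣ)), A p + unitSign z.1 *
      (a 0 + ∑ i, (if z.2 i = 1 then h i 0 else 0)) * B p ∈ I := by
    intro p z
    have h1 := sum_ite_mem_Icc (fun i => hh i 0) z.2
    have h2 := hAB p (a 0 + ∑ i, (if z.2 i = 1 then h i 0 else 0)) (by linarith [ha 0])
      (lt_of_le_of_lt (by exact_mod_cast by linarith) (hT 0))
    rcases Int.units_eq_one_or z.1 with hz | hz <;> rw [hz]
    · simpa using h2.1
    · rw [unitSign_neg_one, neg_one_mul, neg_mul, ← sub_eq_add_neg]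
      exact h2.2
  let χ : ι → (ℤˣ × (ι → ℤˣ) →* ℝ) := fun i =>
    (unitSign.comp (Pi.evalMonoidHom (fun _ : ι => ℤˣ) i)).comp (MonoidHom.snd _ _)
  let χ₀ : ℤˣ × (ι → ℤˣ) →* ℝ := unitSign.comp (MonoidHom.fst _ _)
  let χ' : ℤˣ × (ι → ℤˣ) →* ℝ := η.comp (MonoidHom.fst _ _) * ∏ i, χ i
  have hχ : ∀ z, χ' z = η z.1 * ∏ i, unitSign (z.2 i) := by
    intro z
    simp [χ', χ, MonoidHom.finsetProd_apply]
  have := hf.sum_char_nonneg (G := ℤˣ × (ι → ℤˣ)) (fun x => by ext <;> simp) A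
    (fun p z => unitSign z.1 * (a 0 + ∑ i, (if z.2 i = 1 then h i 0 else 0)) * B p)
    χ' hA hAI (fun p => ?_) hmem ?_
  · simp only [hχ, Fintype.sum_prod_type] at this
    rw [sum_intUnits, ← Finset.sum_add_distrib] at this
    refine this.trans_eq (Finset.sum_congr rfl fun z _ => ?_)
    simp only [map_one, one_mul, unitSign_neg_one, neg_mul, ← sub_eq_add_neg]
    ring
  · have : (fun z : ℤˣ × (ι → ℤˣ) =>
        unitSign z.1 * (a 0 + ∑ i, (if z.2 i = 1 then h i 0 else 0)) * B p) =
        fun z => B p * (a 0 * χ₀ z + ∑ i, h i 0 * (1 / 2 * (χ₀ z + (χ₀ * χ i) z))) := by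
      ext z
      have h3 : ∀ i, (if z.2 i = 1 then h i 0 else 0) = h i 0 * (1 / 2 * (1 + χ i z)) := by
        intro i
        have := ite_eq_one_eq (z.2 i)
        simp only [χ, MonoidHom.comp_apply, Pi.evalMonoidHom_apply, MonoidHom.coe_snd, ← this]
        simp
      have h4 : ∀ i, h i 0 * (1 / 2 * (χ₀ z + (χ₀ * χ i) z)) =
          χ₀ z * (h i 0 * (1 / 2 * (1 + χ i z))) := fun i => by
        rw [MonoidHom.mul_apply]; ring
      simp_rw [h3, h4, ← Finset.mul_sum]
      simp only [χ₀, MonoidHom.comp_apply, MonoidHom.coe_fst]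
      ring
    rw [this]
    exact (((PsdFun.hom χ₀).const_mul (ha 0).le).add (PsdFun.sum _ fun i =>
      (((PsdFun.hom χ₀).add (PsdFun.hom _)).const_mul (by norm_num)).const_mul
        (hh i 0))).const_mul (hB p)
  · simp only [hχ, Fintype.sum_prod_type, ← Finset.mul_sum, sum_prod_unitSign]
    simp

lemma DiffNonneg.mono {m : ℕ} {ρ : EReal} {f : (Fin m → ℝ) → ℝ} (hf : DiffNonneg ρ f)
    {x y : Fin m → ℝ} (hx : ∀ p, 0 < x p) (hxy : ∀ p, x p ≤ y p) (hy : ∀ p, (y p : EReal) < ρ) :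
    f x ≤ f y := by
  have := hf Unit (fun _ p => y p - x p) x (fun _ p => by linarith [hxy p]) hx
    (fun p => by simpa using hy p)
  rw [← Equiv.sum_comp (Equiv.funUnique Unit ℤˣ).symm, sum_intUnits] at this
  simp at this
  linarith

lemma DiffNonneg.two_mul_le {m : ℕ} {ρ : EReal} {f : (Fin m → ℝ) → ℝ} (hf : DiffNonneg ρ f)
    {a s : Fin m → ℝ} (ha : ∀ p, 0 < a p) (hs : ∀ p, 0 ≤ s p)
    (hρ : ∀ p, ((a p + 2 * s p : ℝ) : EReal) < ρ) :
    2 * f (fun p => a p + s p) ≤ f a + f (fun p => a p + 2 * s p) := by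
  have := hf (Fin 2) (fun _ p => s p) a (fun _ p => hs p) ha
    (fun p => by simpa [two_mul] using hρ p)
  rw [← Equiv.sum_comp (finTwoArrowEquiv ℤˣ).symm, Fintype.sum_prod_type, sum_intUnits,
    sum_intUnits, sum_intUnits] at this
  simp [Fin.sum_univ_two, Fin.prod_univ_two, ← two_mul] at this
  linarith

/-- The linear functional on polynomials sending the monomial `X ^ N` to the value of `f` at the
grid point `h (N + 1)`. -/
noncomputable def gridEval {m : ℕ} (f : (Fin m → ℝ) → ℝ) (h : ℝ) : MvPolynomial (Fin m) ℝ →ₗ[ℝ] ℝ :=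
  (MvPolynomial.basisMonomials (Fin m) ℝ).constr ℝ fun N => f fun p => h * (N p + 1)

lemma gridEval_monomial {m : ℕ} (f : (Fin m → ℝ) → ℝ) (h : ℝ) (N : Fin m →₀ ℕ) :
    gridEval f h (MvPolynomial.monomial N 1) = f fun p => h * (N p + 1) := by
  have := (MvPolynomial.basisMonomials (Fin m) ℝ).constr_basis ℝ
    (fun N => f fun p => h * (N p + 1)) N
  simpa using! this

/-- The mixed forward difference of order `α` of `f` at `(h, …, h)` with step `h`. -/
noncomputable def gridDiff {m : ℕ} (f : (Fin m → ℝ) → ℝ) (h : ℝ) (α : Fin m → ℕ) : ℝ :=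
  gridEval f h (∏ p, (MvPolynomial.X p - 1) ^ α p)

lemma gridDiff_zero {m : ℕ} (f : (Fin m → ℝ) → ℝ) (h : ℝ) : gridDiff f h 0 = f fun _ => h := by
  have := gridEval_monomial f h 0
  simpa [gridDiff] using this

/-- Newton's forward difference formula. -/
lemma sum_choose_mul_gridDiff {m : ℕ} (f : (Fin m → ℝ) → ℝ) (h : ℝ) (N : Fin m → ℕ) :
    f (fun p => h * (N p + 1)) = ∑ α ∈ Fintype.piFinset fun p => Finset.range (N p + 1),
      (∏ p, ((N p).choose (α p) : ℝ)) * gridDiff f h α := by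
  have h1 := gridEval_monomial f h (Finsupp.equivFunOnFinite.symm N)
  have h2 : (MvPolynomial.monomial (Finsupp.equivFunOnFinite.symm N) (1 : ℝ)) =
      ∑ α ∈ Fintype.piFinset fun p => Finset.range (N p + 1),
        (∏ p, ((N p).choose (α p) : ℝ)) • ∏ p, (MvPolynomial.X p - 1) ^ α p := by
    rw [MvPolynomial.monomial_eq, Finsupp.prod_fintype _ _ (by simp), map_one, one_mul]
    have h3 : ∀ p, (MvPolynomial.X p : MvPolynomial (Fin m) ℝ) ^ N p =
        ∑ k ∈ Finset.range (N p + 1), ((N p).choose k : ℝ) • (MvPolynomial.X p - 1) ^ k := by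
      intro p
      conv_lhs => rw [← sub_add_cancel (MvPolynomial.X p : MvPolynomial (Fin m) ℝ) 1, add_pow]
      refine Finset.sum_congr rfl fun k _ => ?_
      rw [one_pow, mul_one, Algebra.smul_def, mul_comm]
      simp
    simp only [Finsupp.equivFunOnFinite_symm_apply_apply, h3]
    rw [Finset.prod_univ_sum]
    refine Finset.sum_congr rfl fun α _ => ?_
    rw [Finset.prod_smul]
  rw [h2, map_sum] at h1
  simp only [map_smul, smul_eq_mul, Finsupp.equivFunOnFinite_symm_apply_apply] at h1
  exact h1.symm

lemma DiffNonneg.gridDiff_nonneg {m : ℕ} {ρ : EReal} {f : (Fin m → ℝ) → ℝ} (hf : DiffNonneg ρ f)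
    {h : ℝ} (hh : 0 < h) {α : Fin m → ℕ} (hα : α ≠ 0)
    (hρ : ∀ p, ((h * (α p + 1) : ℝ) : EReal) < ρ) : 0 ≤ gridDiff f h α := by
  obtain ⟨q, hq⟩ := Function.ne_iff.1 hα
  have : Nonempty (Σ p, Fin (α p)) := ⟨⟨q, ⟨0, Nat.pos_of_ne_zero hq⟩⟩⟩
  have h1 := hf (Σ p, Fin (α p)) (fun s p => if s.1 = p then h else 0) (fun _ => h)
    (fun s p => by split_ifs <;> simp [hh.le]) (fun _ => hh) (fun p => by
      have : h + ∑ s : Σ p, Fin (α p), (if s.1 = p then h else 0) = h * (α p + 1) := by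
        rw [show ∑ s : Σ p, Fin (α p), (if s.1 = p then h else 0) =
          ∑ q, ∑ _s : Fin (α q), if q = p then h else 0 from Fintype.sum_sigma _]
        simp only [Finset.sum_const, Finset.card_univ, Fintype.card_fin, nsmul_eq_mul, mul_ite,
          mul_zero, Finset.sum_ite_eq', Finset.mem_univ, if_true]
        ring
      rw [this]
      exact hρ p)
  refine h1.trans_eq ?_
  have h2 : (∏ p, (MvPolynomial.X p - 1) ^ α p : MvPolynomial (Fin m) ℝ) =
      ∑ z : (Σ p, Fin (α p)) → ℤˣ, (∏ s, unitSign (z s)) •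
        MvPolynomial.monomial (∑ s, if z s = 1 then Finsupp.single s.1 1 else 0) 1 := by
    have h3 : ∀ p, (MvPolynomial.X p - 1 : MvPolynomial (Fin m) ℝ) =
        ∑ z : ℤˣ, unitSign z •
          MvPolynomial.monomial (if z = 1 then Finsupp.single p 1 else 0) 1 := by
      intro p
      rw [sum_intUnits]
      simp [show (-1 : ℤˣ) ≠ 1 by decide, MvPolynomial.X, sub_eq_add_neg]
    have h4 : (∏ p, (MvPolynomial.X p - 1) ^ α p : MvPolynomial (Fin m) ℝ) =
        ∏ s : (Σ p, Fin (α p)), (MvPolynomial.X s.1 - 1) := by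
      rw [Fintype.prod_sigma]
      simp
    rw [h4]
    simp_rw [h3]
    rw [Finset.prod_univ_sum, Fintype.piFinset_univ]
    refine Finset.sum_congr rfl fun z _ => ?_
    rw [Finset.prod_smul, MvPolynomial.monomial_sum_one]
  rw [gridDiff, h2, map_sum]
  refine Finset.sum_congr rfl fun z _ => ?_
  rw [map_smul, gridEval_monomial, smul_eq_mul]
  congr 2
  ext p
  have : ∀ s : (Σ p, Fin (α p)), (((if z s = 1 then Finsupp.single s.1 1 else 0 : Fin m →₀ ℕ) p : ℕ) : ℝ)
      * h = if z s = 1 then (if s.1 = p then h else 0) else 0 := by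
    intro s
    by_cases h1 : z s = 1 <;> by_cases h2 : s.1 = p <;> simp [h1, h2]
  rw [Finsupp.finsetSum_apply]
  push_cast
  rw [mul_add, mul_one, add_comm, mul_comm, Finset.sum_mul]
  simp_rw [this]

lemma cast_choose_succ_mul (n k : ℕ) :
    (n.choose (k + 1) : ℝ) * (k + 1) = n.choose k * (n - k) := by
  rcases le_or_gt k n with hk | hk
  · have := Nat.choose_succ_right_eq n k
    rw [← Nat.cast_sub hk]
    exact_mod_cast this
  · simp [Nat.choose_eq_zero_of_lt hk, Nat.choose_eq_zero_of_lt (hk.trans (Nat.lt_succ_self k))]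

lemma cast_choose_le {N M : ℕ} {r : ℝ} (hr0 : 0 ≤ r) (hr : r ≤ 1) (h : (N : ℝ) ≤ r * M) (k : ℕ) :
    (N.choose k : ℝ) ≤ r ^ k * M.choose k := by
  induction k with
  | zero => simp
  | succ k ih =>
    rcases lt_or_ge N (k + 1) with hk | hk
    · rw [Nat.choose_eq_zero_of_lt hk, Nat.cast_zero]
      positivity
    have hkN : (k : ℝ) + 1 ≤ N := by exact_mod_cast hk
    have h1 : (N : ℝ) - k ≤ r * (M - k) := by nlinarith [Nat.cast_nonneg (α := ℝ) k]
    have h2 : (N.choose (k + 1) : ℝ) * (k + 1) ≤ (r ^ (k + 1) * M.choose (k + 1)) * (k + 1) := by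
      rw [mul_assoc, cast_choose_succ_mul, cast_choose_succ_mul]
      calc (N.choose k : ℝ) * (N - k) ≤ (r ^ k * M.choose k) * (r * (M - k)) := by
            apply mul_le_mul ih h1 (by linarith) (by positivity)
        _ = _ := by ring
    exact le_of_mul_le_mul_right h2 (by positivity)

lemma tendsto_choose_mul_pow {F : Filter ℕ} {h : ℕ → ℝ} {N : ℕ → ℕ} {x : ℝ}
    (hh : Tendsto h F (𝓝 0)) (hN : Tendsto (fun j => h j * N j) F (𝓝 x)) (k : ℕ) :
    Tendsto (fun j => ((N j).choose k : ℝ) * h j ^ k) F (𝓝 (x ^ k / k.factorial)) := by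
  induction k with
  | zero => simpa using tendsto_const_nhds
  | succ k ih =>
    have h1 := (ih.mul (hN.sub (hh.mul_const (k : ℝ)))).div_const ((k : ℝ) + 1)
    have hk : (k : ℝ) + 1 ≠ 0 := by positivity
    convert h1 using 1
    · ext j
      rw [eq_div_iff hk, mul_right_comm, cast_choose_succ_mul]
      ring
    · rw [Nat.factorial_succ]
      push_cast
      congr 1
      have : (k.factorial : ℝ) ≠ 0 := by positivity
      field_simp
      ring

lemma summable_prod_pow {m : ℕ} {r : Fin m → ℝ} (h0 : ∀ p, 0 ≤ r p) (h1 : ∀ p, r p < 1) :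
    Summable fun α : Fin m → ℕ => ∏ p, r p ^ α p := by
  refine summable_of_sum_le (c := ∏ p, (1 - r p)⁻¹)
    (fun α => Finset.prod_nonneg fun p _ => pow_nonneg (h0 p) _) fun u => ?_
  have hsub : u ⊆ Fintype.piFinset fun p => Finset.range (u.sup (fun α => α p) + 1) := by
    intro α hα
    rw [Fintype.mem_piFinset]
    intro p
    rw [Finset.mem_range, Nat.lt_succ_iff]
    exact Finset.le_sup (f := fun α : Fin m → ℕ => α p) hα
  refine (Finset.sum_le_sum_of_subset_of_nonneg hsub fun α _ _ =>
    Finset.prod_nonneg fun p _ => pow_nonneg (h0 p) _).trans ?_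
  rw [← Finset.prod_univ_sum (fun p => Finset.range (u.sup (fun α => α p) + 1)) fun p k => r p ^ k]
  refine Finset.prod_le_prod (fun p _ => Finset.sum_nonneg fun k _ => pow_nonneg (h0 p) _)
    fun p _ => ?_
  rw [← tsum_geometric_of_lt_one (h0 p) (h1 p)]
  exact (summable_geometric_of_lt_one (h0 p) (h1 p)).sum_le_tsum _ fun k _ => pow_nonneg (h0 p) _

lemma DiffNonneg.abs_choose_mul_gridDiff_le {m : ℕ} {ρ : EReal} {f : (Fin m → ℝ) → ℝ}
    (hf : DiffNonneg ρ f) {h b : ℝ} (hh : 0 < h) (hb : b ≤ f fun _ => h) {M : Fin m → ℕ}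
    {y : Fin m → ℝ} (hM : ∀ p, h * (M p + 1) ≤ y p) (hy : ∀ p, (y p : EReal) < ρ)
    (α : Fin m → ℕ) :
    |(∏ p, ((M p).choose (α p) : ℝ)) * gridDiff f h α| ≤ |f y| + |b| := by
  set T : (Fin m → ℕ) → ℝ := fun α => (∏ p, ((M p).choose (α p) : ℝ)) * gridDiff f h α with hT
  set s := Fintype.piFinset fun p => Finset.range (M p + 1) with hs
  change |T α| ≤ _
  have hT0 : T 0 = f fun _ => h := by simp [hT, gridDiff_zero]
  have hMh : ∀ p, h ≤ h * (M p + 1) := fun p => by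
    nlinarith [Nat.cast_nonneg (α := ℝ) (M p)]
  have h0y : f (fun _ => h) ≤ f y := hf.mono (fun _ => hh) (fun p => (hMh p).trans (hM p)) hy
  have hsum : ∑ α ∈ s, T α ≤ f y := by
    rw [← sum_choose_mul_gridDiff]
    exact hf.mono (fun p => hh.trans_le (hMh p)) hM hy
  have hpos : ∀ α ∈ s.erase 0, 0 ≤ T α := by
    intro α hα
    rw [Finset.mem_erase, hs, Fintype.mem_piFinset] at hα
    refine mul_nonneg (by positivity) (hf.gridDiff_nonneg hh hα.1 fun p => ?_)
    refine lt_of_le_of_lt (EReal.coe_le_coe_iff.2 (le_trans ?_ (hM p))) (hy p)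
    have := hα.2 p
    rw [Finset.mem_range, Nat.lt_succ_iff] at this
    gcongr
  have h0s : (0 : Fin m → ℕ) ∈ s := by simp [hs]
  have hfy := le_abs_self (f y)
  have hbb := neg_abs_le b
  have hfy0 := abs_nonneg (f y)
  have hbb0 := abs_nonneg b
  by_cases hα0 : α = 0
  · rw [hα0, hT0, abs_le]
    constructor <;> linarith
  by_cases hαs : α ∈ s
  · have h1 : α ∈ s.erase 0 := Finset.mem_erase.2 ⟨hα0, hαs⟩
    have h2 := Finset.single_le_sum hpos h1
    have h3 := Finset.add_sum_erase s T h0s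
    rw [abs_of_nonneg (hpos α h1)]
    linarith
  · rw [hs, Fintype.mem_piFinset] at hαs
    push Not at hαs
    obtain ⟨p, hp⟩ := hαs
    rw [Finset.mem_range, not_lt] at hp
    have : T α = 0 := by
      simp only [hT]
      rw [Finset.prod_eq_zero (Finset.mem_univ p), zero_mul]
      rw [Nat.choose_eq_zero_of_lt hp, Nat.cast_zero]
    rw [this, abs_zero]
    positivity

lemma DiffNonneg.exists_le_diagonal {m : ℕ} {ρ : EReal} {f : (Fin m → ℝ) → ℝ}
    (hf : DiffNonneg ρ f) (hρ : 0 < ρ) :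
    ∃ c b : ℝ, 0 < c ∧ (c : EReal) < ρ ∧ ∀ h, 0 < h → h ≤ c → b ≤ f fun _ => h := by
  obtain ⟨r, hr0, hr⟩ := EReal.lt_iff_exists_real_btwn.1 hρ
  have hr0 : 0 < r := by exact_mod_cast hr0
  refine ⟨r / 2, 2 * f (fun _ => r / 2) - f fun _ => r, by positivity,
    lt_of_le_of_lt (EReal.coe_le_coe_iff.2 (by linarith)) hr, fun h hh hc => ?_⟩
  have h1 : h + 2 * (r / 2 - h) ≤ r := by linarith
  have h2 := hf.two_mul_le (a := fun _ => h) (s := fun _ => r / 2 - h) (fun _ => hh)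
    (fun _ => by linarith) fun _ => lt_of_le_of_lt (EReal.coe_le_coe_iff.2 h1) hr
  have h3 := hf.mono (x := fun _ => h + 2 * (r / 2 - h)) (y := fun _ => r)
    (fun _ => by linarith) (fun _ => h1) fun _ => hr
  simp only [add_sub_cancel] at h2
  linarith

/-- The mesh `1 / (j + 1)`. -/
noncomputable def mesh (j : ℕ) : ℝ := 1 / ((j : ℝ) + 1)

lemma mesh_pos (j : ℕ) : 0 < mesh j := by unfold mesh; positivity

lemma tendsto_mesh : Tendsto mesh atTop (𝓝 0) := tendsto_one_div_add_atTop_nhds_zero_nat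

/-- The integer part of `x / mesh j`. -/
noncomputable def meshFloor (x : ℝ) (j : ℕ) : ℕ := ⌊x * ((j : ℝ) + 1)⌋₊

lemma mesh_mul (x : ℝ) (j : ℕ) : mesh j * (x * ((j : ℝ) + 1)) = x := by
  unfold mesh
  field_simp

lemma mesh_mul_meshFloor_le {x : ℝ} (hx : 0 ≤ x) (j : ℕ) : mesh j * meshFloor x j ≤ x := by
  conv_rhs => rw [← mesh_mul x j]
  exact mul_le_mul_of_nonneg_left (Nat.floor_le (by positivity)) (mesh_pos j).le

lemma le_mesh_mul_meshFloor (x : ℝ) (j : ℕ) : x ≤ mesh j * (meshFloor x j + 1) := by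
  conv_lhs => rw [← mesh_mul x j]
  exact mul_le_mul_of_nonneg_left (Nat.lt_floor_add_one _).le (mesh_pos j).le

lemma tendsto_mesh_mul_meshFloor {x : ℝ} (hx : 0 ≤ x) :
    Tendsto (fun j => mesh j * meshFloor x j) atTop (𝓝 x) := by
  have h1 := (tendsto_nat_floor_mul_div_atTop hx).comp
    (tendsto_atTop_add_const_right atTop (1 : ℝ) (tendsto_natCast_atTop_atTop (R := ℝ)))
  refine h1.congr fun j => ?_
  simp only [Function.comp, mesh, meshFloor]
  ring

lemma eventually_one_le_meshFloor {x : ℝ} (hx : 0 < x) : ∀ᶠ j in atTop, 1 ≤ meshFloor x j := by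
  have h1 := (tendsto_mesh_mul_meshFloor hx.le).eventually (lt_mem_nhds hx)
  filter_upwards [h1] with j hj
  rw [Nat.one_le_iff_ne_zero]
  rintro h0
  simp [h0] at hj

lemma eventually_mesh_mul_pred_le {x : ℝ} (hx : 0 < x) :
    ∀ᶠ j in atTop, mesh j * (((meshFloor x j - 1 : ℕ) : ℝ) + 1) ≤ x := by
  filter_upwards [eventually_one_le_meshFloor hx] with j hj
  rw [Nat.cast_sub hj, Nat.cast_one, sub_add_cancel]
  exact mesh_mul_meshFloor_le hx.le j

lemma tendsto_mesh_mul_pred {x : ℝ} (hx : 0 < x) :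
    Tendsto (fun j => mesh j * ((meshFloor x j - 1 : ℕ) : ℝ)) atTop (𝓝 x) := by
  have h1 := (tendsto_mesh_mul_meshFloor hx.le).sub tendsto_mesh
  rw [sub_zero] at h1
  refine h1.congr' ?_
  filter_upwards [eventually_one_le_meshFloor hx] with j hj
  rw [Nat.cast_sub hj]
  push_cast
  ring

lemma tendsto_prod_choose_mul_pow {m : ℕ} {F : Filter ℕ} (hF : F ≤ atTop) {N : ℕ → Fin m → ℕ}
    {x : Fin m → ℝ} (hN : ∀ p, Tendsto (fun j => mesh j * N j p) F (𝓝 (x p))) (α : Fin m → ℕ) :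
    Tendsto (fun j => (∏ p, ((N j p).choose (α p) : ℝ)) * mesh j ^ ∑ p, α p) F
      (𝓝 (∏ p, x p ^ α p / (α p).factorial)) := by
  have := tendsto_finsetProd Finset.univ fun p _ =>
    tendsto_choose_mul_pow (tendsto_mesh.mono_left hF) (hN p) (α p)
  refine this.congr fun j => ?_
  rw [Finset.prod_mul_distrib, Finset.prod_pow_eq_pow_sum]

lemma DiffNonneg.exists_tendsto_gridDiff {m : ℕ} {ρ : EReal} {f : (Fin m → ℝ) → ℝ}
    (hf : DiffNonneg ρ f) (hρ : 0 < ρ) (U : Ultrafilter ℕ) (hU : (U : Filter ℕ) ≤ atTop)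
    (α : Fin m → ℕ) : ∃ d : ℝ, (α ≠ 0 → 0 ≤ d) ∧
      Tendsto (fun j => gridDiff f (mesh j) α / mesh j ^ ∑ p, α p) U (𝓝 d) := by
  obtain ⟨c, b, hc, hcρ, hb⟩ := hf.exists_le_diagonal hρ
  set D : ℕ → ℝ := fun j => gridDiff f (mesh j) α / mesh j ^ ∑ p, α p with hD
  have hbound : ∃ K, ∀ᶠ j in atTop, |D j| ≤ K := by
    set Q : ℝ := ∏ p, c ^ α p / (α p).factorial
    have hQ : 0 < Q := Finset.prod_pos fun p _ => by positivity
    have h1 := (tendsto_prod_choose_mul_pow (m := m) le_rfl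
      (fun _ => tendsto_mesh_mul_pred hc) α).eventually (lt_mem_nhds (half_lt_self hQ))
    refine ⟨(|f fun _ => c| + |b|) / (Q / 2), ?_⟩
    filter_upwards [h1, eventually_mesh_mul_pred_le hc, tendsto_mesh.eventually (gt_mem_nhds hc)]
      with j h1 h2 h3
    have h4 := hf.abs_choose_mul_gridDiff_le (mesh_pos j) (hb _ (mesh_pos j) h3.le)
      (M := fun _ => meshFloor c j - 1) (y := fun _ => c) (fun _ => h2) (fun _ => hcρ) α
    rw [le_div_iff₀ (by positivity)]
    have h5 : gridDiff f (mesh j) α = mesh j ^ (∑ p, α p) * D j := by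
      rw [hD]
      field_simp [(mesh_pos j).ne']
    rw [h5, ← mul_assoc, abs_mul, mul_comm] at h4
    refine le_trans ?_ h4
    gcongr
    exact h1.le.trans (le_abs_self _)
  obtain ⟨K, hK⟩ := hbound
  have hmem : ∀ᶠ j in (U : Filter ℕ), D j ∈ Set.Icc (-K) K := by
    filter_upwards [hU hK] with j hj
    exact abs_le.1 hj
  obtain ⟨d, -, hd'⟩ := isCompact_Icc.ultrafilter_le_nhds (U.map D) (le_principal_iff.2 hmem)
  have hd : Tendsto D U (𝓝 d) := hd'
  refine ⟨d, fun hα => ?_, hd⟩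
  refine ge_of_tendsto hd (hU ?_)
  have h1 : ∀ p, ∀ᶠ j in atTop, mesh j * ((α p : ℝ) + 1) < c := fun p => by
    have := tendsto_mesh.mul_const ((α p : ℝ) + 1)
    rw [zero_mul] at this
    exact this.eventually (gt_mem_nhds hc)
  filter_upwards [eventually_all.2 h1] with j hj
  exact div_nonneg (hf.gridDiff_nonneg (mesh_pos j) hα fun p =>
    lt_trans (EReal.coe_lt_coe_iff.2 (hj p)) hcρ) (pow_pos (mesh_pos j) _).le

lemma DiffNonneg.tendsto_grid {m : ℕ} {ρ : EReal} {f : (Fin m → ℝ) → ℝ}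
    (hf : DiffNonneg ρ f) (hρ : 0 < ρ) {U : Filter ℕ} [U.NeBot] (hU : U ≤ atTop)
    {d : (Fin m → ℕ) → ℝ}
    (hd : ∀ α, Tendsto (fun j => gridDiff f (mesh j) α / mesh j ^ ∑ p, α p) U (𝓝 (d α)))
    {x : Fin m → ℝ} (hx : ∀ p, 0 < x p) (hxρ : ∀ p, (x p : EReal) < ρ) {N : ℕ → Fin m → ℕ}
    (hN : ∀ p, Tendsto (fun j => mesh j * N j p) atTop (𝓝 (x p))) :
    (Summable fun α => (∏ p, x p ^ α p / (α p).factorial) * d α) ∧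
    Tendsto (fun j => f fun p => mesh j * (N j p + 1)) U
      (𝓝 (∑' α, (∏ p, x p ^ α p / (α p).factorial) * d α)) := by
  obtain ⟨c, b, hc, hcρ, hb⟩ := hf.exists_le_diagonal hρ
  choose y hxy hyρ using fun p => EReal.lt_iff_exists_real_btwn.1 (hxρ p)
  replace hxy : ∀ p, x p < y p := fun p => by exact_mod_cast hxy p
  have hy : ∀ p, 0 < y p := fun p => (hx p).trans (hxy p)
  have hr : ∀ p, ∃ r, 0 < r ∧ r < 1 ∧ x p < r * y p := fun p => by
    obtain ⟨r, h1, h2⟩ := exists_between ((div_lt_one (hy p)).2 (hxy p))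
    exact ⟨r, (div_pos (hx p) (hy p)).trans h1, h2, (div_lt_iff₀ (hy p)).1 h1⟩
  choose r hr0 hr1 hr using hr
  set T : ℕ → (Fin m → ℕ) → ℝ := fun j α =>
    (∏ p, ((N j p).choose (α p) : ℝ)) * gridDiff f (mesh j) α with hT
  set B := |f y| + |b|
  have hsum : Summable fun α : Fin m → ℕ => (∏ p, r p ^ α p) * B :=
    (summable_prod_pow (fun p => (hr0 p).le) hr1).mul_right B
  have hlim : ∀ α, Tendsto (fun j => T j α) U
      (𝓝 ((∏ p, x p ^ α p / (α p).factorial) * d α)) := fun α => by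
    refine ((tendsto_prod_choose_mul_pow hU (fun p => (hN p).mono_left hU) α).mul (hd α)).congr
      fun j => ?_
    have := (pow_pos (mesh_pos j) (∑ p, α p)).ne'
    simp only [hT]
    field_simp
  have hbound : ∀ᶠ j in U, ∀ α, ‖T j α‖ ≤ (∏ p, r p ^ α p) * B := by
    refine hU ?_
    have h1 : ∀ p, ∀ᶠ j in atTop, mesh j * N j p < mesh j * (r p * (meshFloor (y p) j - 1 : ℕ)) :=
      fun p => by
        refine ((hN p).eventually_lt ?_ (hr p))
        refine ((tendsto_mesh_mul_pred (hy p)).const_mul (r p)).congr fun j => by ring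
    filter_upwards [eventually_all.2 h1,
      eventually_all.2 fun p => eventually_mesh_mul_pred_le (hy p),
      tendsto_mesh.eventually (gt_mem_nhds hc)] with j h1 h2 h3 α
    have h4 := hf.abs_choose_mul_gridDiff_le (mesh_pos j) (hb _ (mesh_pos j) h3.le)
      (M := fun p => meshFloor (y p) j - 1) h2 hyρ α
    have h5 : ∏ p, ((N j p).choose (α p) : ℝ) ≤
        (∏ p, r p ^ α p) * ∏ p, ((meshFloor (y p) j - 1).choose (α p) : ℝ) := by
      rw [← Finset.prod_mul_distrib]
      refine Finset.prod_le_prod (fun p _ => by positivity) fun p _ => ?_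
      exact cast_choose_le (hr0 p).le (hr1 p).le (lt_of_mul_lt_mul_left (h1 p) (mesh_pos j).le).le _
    rw [abs_mul, abs_of_nonneg (by positivity)] at h4
    rw [Real.norm_eq_abs, hT, abs_mul, abs_of_nonneg (by positivity)]
    refine (mul_le_mul_of_nonneg_right h5 (abs_nonneg _)).trans ?_
    rw [mul_assoc]
    exact mul_le_mul_of_nonneg_left h4 (Finset.prod_nonneg fun p _ => pow_nonneg (hr0 p).le _)
  refine ⟨hsum.of_norm_bounded fun α => ?_, ?_⟩
  · exact le_of_tendsto (hlim α).norm (hbound.mono fun j hj => hj α)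
  · refine (tendsto_tsum_of_dominated_convergence hsum hlim hbound).congr fun j => ?_
    rw [sum_choose_mul_gridDiff f (mesh j) (N j)]
    refine tsum_eq_sum fun α hα => ?_
    rw [Fintype.mem_piFinset] at hα
    push Not at hα
    obtain ⟨p, hp⟩ := hα
    rw [Finset.mem_range, not_lt] at hp
    simp only [hT]
    rw [Finset.prod_eq_zero (Finset.mem_univ p), zero_mul]
    rw [Nat.choose_eq_zero_of_lt hp, Nat.cast_zero]

/-- A multivariate Bernstein theorem on absolutely monotone functions. -/
theorem DiffNonneg.exists_hasSum {m : ℕ} {ρ : EReal} {f : (Fin m → ℝ) → ℝ}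
    (hf : DiffNonneg ρ f) (hρ : 0 < ρ) :
    ∃ c : (Fin m → ℕ) → ℝ, (∀ α, α ≠ 0 → 0 ≤ c α) ∧
      ∀ x : Fin m → ℝ, (∀ p, 0 < x p) → (∀ p, (x p : EReal) < ρ) →
        HasSum (fun α => c α * ∏ p, x p ^ α p) (f x) := by
  have hU := Nat.hyperfilter_le_atTop
  choose d hd0 hd using hf.exists_tendsto_gridDiff hρ (hyperfilter ℕ) hU
  refine ⟨fun α => d α / ∏ p, ((α p).factorial : ℝ),
    fun α hα => div_nonneg (hd0 α hα) (by positivity), fun x hx hxρ => ?_⟩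
  obtain ⟨hs, h1⟩ := hf.tendsto_grid hρ hU hd hx hxρ
    (N := fun j p => meshFloor (x p) j - 1) fun p => tendsto_mesh_mul_pred (hx p)
  obtain ⟨-, h2⟩ := hf.tendsto_grid hρ hU hd hx hxρ
    (N := fun j p => meshFloor (x p) j) fun p => tendsto_mesh_mul_meshFloor (hx p).le
  have h3 : (fun α => d α / (∏ p, ((α p).factorial : ℝ)) * ∏ p, x p ^ α p) =
      fun α => (∏ p, x p ^ α p / (α p).factorial) * d α := by
    ext α
    rw [Finset.prod_div_distrib]
    ring
  have h4 : ∑' α, (∏ p, x p ^ α p / (α p).factorial) * d α = f x := by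
    apply le_antisymm
    · refine le_of_tendsto h1 (hU ?_)
      filter_upwards [eventually_all.2 fun p => eventually_mesh_mul_pred_le (hx p)] with j hj
      exact hf.mono (fun p => mul_pos (mesh_pos j) (by positivity)) hj hxρ
    · refine ge_of_tendsto h2 (hU ?_)
      choose y hxy hyρ using fun p => EReal.lt_iff_exists_real_btwn.1 (hxρ p)
      have h5 : ∀ p, ∀ᶠ j in atTop, mesh j * (meshFloor (x p) j + 1) < y p := fun p => by
        have h6 := (tendsto_mesh_mul_meshFloor (hx p).le).add tendsto_mesh
        rw [add_zero] at h6
        refine (h6.congr fun j => ?_).eventually (gt_mem_nhds (EReal.coe_lt_coe_iff.1 (hxy p)))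
        ring
      filter_upwards [eventually_all.2 h5] with j hj
      exact hf.mono hx (fun p => le_mesh_mul_meshFloor _ _) fun p =>
        lt_trans (EReal.coe_lt_coe_iff.2 (hj p)) (hyρ p)
  rw [h3, ← h4]
  exact hs.hasSum

lemma ShiftCondPos.le_add_two_mul {m : ℕ} {I : Set ℝ} {f : (Fin m → ℝ) → ℝ}
    (hf : ShiftCondPos I f) {x u : Fin m → ℝ} (hu : ∀ p, 0 ≤ u p) (hpos : ∀ p, 0 < x p + u p)
    (hx : ∀ p, x p ∈ I) (hxu : ∀ p, x p + u p ∈ I) (hxu2 : ∀ p, x p + 2 * u p ∈ I) :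
    f x ≤ f fun p => x p + 2 * u p := by
  have h := hf.sum_char_nonneg (G := ℤˣ) (fun z => by simp) (fun p => x p + u p)
    (fun p z => u p * unitSign z) unitSign hpos hxu
    (fun p => (PsdFun.hom unitSign).const_mul (hu p)) (fun p z => by
      rcases Int.units_eq_one_or z with rfl | rfl
      · simpa [add_assoc, two_mul] using hxu2 p
      · simpa using hx p) (by rw [sum_intUnits]; simp)
  rw [sum_intUnits] at h
  simp [add_assoc, ← two_mul] at h
  exact h

lemma ShiftCondPos.eight_mul_le {m : ℕ} {I : Set ℝ} {f : (Fin m → ℝ) → ℝ}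
    (hf : ShiftCondPos I f) {x u : Fin m → ℝ} (hu : ∀ p, 0 ≤ u p) (hpos : ∀ p, 0 < x p + u p)
    (hx : ∀ p, x p ∈ I) (hxu : ∀ p, x p + u p ∈ I) (hxu2 : ∀ p, x p + 2 * u p ∈ I) :
    8 * f (fun p => x p + u p) ≤ 6 * f (fun p => x p + 2 * u p) + 2 * f x := by
  let K : Fin 3 → Fin 3 → ℝ := ![![1, 0, -1], ![0, 1, 0], ![-1, 0, 1]]
  have h := hf (Fin 3) (fun p => x p + u p) (fun p i j => u p * K i j) ![1, -2, 1] hpos hxu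
    (fun p i j => by fin_cases i <;> fin_cases j <;> simp [K])
    (fun p v => by
      have : ∑ i, ∑ j, v i * v j * (u p * K i j) = u p * ((v 0 - v 2) ^ 2 + v 1 ^ 2) := by
        simp [Fin.sum_univ_three, K]
        ring
      rw [this]
      exact mul_nonneg (hu p) (by positivity))
    (fun p i j => by
      have h2 := hxu2 p
      rw [two_mul, ← add_assoc] at h2
      fin_cases i <;> fin_cases j <;> simp [K, hx, hxu, h2])
    (by simp [Fin.sum_univ_three]; norm_num)
  simp [Fin.sum_univ_three, K, add_assoc, ← two_mul] at h
  linarith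

section PowerSeries

variable {m : ℕ} {c : (Fin m → ℕ) → ℝ}

lemma norm_mul_prod_pow_le {𝕜 : Type*} [NormedField 𝕜] (a : 𝕜) {z : Fin m → 𝕜} {y : Fin m → ℝ}
    (hz : ∀ p, ‖z p‖ ≤ y p) (α : Fin m → ℕ) :
    ‖a * ∏ p, z p ^ α p‖ ≤ ‖a‖ * ∏ p, y p ^ α p := by
  rw [norm_mul, norm_prod]
  refine mul_le_mul_of_nonneg_left (Finset.prod_le_prod (fun p _ => norm_nonneg _) fun p _ => ?_)
    (norm_nonneg a)
  rw [norm_pow]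
  exact pow_le_pow_left₀ (norm_nonneg _) (hz p) _

lemma summable_norm_mul_prod_pow {y : Fin m → ℝ} (hy : ∀ p, 0 ≤ y p)
    (h : Summable fun α => c α * ∏ p, y p ^ α p) : Summable fun α => ‖c α‖ * ∏ p, y p ^ α p := by
  refine h.norm.congr fun α => ?_
  rw [norm_mul, Real.norm_of_nonneg (Finset.prod_nonneg fun p _ => pow_nonneg (hy p) _)]

lemma tendsto_tsum_mul_prod_pow {ι : Type*} {F : Filter ι} {x y : Fin m → ℝ}
    (h : Summable fun α => ‖c α‖ * ∏ p, y p ^ α p) (hxy : ∀ p, |x p| < y p) {u : ι → Fin m → ℝ}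
    (hu : ∀ p, Tendsto (fun i => u i p) F (𝓝 (x p))) :
    Tendsto (fun i => ∑' α, c α * ∏ p, u i p ^ α p) F (𝓝 (∑' α, c α * ∏ p, x p ^ α p)) := by
  refine tendsto_tsum_of_dominated_convergence h
    (fun α => (tendsto_finsetProd _ fun p _ => (hu p).pow _).const_mul _) ?_
  filter_upwards [eventually_all.2 fun p => (hu p).abs.eventually (gt_mem_nhds (hxy p))] with i hi α
  exact norm_mul_prod_pow_le _ (fun p => (hi p).le) α

lemma differentiableOn_tsum_mul_prod_pow {A B : Fin m → ℝ} {T : ℝ}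
    (h : Summable fun α => ‖c α‖ * ∏ p, (|A p| + T * |B p|) ^ α p) :
    DifferentiableOn ℂ (fun t : ℂ => ∑' α, (c α : ℂ) * ∏ p, (A p + t * B p : ℂ) ^ α p)
      (Metric.ball 0 T) := by
  refine Complex.differentiableOn_tsum_of_summable_norm h (fun α => by fun_prop)
    Metric.isOpen_ball fun α t ht => ?_
  rw [mem_ball_zero_iff] at ht
  have := norm_mul_prod_pow_le (c α : ℂ) (z := fun p => (A p + t * B p : ℂ))
    (y := fun p => |A p| + T * |B p|) (fun p => ?_) α
  · simpa using this
  · refine (norm_add_le _ _).trans ?_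
    rw [norm_mul, Complex.norm_real, Complex.norm_real, Real.norm_eq_abs, Real.norm_eq_abs]
    gcongr

/-- Two power series agreeing on short segments of affine lines agree further along them. -/
lemma tsum_mul_prod_pow_eq_of_eventually {n : ℕ} {d : (Fin n → ℕ) → ℝ} {A B : Fin m → ℝ}
    {A' B' : Fin n → ℝ} {T : ℝ} (hT : 1 < T)
    (hc : Summable fun α => ‖c α‖ * ∏ p, (|A p| + T * |B p|) ^ α p)
    (hd : Summable fun β => ‖d β‖ * ∏ q, (|A' q| + T * |B' q|) ^ β q)
    (heq : ∀ᶠ t in 𝓝[>] (0 : ℝ), ∑' α, c α * ∏ p, (A p + t * B p) ^ α p =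
      ∑' β, d β * ∏ q, (A' q + t * B' q) ^ β q) :
    ∑' α, c α * ∏ p, (A p + B p) ^ α p = ∑' β, d β * ∏ q, (A' q + B' q) ^ β q := by
  have h1 := (differentiableOn_tsum_mul_prod_pow hc).analyticOnNhd Metric.isOpen_ball
  have h2 := (differentiableOn_tsum_mul_prod_pow hd).analyticOnNhd Metric.isOpen_ball
  have hlim : Tendsto (fun t : ℝ => (t : ℂ)) (𝓝[>] 0) (𝓝[≠] 0) := by
    refine tendsto_nhdsWithin_iff.2 ⟨?_, ?_⟩
    · exact (Complex.continuous_ofReal.tendsto' 0 0 (by simp)).mono_left nhdsWithin_le_nhds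
    · filter_upwards [self_mem_nhdsWithin] with t ht
      simpa using (ne_of_gt ht)
  have h3 := h1.eqOn_of_preconnected_of_frequently_eq h2 (convex_ball _ _).isPreconnected
    (z₀ := 0) (by simpa using by linarith) (hlim.frequently (heq.mono fun t ht => by
      have := congrArg ((↑) : ℝ → ℂ) ht
      push_cast at this
      exact this).frequently)
  have h4 := h3 (x := 1) (by simpa using hT)
  simp only [one_mul] at h4
  exact_mod_cast h4

end PowerSeries

lemma shiftCondPos_of_negEigCount_le {I : Set ℝ} {ρ : EReal} {m : ℕ} {k : Fin m → ℕ} {l : ℕ}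
    {f : (Fin m → ℝ) → ℝ} (hpos : ∀ x : ℝ, 0 < x → (x : EReal) < ρ → x ∈ I)
    (hlt : ∀ x ∈ I, (x : EReal) < ρ)
    (hf : ∀ n : ℕ, max (Finset.univ.sup k) 1 ≤ n →
        ∀ B : Fin m → Matrix (Fin n) (Fin n) ℝ,
        (∀ p, (B p).IsSymm ∧ (∀ i j, B p i j ∈ I) ∧ negEigCount (B p) = k p) →
        negEigCount (Matrix.of fun i j => f fun p => B p i j) ≤ l) : ShiftCondPos I f := by
  intro X _ _ a P v ha haI hsymm hP hmem hv
  choose r har hrρ using fun p => EReal.lt_iff_exists_real_btwn.1 (hlt _ (haI p))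
  replace har : ∀ p, a p < r p := fun p => by exact_mod_cast har p
  refine sum_nonneg_of_negEigCount_le hf a (fun p => min (a p / 2) (r p - a p)) P v
    (fun p => ⟨ha p, haI p⟩) (fun p => ?_) hsymm hP hmem hv
  have h1 := min_le_left (a p / 2) (r p - a p)
  have h2 := min_le_right (a p / 2) (r p - a p)
  have h3 : 0 < min (a p / 2) (r p - a p) := lt_min (half_pos (ha p)) (sub_pos.2 (har p))
  have h4 : ∀ y : ℝ, y ≤ r p → (y : EReal) < ρ := fun y hy =>
    lt_of_le_of_lt (EReal.coe_le_coe_iff.2 hy) (hrρ p)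
  exact ⟨h3, hpos _ (by linarith [ha p]) (h4 _ (by linarith [har p])),
    hpos _ (by linarith [ha p]) (h4 _ (by linarith))⟩

/-- The power series of `f` on the open positive box also represents `f` at boundary points. -/
lemma ShiftCondPos.eq_tsum_of_nonneg {m : ℕ} {I : Set ℝ} {ρ : EReal} {f : (Fin m → ℝ) → ℝ}
    (hf : ShiftCondPos I f) (hpos : ∀ x : ℝ, 0 < x → (x : EReal) < ρ → x ∈ I)
    {c : (Fin m → ℕ) → ℝ} (hc : ∀ x : Fin m → ℝ, (∀ p, 0 < x p) → (∀ p, (x p : EReal) < ρ) →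
      HasSum (fun α => c α * ∏ p, x p ^ α p) (f x))
    {x : Fin m → ℝ} (hx : ∀ p, 0 ≤ x p) (hxI : ∀ p, x p ∈ I) (hxρ : ∀ p, (x p : EReal) < ρ) :
    f x = ∑' α, c α * ∏ p, x p ^ α p := by
  choose y hxy hyρ using fun p => EReal.lt_iff_exists_real_btwn.1 (hxρ p)
  replace hxy : ∀ p, x p < y p := fun p => by exact_mod_cast hxy p
  have hy : ∀ p, 0 < y p := fun p => (hx p).trans_lt (hxy p)
  have hsum := summable_norm_mul_prod_pow (fun p => (hy p).le) (hc y hy hyρ).summable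
  set w : Fin m → ℝ := fun p => if x p = 0 then 1 else 0 with hw
  have hw0 : ∀ p, 0 ≤ w p := fun p => by simp only [hw]; split_ifs <;> simp
  have hxw : ∀ p (s : ℝ), 0 < s → 0 < x p + s * w p := fun p s hs => by
    rcases (hx p).eq_or_lt with h | h
    · simp [hw, ← h, hs]
    · have := mul_nonneg hs.le (hw0 p)
      linarith
  have hpath : ∀ (a : ℝ) p, Tendsto (fun s : ℝ => x p + a * (s * w p)) (𝓝[>] 0) (𝓝 (x p)) := by
    intro a p
    refine (Continuous.tendsto' (by fun_prop) _ _ (by simp)).mono_left nhdsWithin_le_nhds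
  have hlim := fun a => tendsto_tsum_mul_prod_pow hsum
    (fun p => by rw [abs_of_nonneg (hx p)]; exact hxy p) (hpath a)
  have hev : ∀ᶠ s in 𝓝[>] (0 : ℝ), ∀ p, 0 < s ∧ x p + 2 * (s * w p) < y p := by
    filter_upwards [self_mem_nhdsWithin,
      eventually_all.2 fun p => (hpath 2 p).eventually (gt_mem_nhds (hxy p))] with s hs h p
    exact ⟨hs, h p⟩
  have hρ2 : ∀ {p} {s : ℝ}, x p + 2 * (s * w p) < y p →
      ((x p + 2 * (s * w p) : ℝ) : EReal) < ρ := fun {p s} h =>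
    lt_trans (EReal.coe_lt_coe_iff.2 h) (hyρ p)
  have hρ1 : ∀ {p} {s : ℝ}, 0 < s → x p + 2 * (s * w p) < y p →
      ((x p + s * w p : ℝ) : EReal) < ρ := fun {p s} hs h => by
    have := mul_nonneg hs.le (hw0 p)
    exact lt_of_le_of_lt (EReal.coe_le_coe_iff.2 (by linarith)) (hρ2 h)
  have hw2 : ∀ {p} {s : ℝ}, 0 < s → 0 < x p + 2 * (s * w p) := fun {p s} hs => by
    have := mul_nonneg hs.le (hw0 p)
    linarith [hxw p s hs]
  rcases Nat.eq_zero_or_pos m with rfl | hm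
  · exact (hc x (fun p => p.elim0) fun p => p.elim0).tsum_eq.symm
  apply le_antisymm
  · refine ge_of_tendsto (hlim 2) ?_
    filter_upwards [hev] with s hs
    have hs0 := (hs ⟨0, hm⟩).1
    rw [(hc _ (fun p => hw2 hs0) fun p => hρ2 (hs p).2).tsum_eq]
    exact hf.le_add_two_mul (fun p => mul_nonneg hs0.le (hw0 p)) (fun p => hxw p s hs0) hxI
      (fun p => hpos _ (hxw p s hs0) (hρ1 hs0 (hs p).2))
      fun p => hpos _ (hw2 hs0) (hρ2 (hs p).2)
  · have h1 := ((hlim 1).const_mul 8).sub ((hlim 2).const_mul 6)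
    have h2 : 8 * ∑' α, c α * ∏ p, x p ^ α p - 6 * ∑' α, c α * ∏ p, x p ^ α p ≤ 2 * f x := by
      refine le_of_tendsto h1 ?_
      filter_upwards [hev] with s hs
      have hs0 := (hs ⟨0, hm⟩).1
      simp only [one_mul]
      rw [(hc _ (fun p => hw2 hs0) fun p => hρ2 (hs p).2).tsum_eq,
        (hc _ (fun p => hxw p s hs0) fun p => hρ1 hs0 (hs p).2).tsum_eq]
      have := hf.eight_mul_le (fun p => mul_nonneg hs0.le (hw0 p)) (fun p => hxw p s hs0) hxI
        (fun p => hpos _ (hxw p s hs0) (hρ1 hs0 (hs p).2))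
        fun p => hpos _ (hw2 hs0) (hρ2 (hs p).2)
      linarith
    linarith

/-- The power series of `f` on the open positive box also represents `f` on the symmetric box. -/
lemma ShiftCondPos.eq_tsum_of_symmetric {m : ℕ} {I : Set ℝ} {ρ : EReal} {f : (Fin m → ℝ) → ℝ}
    (hf : ShiftCondPos I f) (hI : ∀ x : ℝ, x ∈ I ↔ ((|x| : ℝ) : EReal) < ρ)
    {c : (Fin m → ℕ) → ℝ} (hc : ∀ x : Fin m → ℝ, (∀ p, 0 < x p) → (∀ p, (x p : EReal) < ρ) →
      HasSum (fun α => c α * ∏ p, x p ^ α p) (f x))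
    {x : Fin m → ℝ} (hx : ∀ p, x p ∈ I) : f x = ∑' α, c α * ∏ p, x p ^ α p := by
  have hAB : ∀ p, ∃ A B r : ℝ, 0 < A ∧ 0 ≤ B ∧ A - B = x p ∧ A + B < r ∧ (r : EReal) < ρ := by
    intro p
    obtain ⟨r, hxr, hr⟩ := EReal.lt_iff_exists_real_btwn.1 ((hI _).1 (hx p))
    replace hxr : |x p| < r := by exact_mod_cast hxr
    obtain ⟨h1, h2⟩ := abs_lt.1 hxr
    rcases lt_or_ge 0 (x p) with h | h
    · exact ⟨x p, 0, r, h, le_rfl, by ring, by linarith, hr⟩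
    · exact ⟨(r + x p) / 4, (r + x p) / 4 - x p, r, by linarith, by linarith, by ring,
        by linarith, hr⟩
  choose A B r hA hB hABx hABr hr using hAB
  obtain ⟨T, hTr, hT⟩ : ∃ T : ℝ, (∀ p, A p + T * B p < r p) ∧ 1 < T := by
    have h1 : ∀ᶠ T in 𝓝[>] (1 : ℝ), ∀ p, A p + T * B p < r p := by
      refine eventually_all.2 fun p => nhdsWithin_le_nhds ?_
      have : Tendsto (fun T : ℝ => A p + T * B p) (𝓝 1) (𝓝 (A p + B p)) :=
        Continuous.tendsto' (by fun_prop) _ _ (by simp)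
      exact this.eventually (gt_mem_nhds (hABr p))
    exact (h1.and self_mem_nhdsWithin).exists
  have hρ : ∀ p (y : ℝ), y < r p → (y : EReal) < ρ := fun p y hy =>
    lt_trans (EReal.coe_lt_coe_iff.2 hy) (hr p)
  have hmem : ∀ p (y : ℝ), |y| < r p → y ∈ I := fun p y hy => (hI _).2 (hρ p _ hy)
  have hmemT : ∀ p (t : ℝ), 0 < t → (t : EReal) < (T : ℝ) →
      A p + t * B p ∈ I ∧ A p - t * B p ∈ I := by
    intro p t ht htT
    replace htT : t < T := by exact_mod_cast htT
    have h1 := mul_nonneg ht.le (hB p)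
    have h2 : t * B p ≤ T * B p := mul_le_mul_of_nonneg_right htT.le (hB p)
    have h3 := hTr p
    have h4 := hA p
    constructor <;> refine hmem p _ (abs_lt.2 ⟨?_, ?_⟩) <;> linarith
  have hAI : ∀ p, A p ∈ I := fun p =>
    hmem p _ (by rw [abs_of_pos (hA p)]; linarith [hABr p, hB p])
  have hT0 : (0 : EReal) < (T : ℝ) := by exact_mod_cast zero_lt_one.trans hT
  obtain ⟨d₁, -, hd₁⟩ := (hf.diffNonneg_slice A B hA hAI hB hmemT 1).exists_hasSum hT0
  obtain ⟨d₂, -, hd₂⟩ := (hf.diffNonneg_slice A B hA hAI hB hmemT unitSign).exists_hasSum hT0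
  have hd : ∀ t : ℝ, 0 < t → t < T → HasSum (fun β : Fin 1 → ℕ =>
      ((d₁ β - d₂ β) / 2) * ∏ q, (0 + t * 1) ^ β q) (f fun p => A p - t * B p) := by
    intro t ht htT
    have h1 := hd₁ (fun _ => t) (fun _ => ht) fun _ => EReal.coe_lt_coe_iff.2 htT
    have h2 := hd₂ (fun _ => t) (fun _ => ht) fun _ => EReal.coe_lt_coe_iff.2 htT
    rw [MonoidHom.one_apply] at h1
    rw [unitSign_neg_one] at h2
    have h3 := (h1.sub h2).div_const 2
    have h4 : ∀ u v : ℝ, (u + 1 * v - (u + -1 * v)) / 2 = v := fun u v => by ring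
    rw [h4] at h3
    have h5 : (fun β : Fin 1 → ℕ => (d₁ β - d₂ β) / 2 * ∏ q, (0 + t * 1) ^ β q) =
        fun β => (d₁ β * ∏ q, t ^ β q - d₂ β * ∏ q, t ^ β q) / 2 := by
      ext β
      rw [zero_add, mul_one]
      ring
    rw [h5]
    exact h3
  obtain ⟨S, hS1, hST⟩ := exists_between hT
  have hS0 : 0 < S := zero_lt_one.trans hS1
  have h1 : Summable fun α => ‖c α‖ * ∏ p, (|A p| + S * |-B p|) ^ α p := by
    refine summable_norm_mul_prod_pow (fun p => by positivity)
      (hc _ (fun p => ?_) fun p => ?_).summable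
    · have := hA p
      positivity
    · rw [abs_neg, abs_of_pos (hA p), abs_of_nonneg (hB p)]
      refine hρ p _ (lt_of_le_of_lt ?_ (hTr p))
      have := mul_le_mul_of_nonneg_right hST.le (hB p)
      linarith
  have h2 : Summable fun β : Fin 1 → ℕ =>
      ‖(d₁ β - d₂ β) / 2‖ * ∏ q, (|(0 : ℝ)| + S * |(1 : ℝ)|) ^ β q := by
    refine summable_norm_mul_prod_pow (fun q => by positivity) ?_
    simpa using (hd S hS0 hST).summable
  have h3 := tsum_mul_prod_pow_eq_of_eventually (A := A) (B := fun p => -B p) (A' := fun _ => 0)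
    (B' := fun _ => 1) hS1 h1 h2 ?_
  · rw [show f x = f fun p => A p - 1 * B p by simp [hABx], ← (hd 1 one_pos hT).tsum_eq]
    simpa [← sub_eq_add_neg, hABx] using h3.symm
  · have h4 : ∀ᶠ t in 𝓝[>] (0 : ℝ), ∀ p, 0 < A p - t * B p := by
      refine eventually_all.2 fun p => nhdsWithin_le_nhds ?_
      have : Tendsto (fun t : ℝ => A p - t * B p) (𝓝 0) (𝓝 (A p)) :=
        Continuous.tendsto' (by fun_prop) _ _ (by simp)
      exact this.eventually (lt_mem_nhds (hA p))
    filter_upwards [h4, self_mem_nhdsWithin,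
      nhdsWithin_le_nhds (gt_mem_nhds (zero_lt_one.trans hT))] with t h4 ht htT
    replace ht : 0 < t := ht
    rw [(hd t ht htT).tsum_eq]
    simp only [mul_neg, ← sub_eq_add_neg]
    refine (hc _ h4 fun p => hρ p _ ?_).tsum_eq
    have := mul_nonneg ht.le (hB p)
    linarith [hABr p, hB p]

/-- Proposition 4.5(1): if `f[-]` sends `S_n^(𝐤)(I)` to the matrices with at most `l`
negative eigenvalues for all `n ≥ k_max`, where `I` is one of `(-ρ,ρ)`, `(0,ρ)`,
`[0,ρ)`, then `f` is represented on `Iᵐ` by a convergent power series whose coefficients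
`c_α` are non-negative for all `α ≠ 𝟎`. -/
theorem multivar_preserver_power_series (ρ : EReal) (hρ : 0 < ρ) (I : Set ℝ)
    (hI : I = {x : ℝ | -ρ < (x : EReal) ∧ (x : EReal) < ρ} ∨
          I = {x : ℝ | 0 < x ∧ (x : EReal) < ρ} ∨
          I = {x : ℝ | 0 ≤ x ∧ (x : EReal) < ρ})
    (m : ℕ) (k : Fin m → ℕ) (l : ℕ) (f : (Fin m → ℝ) → ℝ)
    (hf : ∀ n : ℕ, max (Finset.univ.sup k) 1 ≤ n →
        ∀ B : Fin m → Matrix (Fin n) (Fin n) ℝ,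
        (∀ p, (B p).IsSymm ∧ (∀ i j, B p i j ∈ I) ∧ negEigCount (B p) = k p) →
        negEigCount (Matrix.of fun i j => f fun p => B p i j) ≤ l) :
    ∃ c : (Fin m → ℕ) → ℝ, (∀ α : Fin m → ℕ, α ≠ 0 → 0 ≤ c α) ∧
      ∀ x : Fin m → ℝ, (∀ p, x p ∈ I) →
        HasSum (fun α : Fin m → ℕ => c α * ∏ p, x p ^ α p) (f x) := by
  have hpos : ∀ x : ℝ, 0 < x → (x : EReal) < ρ → x ∈ I := by
    intro x hx hxρ
    rcases hI with rfl | rfl | rfl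
    · refine ⟨lt_trans ?_ (EReal.coe_pos.2 hx), hxρ⟩
      simpa using EReal.neg_lt_neg_iff.2 hρ
    · exact ⟨hx, hxρ⟩
    · exact ⟨hx.le, hxρ⟩
  have habs : ∀ x ∈ I, ((|x| : ℝ) : EReal) < ρ := by
    intro x hx
    rcases hI with rfl | rfl | rfl
    · rcases abs_cases x with h | h <;> rw [h.1]
      · exact hx.2
      · rw [EReal.coe_neg]
        exact EReal.neg_lt_comm.1 hx.1
    · rw [abs_of_pos hx.1]
      exact hx.2
    · rw [abs_of_nonneg hx.1]
      exact hx.2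
  have hlt : ∀ x ∈ I, (x : EReal) < ρ := fun x hx =>
    lt_of_le_of_lt (EReal.coe_le_coe_iff.2 (le_abs_self x)) (habs x hx)
  have hS := shiftCondPos_of_negEigCount_le hpos hlt hf
  obtain ⟨c, hc0, hc⟩ := (hS.diffNonneg hpos).exists_hasSum hρ
  refine ⟨c, hc0, fun x hx => ?_⟩
  have hsum : Summable fun α : Fin m → ℕ => c α * ∏ p, x p ^ α p := by
    choose y hxy hyρ using fun p => EReal.lt_iff_exists_real_btwn.1 (habs _ (hx p))
    replace hxy : ∀ p, |x p| < y p := fun p => by exact_mod_cast hxy p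
    have hy : ∀ p, 0 < y p := fun p => (abs_nonneg _).trans_lt (hxy p)
    exact (summable_norm_mul_prod_pow (fun p => (hy p).le) (hc y hy hyρ).summable).of_norm_bounded
      fun α => norm_mul_prod_pow_le _ (fun p => (hxy p).le) α
  have heq : f x = ∑' α, c α * ∏ p, x p ^ α p := by
    by_cases h0 : ∀ p, 0 ≤ x p
    · exact hS.eq_tsum_of_nonneg hpos hc h0 hx fun p => hlt _ (hx p)
    · push Not at h0
      obtain ⟨q, hq⟩ := h0
      have hsymm : I = {x : ℝ | -ρ < (x : EReal) ∧ (x : EReal) < ρ} := by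
        rcases hI with h | h | h
        · exact h
        · exact absurd (h ▸ hx q).1 (not_lt.2 hq.le)
        · exact absurd (h ▸ hx q).1 (not_le.2 hq)
      refine hS.eq_tsum_of_symmetric (fun z => ⟨habs z, fun hz => ?_⟩) hc hx
      rw [hsymm]
      refine ⟨EReal.neg_lt_comm.1 ?_, lt_of_le_of_lt (EReal.coe_le_coe_iff.2 (le_abs_self z)) hz⟩
      exact lt_of_le_of_lt (EReal.coe_le_coe_iff.2 (neg_le_abs z)) hz
  rw [heq]
  exact hsum.hasSum
end

section
/- Let I = (0, ρ) where 0 < ρ ≤ ∞ and let m be a positive integer. A smooth function f : I^m → ℝ is absolutely monotone (that is, all its partial derivatives of all orders, including order zero, are non-negative at every point of I^m) if and only if f is represented on I^m by a convergent power series with non-negative Maclaurin coefficients: f(x) = Σ_{α ∈ ℤ₊^m} c_α x^α for all x ∈ I^m, where c_α ≥ 0 for all α ∈ ℤ₊^m. -/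
open Set Filter Topology

/-- On a closed interval, the iterated derivatives within the interval of the first member of a
sequence of functions, each the derivative of the previous one, are the members of the sequence. -/
theorem iteratedDerivWithin_eq_of_hasDerivAt_succ {G : ℕ → ℝ → ℝ} {s x : ℝ} (hsx : s < x)
    (hG : ∀ n, ∀ t ∈ Icc s x, HasDerivAt (G n) (G (n + 1) t) t) (n : ℕ) :
    ∀ t ∈ Icc s x, iteratedDerivWithin n (G 0) (Icc s x) t = G n t := by
  induction n with
  | zero => intro t _; simp
  | succ n ih =>
    intro t ht
    rw [iteratedDerivWithin_succ, derivWithin_congr ih (ih t ht)]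
    exact (hG n t ht).hasDerivWithinAt.derivWithin (uniqueDiffOn_Icc hsx t ht)

/-- Taylor's theorem with the Cauchy remainder for a sequence of successive derivatives. -/
theorem exists_taylor_cauchy_of_hasDerivAt_succ {G : ℕ → ℝ → ℝ} {s x : ℝ} (hsx : s < x)
    (hG : ∀ n, ∀ t ∈ Icc s x, HasDerivAt (G n) (G (n + 1) t) t) (n : ℕ) :
    ∃ ξ ∈ Ioo s x, G 0 x - ∑ k ∈ Finset.range (n + 1), G k s * (x - s) ^ k / k.factorial =
      G (n + 1) ξ * (x - ξ) ^ n / n.factorial * (x - s) := by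
  have hI := iteratedDerivWithin_eq_of_hasDerivAt_succ hsx hG
  have hdiff : ∀ k, DifferentiableOn ℝ (iteratedDerivWithin k (G 0) (Icc s x)) (Icc s x) :=
    fun k t ht => ((hG k t ht).differentiableAt.differentiableWithinAt).congr (hI k) (hI k t ht)
  have hcd : ContDiffOn ℝ n (G 0) (Icc s x) := contDiffOn_of_differentiableOn_deriv
    fun k _ => hdiff k
  rw [← uIcc_of_le hsx.le] at hcd
  obtain ⟨ξ, hξ, h⟩ := taylor_mean_remainder_cauchy (n := n) hsx.ne hcd (by
    rw [uIcc_of_le hsx.le, uIoo_of_le hsx.le]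
    exact (hdiff n).mono Ioo_subset_Icc_self)
  rw [uIoo_of_le hsx.le] at hξ
  refine ⟨ξ, hξ, ?_⟩
  rw [uIcc_of_le hsx.le, hI _ ξ (Ioo_subset_Icc_self hξ), taylor_within_apply] at h
  rw [← h]
  congr 1
  refine Finset.sum_congr rfl fun k _ => ?_
  rw [hI k s (left_mem_Icc.2 hsx.le), smul_eq_mul]
  ring

/-- **Bernstein's theorem** in one variable, at the point `1`: a function with nonnegative
derivatives of all orders on `(0, b]`, `1 < b`, is the sum of its Taylor series at `0`. -/
theorem hasSum_of_hasDerivAt_succ_nonneg {G : ℕ → ℝ → ℝ} {a : ℕ → ℝ} {b : ℝ} (hb : 1 < b)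
    (hG : ∀ n t, 0 < t → t ≤ b → HasDerivAt (G n) (G (n + 1) t) t)
    (hpos : ∀ n t, 0 < t → t ≤ b → 0 ≤ G n t)
    (ha : ∀ n, Tendsto (G n) (𝓝[>] 0) (𝓝 (a n))) :
    HasSum (fun n => a n / n.factorial) (G 0 1) := by
  have hb1 : 0 < b - 1 := by linarith
  have hlower : ∀ (n : ℕ) (ξ : ℝ), 0 < ξ → ξ < b → G n ξ * (b - ξ) ^ n / n.factorial ≤ G 0 b := by
    intro n ξ h0 h1
    obtain ⟨η, hη, h⟩ := exists_taylor_cauchy_of_hasDerivAt_succ h1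
      (fun n t ht => hG n t (h0.trans_le ht.1) ht.2) n
    have hR : 0 ≤ G (n + 1) η * (b - η) ^ n / n.factorial * (b - ξ) := by
      have := hpos (n + 1) η (h0.trans hη.1) hη.2.le
      have h2 : 0 ≤ b - η := by linarith [hη.2]
      have h3 : 0 ≤ b - ξ := by linarith
      positivity
    have hterm := Finset.single_le_sum (s := Finset.range (n + 1))
      (f := fun k => G k ξ * (b - ξ) ^ k / k.factorial) (fun k _ => by
        have := hpos k ξ h0 h1.le
        have h3 : 0 ≤ b - ξ := by linarith
        positivity) (Finset.self_mem_range_succ n)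
    linarith
  have hbound : ∀ (n : ℕ) (s : ℝ), 0 < s → s < 1 →
      G 0 1 - ∑ k ∈ Finset.range (n + 1), G k s * (1 - s) ^ k / k.factorial ∈
        Icc 0 (G 0 b / (b - 1) * ((n + 1) * (1 / b) ^ n)) := by
    intro n s h0 h1
    obtain ⟨ξ, hξ, h⟩ := exists_taylor_cauchy_of_hasDerivAt_succ h1
      (fun n t ht => hG n t (h0.trans_le ht.1) (ht.2.trans hb.le)) n
    have hξ0 : 0 < ξ := h0.trans hξ.1
    have hξb : 0 < b - ξ := by linarith [hξ.2]
    have hξ1 : 0 < 1 - ξ := by linarith [hξ.2]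
    have hGn := hpos (n + 1) ξ hξ0 (by linarith)
    have hGb := hpos 0 b (by linarith) le_rfl
    have hs : 0 ≤ 1 - s := by linarith
    rw [h]
    refine ⟨by positivity, ?_⟩
    have hl := hlower (n + 1) ξ hξ0 (by linarith)
    have hratio : (1 - ξ) / (b - ξ) ≤ 1 / b := by
      rw [div_le_div_iff₀ hξb (by linarith)]
      nlinarith
    calc G (n + 1) ξ * (1 - ξ) ^ n / n.factorial * (1 - s)
        ≤ G (n + 1) ξ * (1 - ξ) ^ n / n.factorial * 1 := by gcongr; linarith
      _ = (G (n + 1) ξ * (b - ξ) ^ (n + 1) / (n + 1).factorial) / (b - ξ) *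
            ((n + 1) * ((1 - ξ) / (b - ξ)) ^ n) := by
          rw [Nat.factorial_succ, div_pow]
          push_cast
          field_simp
          ring
      _ ≤ G 0 b / (b - 1) * ((n + 1) * (1 / b) ^ n) := by
          gcongr
          exact hξ.2.le
  have hnonneg : ∀ n, 0 ≤ a n := fun n => ge_of_tendsto (ha n) (by
    filter_upwards [Ioo_mem_nhdsGT (show (0 : ℝ) < b by linarith)] with t ht
    exact hpos n t ht.1 ht.2.le)
  have hlim : ∀ n : ℕ, G 0 1 - ∑ k ∈ Finset.range (n + 1), a k / k.factorial ∈
        Icc 0 (G 0 b / (b - 1) * ((n + 1) * (1 / b) ^ n)) := by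
    intro n
    refine isClosed_Icc.mem_of_tendsto (b := 𝓝[>] (0 : ℝ))
      (f := fun s => G 0 1 - ∑ k ∈ Finset.range (n + 1), G k s * (1 - s) ^ k / k.factorial) ?_ ?_
    · refine tendsto_const_nhds.sub (tendsto_finsetSum _ fun k _ => ?_)
      have h1 : Tendsto (fun s : ℝ => (1 - s) ^ k) (𝓝[>] 0) (𝓝 1) := by
        have : Continuous fun s : ℝ => (1 - s) ^ k := by fun_prop
        simpa using (this.tendsto 0).mono_left nhdsWithin_le_nhds
      simpa using ((ha k).mul h1).div_const (k.factorial : ℝ)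
    · filter_upwards [Ioo_mem_nhdsGT (one_pos (α := ℝ))] with s hs
      exact hbound n s hs.1 hs.2
  rw [hasSum_iff_tendsto_nat_of_nonneg (fun n => div_nonneg (hnonneg n) (by positivity)),
    ← tendsto_add_atTop_iff_nat 1]
  have hK : Tendsto (fun n : ℕ => G 0 b / (b - 1) * ((n + 1) * (1 / b) ^ n)) atTop (𝓝 0) := by
    have hr : |1 / b| < 1 := by
      rw [abs_of_pos (by positivity), div_lt_one (by linarith)]; exact hb
    have h1 := tendsto_self_mul_const_pow_of_abs_lt_one hr
    have h2 := tendsto_pow_atTop_nhds_zero_of_abs_lt_one hr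
    have := (h1.add h2).const_mul (G 0 b / (b - 1))
    simpa [add_mul] using this
  have h0 := squeeze_zero (fun n => (hlim n).1) (fun n => (hlim n).2) hK
  simpa using (tendsto_const_nhds (x := G 0 1)).sub h0

/-- The open cube `(0, ρ)^m`. -/
def openCube (m : ℕ) (ρ : EReal) : Set (Fin m → ℝ) :=
  {x | ∀ p, 0 < x p ∧ (x p : EReal) < ρ}

theorem isOpen_openCube (m : ℕ) (ρ : EReal) : IsOpen (openCube m ρ) := by
  simp only [openCube, ofPred_forall]
  refine isOpen_iInter_of_finite fun p =>
    (isOpen_lt continuous_const (continuous_apply p)).inter ?_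
  exact isOpen_lt (continuous_coe_real_ereal.comp (continuous_apply p)) continuous_const

theorem mem_openCube_of_le {m : ℕ} {ρ : EReal} {x y : Fin m → ℝ} (hy : y ∈ openCube m ρ)
    (hx : ∀ p, 0 < x p) (hxy : x ≤ y) : x ∈ openCube m ρ := fun p =>
  ⟨hx p, (EReal.coe_le_coe_iff.2 (hxy p)).trans_lt (hy p).2⟩

section Derivatives

variable {m N : ℕ} {ρ : EReal} {f : (Fin m → ℝ) → ℝ}

/-- For a smooth function on an open set, the iterated derivative evaluated at fixed vectors is
differentiable. -/
theorem ContDiffOn.hasFDerivAt_iteratedFDerivWithin_apply {E : Type*} [NormedAddCommGroup E]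
    [NormedSpace ℝ E] {S : Set E} {g : E → ℝ} (hS : IsOpen S)
    (hg : ContDiffOn ℝ (⊤ : ℕ∞) g S) (N : ℕ) (v : Fin N → E) {x : E} (hx : x ∈ S) :
    HasFDerivAt (fun y => iteratedFDerivWithin ℝ N g S y v)
      ((ContinuousMultilinearMap.apply ℝ (fun _ : Fin N => E) ℝ v).comp
        (fderivWithin ℝ (iteratedFDerivWithin ℝ N g S) S x)) x := by
  have h := (hg.differentiableOn_iteratedFDerivWithin (m := N)
    (by exact_mod_cast WithTop.coe_lt_top _) hS.uniqueDiffOn x hx).hasFDerivWithinAt.hasFDerivAt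
      (hS.mem_nhds hx)
  exact (ContinuousMultilinearMap.apply ℝ (fun _ : Fin N => E) ℝ v).hasFDerivAt.comp x h

/-- The derivative along a curve of an iterated derivative evaluated at fixed vectors. -/
theorem ContDiffOn.hasDerivAt_iteratedFDerivWithin_apply_comp {E : Type*} [NormedAddCommGroup E]
    [NormedSpace ℝ E] {S : Set E} {g : E → ℝ} (hS : IsOpen S)
    (hg : ContDiffOn ℝ (⊤ : ℕ∞) g S) (N : ℕ) (v : Fin N → E) {γ : ℝ → E} {w : E} {t : ℝ}
    (hγ : HasDerivAt γ w t) (ht : γ t ∈ S) :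
    HasDerivAt (fun s => iteratedFDerivWithin ℝ N g S (γ s) v)
      (iteratedFDerivWithin ℝ (N + 1) g S (γ t) (Fin.cons w v)) t := by
  have h := (hg.hasFDerivAt_iteratedFDerivWithin_apply hS N v ht).comp_hasDerivAt t hγ
  rw [iteratedFDerivWithin_succ_apply_left]
  simpa [Function.comp_def] using h

/-- The mixed partial derivative of `f` within `S` in the coordinate directions `d`. -/
noncomputable def mixedPartial (f : (Fin m → ℝ) → ℝ) (S : Set (Fin m → ℝ)) (d : Fin N → Fin m)
    (x : Fin m → ℝ) : ℝ :=
  iteratedFDerivWithin ℝ N f S x (fun i => Pi.single (d i) 1)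

/-- Expansion of the iterated derivative along a constant vector into mixed partial derivatives. -/
theorem iteratedFDerivWithin_apply_const_eq_sum (S : Set (Fin m → ℝ)) (y x : Fin m → ℝ) :
    iteratedFDerivWithin ℝ N f S y (fun _ => x) =
      ∑ d : Fin N → Fin m, (∏ i, x (d i)) * mixedPartial f S d y := by
  have hx : (fun _ : Fin N => x) = fun _ => ∑ p, x p • Pi.single p (1 : ℝ) := by
    ext i q
    simp [Finset.sum_apply, Pi.single_apply]
  rw [hx, ContinuousMultilinearMap.map_sum]
  refine Finset.sum_congr rfl fun d _ => ?_
  rw [ContinuousMultilinearMap.map_smul_univ, smul_eq_mul, mixedPartial]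

theorem iteratedFDerivWithin_cons_eq_sum (S : Set (Fin m → ℝ)) (y w : Fin m → ℝ)
    (d : Fin N → Fin m) :
    iteratedFDerivWithin ℝ (N + 1) f S y (Fin.cons w fun i => Pi.single (d i) 1) =
      ∑ p, w p * mixedPartial f S (Fin.cons p d : Fin (N + 1) → Fin m) y := by
  have hw : w = ∑ p, w p • Pi.single p (1 : ℝ) := by
    ext q
    simp [Finset.sum_apply, Pi.single_apply]
  conv_lhs => rw [hw, iteratedFDerivWithin_succ_apply_left]
  simp only [Fin.cons_zero, map_sum, map_smul, Fin.tail_cons]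
  rw [sum_apply]
  refine Finset.sum_congr rfl fun p _ => ?_
  rw [smul_apply, smul_eq_mul, mixedPartial,
    iteratedFDerivWithin_succ_apply_left]
  congr 1

/-- If all mixed partial derivatives are nonnegative on the cube, they are monotone there. -/
theorem mixedPartial_mono (hf : ContDiffOn ℝ (⊤ : ℕ∞) f (openCube m ρ))
    (hpos : ∀ (N : ℕ) (d : Fin N → Fin m), ∀ x ∈ openCube m ρ,
      0 ≤ mixedPartial f (openCube m ρ) d x)
    (d : Fin N → Fin m) {x y : Fin m → ℝ} (hx : x ∈ openCube m ρ) (hy : y ∈ openCube m ρ)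
    (hxy : x ≤ y) :
    mixedPartial f (openCube m ρ) d x ≤ mixedPartial f (openCube m ρ) d y := by
  have hmem : ∀ t ∈ Icc (0 : ℝ) 1, x + t • (y - x) ∈ openCube m ρ := fun t ht =>
    mem_openCube_of_le hy (fun p => by
      have := mul_nonneg ht.1 (sub_nonneg.2 (hxy p))
      simp only [Pi.add_apply, Pi.smul_apply, Pi.sub_apply, smul_eq_mul]
      linarith [(hx p).1]) (fun p => by
      have := mul_le_mul_of_nonneg_right ht.2 (sub_nonneg.2 (hxy p))
      simp only [Pi.add_apply, Pi.smul_apply, Pi.sub_apply, smul_eq_mul]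
      linarith)
  have hderiv : ∀ t ∈ Icc (0 : ℝ) 1, HasDerivAt
      (fun s : ℝ => mixedPartial f (openCube m ρ) d (x + s • (y - x)))
      (∑ p, (y - x) p * mixedPartial f (openCube m ρ) (Fin.cons p d : Fin (N + 1) → Fin m)
        (x + t • (y - x))) t := fun t ht => by
    rw [← iteratedFDerivWithin_cons_eq_sum]
    exact hf.hasDerivAt_iteratedFDerivWithin_apply_comp (isOpen_openCube m ρ) N _
      (by simpa using ((hasDerivAt_id t).smul_const (y - x)).const_add x) (hmem t ht)
  have hmono := monotoneOn_of_hasDerivWithinAt_nonneg (convex_Icc (0 : ℝ) 1)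
    (fun t ht => (hderiv t ht).continuousAt.continuousWithinAt)
    (fun t ht => (hderiv t (interior_subset ht)).hasDerivWithinAt)
    (fun t ht => Finset.sum_nonneg fun p _ => mul_nonneg (sub_nonneg.2 (hxy p))
      (hpos _ _ _ (hmem t (interior_subset ht))))
  simpa using hmono (left_mem_Icc.2 zero_le_one) (right_mem_Icc.2 zero_le_one) zero_le_one

/-- If all mixed partial derivatives are nonnegative on the cube, each has its infimum as limit at the
origin along rays. -/
theorem tendsto_mixedPartial_smul (hf : ContDiffOn ℝ (⊤ : ℕ∞) f (openCube m ρ))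
    (hpos : ∀ (N : ℕ) (d : Fin N → Fin m), ∀ x ∈ openCube m ρ,
      0 ≤ mixedPartial f (openCube m ρ) d x)
    (d : Fin N → Fin m) {x : Fin m → ℝ} (hx : x ∈ openCube m ρ) :
    Tendsto (fun t : ℝ => mixedPartial f (openCube m ρ) d (t • x)) (𝓝[>] 0)
      (𝓝 (sInf (mixedPartial f (openCube m ρ) d '' openCube m ρ))) := by
  have hmem : ∀ᶠ t : ℝ in 𝓝[>] 0, t • x ∈ openCube m ρ := by
    filter_upwards [Ioo_mem_nhdsGT (one_pos (α := ℝ))] with t ht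
    exact mem_openCube_of_le hx (fun p => mul_pos ht.1 (hx p).1)
      (fun p => mul_le_of_le_one_left (hx p).1.le ht.2.le)
  have hbdd : BddBelow (mixedPartial f (openCube m ρ) d '' openCube m ρ) :=
    ⟨0, by rintro _ ⟨y, hy, rfl⟩; exact hpos N d y hy⟩
  refine tendsto_order.2 ⟨fun a ha => ?_, fun a ha => ?_⟩
  · filter_upwards [hmem] with t ht
    exact ha.trans_le (csInf_le hbdd (mem_image_of_mem _ ht))
  · obtain ⟨_, ⟨y, hy, rfl⟩, hya⟩ := exists_lt_of_csInf_lt ⟨_, mem_image_of_mem _ hx⟩ ha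
    have hle : ∀ᶠ t : ℝ in 𝓝[>] 0, ∀ p, t * x p < y p := by
      refine eventually_all.2 fun p => ?_
      have : Tendsto (fun t : ℝ => t * x p) (𝓝[>] 0) (𝓝 0) := by
        have h : Continuous fun t : ℝ => t * x p := by fun_prop
        simpa using (h.tendsto 0).mono_left nhdsWithin_le_nhds
      exact this.eventually_lt_const (hy p).1
    filter_upwards [hmem, hle] with t ht htp
    exact (mixedPartial_mono hf hpos d ht hy fun p => (htp p).le).trans_lt hya

/-- A function with nonnegative mixed partial derivatives on the cube is the sum of its Taylor series
at the origin, with terms grouped by total degree. -/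
theorem hasSum_taylor_of_mixedPartial_nonneg (hf : ContDiffOn ℝ (⊤ : ℕ∞) f (openCube m ρ))
    (hpos : ∀ (N : ℕ) (d : Fin N → Fin m), ∀ x ∈ openCube m ρ,
      0 ≤ mixedPartial f (openCube m ρ) d x)
    {x : Fin m → ℝ} (hx : x ∈ openCube m ρ) :
    HasSum (fun N : ℕ => (∑ d : Fin N → Fin m,
      (∏ i, x (d i)) * sInf (mixedPartial f (openCube m ρ) d '' openCube m ρ)) / N.factorial)
      (f x) := by
  obtain ⟨b, hb1, hb⟩ : ∃ b : ℝ, 1 < b ∧ b • x ∈ openCube m ρ := by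
    have hc : Continuous fun t : ℝ => t • x := by fun_prop
    have h1 : ∀ᶠ t : ℝ in 𝓝[>] 1, t • x ∈ openCube m ρ :=
      nhdsWithin_le_nhds (hc.continuousAt.preimage_mem_nhds
        ((isOpen_openCube m ρ).mem_nhds (by simpa using hx)))
    obtain ⟨b, hb, hb'⟩ := (h1.and self_mem_nhdsWithin).exists
    exact ⟨b, hb', hb⟩
  have hmem : ∀ t : ℝ, 0 < t → t ≤ b → t • x ∈ openCube m ρ := fun t h0 h1 =>
    mem_openCube_of_le hb (fun p => mul_pos h0 (hx p).1)
      (fun p => mul_le_mul_of_nonneg_right h1 (hx p).1.le)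
  have h := hasSum_of_hasDerivAt_succ_nonneg
    (G := fun N t => iteratedFDerivWithin ℝ N f (openCube m ρ) (t • x) fun _ => x)
    (a := fun N => ∑ d : Fin N → Fin m,
      (∏ i, x (d i)) * sInf (mixedPartial f (openCube m ρ) d '' openCube m ρ)) hb1 ?_ ?_ ?_
  · simpa using h
  · intro N t h0 h1
    have := hf.hasDerivAt_iteratedFDerivWithin_apply_comp (isOpen_openCube m ρ) N (fun _ => x)
      (γ := fun t : ℝ => t • x) (w := x) (t := t)
      (by simpa using (hasDerivAt_id t).smul_const x) (hmem t h0 h1)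
    rwa [show (Fin.cons x fun _ => x : Fin (N + 1) → Fin m → ℝ) = fun _ => x from
      funext fun i => by cases i using Fin.cases <;> rfl] at this
  · intro N t h0 h1
    simp only [iteratedFDerivWithin_apply_const_eq_sum]
    exact Finset.sum_nonneg fun d _ => mul_nonneg
      (Finset.prod_nonneg fun i _ => (hx _).1.le) (hpos N d _ (hmem t h0 h1))
  · intro N
    simp only [iteratedFDerivWithin_apply_const_eq_sum]
    exact tendsto_finsetSum _ fun d _ => (tendsto_mixedPartial_smul hf hpos d hx).const_mul _

/-- A function with nonnegative mixed partial derivatives on the cube is the sum of a power series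
with nonnegative coefficients. -/
theorem exists_hasSum_of_mixedPartial_nonneg (hf : ContDiffOn ℝ (⊤ : ℕ∞) f (openCube m ρ))
    (hpos : ∀ (N : ℕ) (d : Fin N → Fin m), ∀ x ∈ openCube m ρ,
      0 ≤ mixedPartial f (openCube m ρ) d x) :
    ∃ c : (Fin m → ℕ) → ℝ, (∀ α, 0 ≤ c α) ∧
      ∀ x ∈ openCube m ρ, HasSum (fun α => c α * ∏ p, x p ^ α p) (f x) := by
  let L : (Σ N : ℕ, Fin N → Fin m) → ℝ := fun s =>
    sInf (mixedPartial f (openCube m ρ) s.2 '' openCube m ρ) / s.1.factorial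
  let κ : (Σ N : ℕ, Fin N → Fin m) → Fin m → ℕ := fun s p => (Finset.univ.filter (s.2 · = p)).card
  have hL : ∀ s, 0 ≤ L s := fun s => div_nonneg
    (Real.sInf_nonneg (by rintro _ ⟨y, hy, rfl⟩; exact hpos _ _ y hy)) (by positivity)
  refine ⟨fun α => ∑' s : κ ⁻¹' {α}, L s, fun α => tsum_nonneg fun s => hL s, fun x hx => ?_⟩
  have hprod : ∀ s, ∏ i, x (s.2 i) = ∏ p, x p ^ κ s p := fun s => by
    rw [← Finset.prod_fiberwise Finset.univ s.2 (fun i => x (s.2 i))]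
    refine Finset.prod_congr rfl fun p _ => ?_
    rw [Finset.prod_congr rfl (g := fun _ => x p) fun i hi => by
      rw [(Finset.mem_filter.1 hi).2], Finset.prod_const]
  have hT := hasSum_taylor_of_mixedPartial_nonneg hf hpos hx
  have hin : ∀ N : ℕ, HasSum (fun d : Fin N → Fin m => L ⟨N, d⟩ * ∏ p, x p ^ κ ⟨N, d⟩ p)
      ((∑ d : Fin N → Fin m, (∏ i, x (d i)) *
        sInf (mixedPartial f (openCube m ρ) d '' openCube m ρ)) / N.factorial) := fun N => by
    convert hasSum_fintype _ using 1
    rw [Finset.sum_div]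
    refine Finset.sum_congr rfl fun d _ => ?_
    rw [← hprod ⟨N, d⟩]
    simp only [L]
    ring
  have hsum : HasSum (fun s => L s * ∏ p, x p ^ κ s p) (f x) := by
    have hs : Summable (fun s => L s * ∏ p, x p ^ κ s p) := by
      refine (summable_sigma_of_nonneg fun s => mul_nonneg (hL s)
        (Finset.prod_nonneg fun p _ => pow_nonneg (hx p).1.le _)).2
          ⟨fun N => (hin N).summable, ?_⟩
      simpa only [(hin _).tsum_eq] using hT.summable
    exact (hs.hasSum.sigma hin).unique hT ▸ hs.hasSum
  convert! hsum.tsum_fiberwise κ using 2 with α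
  rw [← tsum_mul_right]
  refine tsum_congr fun s => ?_
  rw [show κ s = α from s.2]

/-- A power series with nonnegative coefficients on the cube can be differentiated term by term
in each variable. -/
theorem hasSum_partialDeriv_of_hasSum {F : (Fin m → ℝ) → ℝ} {c : (Fin m → ℕ) → ℝ}
    (hc : ∀ α, 0 ≤ c α)
    (hF : ∀ x ∈ openCube m ρ, HasSum (fun α => c α * ∏ p, x p ^ α p) (F x))
    {x : Fin m → ℝ} (hx : x ∈ openCube m ρ) (p : Fin m) {D : ℝ}
    (hD : HasDerivAt (fun t => F (Function.update x p t)) D (x p)) :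
    HasSum (fun β : Fin m → ℕ => c (β + Pi.single p 1) * (β p + 1) * ∏ q, x q ^ β q) D := by
  obtain ⟨b, hxb, hbρ⟩ := EReal.exists_between_coe_real (hx p).2
  rw [EReal.coe_lt_coe_iff] at hxb
  obtain ⟨r, hxr, hrb⟩ := exists_between hxb
  have hx0 := (hx p).1
  have hupd : ∀ t, 0 < t → t ≤ b → Function.update x p t ∈ openCube m ρ := fun t h0 h1 q => by
    rcases eq_or_ne q p with rfl | hq
    · simpa using ⟨h0, (EReal.coe_le_coe_iff.2 h1).trans_lt hbρ⟩
    · simpa [hq] using hx q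
  let M : (Fin m → ℕ) → ℝ := fun α => c α * ∏ q ∈ Finset.univ.erase p, x q ^ α q
  have hM : ∀ α, 0 ≤ M α := fun α =>
    mul_nonneg (hc α) (Finset.prod_nonneg fun q _ => pow_nonneg (hx q).1.le _)
  have hterm : ∀ (α : Fin m → ℕ) (t : ℝ),
      c α * ∏ q, Function.update x p t q ^ α q = M α * t ^ α p := fun α t => by
    rw [← Finset.mul_prod_erase _ _ (Finset.mem_univ p)]
    have : ∏ q ∈ Finset.univ.erase p, Function.update x p t q ^ α q =
        ∏ q ∈ Finset.univ.erase p, x q ^ α q := Finset.prod_congr rfl fun q hq => by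
      rw [Function.update_of_ne (Finset.ne_of_mem_erase hq)]
    rw [this, Function.update_self]
    simp only [M]
    ring
  have hsum : ∀ t, 0 < t → t ≤ b → HasSum (fun α => M α * t ^ α p) (F (Function.update x p t)) :=
    fun t h0 h1 => by simpa only [hterm] using hF _ (hupd t h0 h1)
  have hpow : ∀ (n : ℕ) (t : ℝ), 0 < t → t < r → n * t ^ (n - 1) ≤ b ^ n / (b - r) := by
    intro n t h0 h1
    rw [le_div_iff₀ (by linarith)]
    have hb0 : 0 < b := by linarith
    induction n with
    | zero => simp
    | succ n ih =>
      have h2 : (n : ℝ) * t ^ n * (b - r) ≤ t * b ^ n := by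
        rcases n with _ | n
        · simpa using h0.le
        · simp only [Nat.add_sub_cancel] at ih
          calc ((n + 1 : ℕ) : ℝ) * t ^ (n + 1) * (b - r)
              = t * (((n + 1 : ℕ) : ℝ) * t ^ n * (b - r)) := by ring
            _ ≤ t * b ^ (n + 1) := by gcongr
      have h3 : t ^ n * (b - r) ≤ b ^ n * (b - r) := by
        have : 0 ≤ b - r := by linarith
        gcongr
        linarith
      have h4 : 0 ≤ b ^ n * (r - t) := mul_nonneg (by positivity) (by linarith)
      simp only [Nat.add_sub_cancel, Nat.cast_succ, pow_succ]
      linarith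
  have hbd : Summable fun α => M α * (b ^ α p / (b - r)) := by
    simpa only [mul_div_assoc] using (hsum b (by linarith) le_rfl).summable.div_const (b - r)
  have hxm : x p ∈ Ioo 0 r := ⟨hx0, hxr⟩
  have hle : ∀ (α : Fin m → ℕ) (t : ℝ), t ∈ Ioo 0 r →
      ‖M α * (α p * t ^ (α p - 1))‖ ≤ M α * (b ^ α p / (b - r)) := fun α t ht => by
    have h1 : 0 ≤ (α p : ℝ) * t ^ (α p - 1) := mul_nonneg (by positivity) (pow_nonneg ht.1.le _)
    rw [Real.norm_of_nonneg (mul_nonneg (hM α) h1)]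
    exact mul_le_mul_of_nonneg_left (hpow _ t ht.1 ht.2) (hM α)
  have hderiv := hasDerivAt_tsum_of_isPreconnected (g := fun (α : Fin m → ℕ) t => M α * t ^ α p)
    (g' := fun (α : Fin m → ℕ) t => M α * (α p * t ^ (α p - 1)))
    hbd isOpen_Ioo isPreconnected_Ioo
    (fun α t _ => (hasDerivAt_pow (α p) t).const_mul (M α)) hle hxm
    (hsum _ hx0 hxb.le).summable hxm
  have heq : (fun t => F (Function.update x p t)) =ᶠ[𝓝 (x p)] fun t => ∑' α, M α * t ^ α p := by
    filter_upwards [Ioo_mem_nhds hx0 hxb] with t ht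
    exact (hsum t ht.1 ht.2.le).tsum_eq.symm
  have hall : HasSum (fun α : Fin m → ℕ => M α * (α p * x p ^ (α p - 1))) D := by
    rw [hD.unique (hderiv.congr_of_eventuallyEq heq)]
    exact (Summable.of_norm_bounded hbd fun α => hle α _ hxm).hasSum
  rw [← (add_left_injective (Pi.single p 1 : Fin m → ℕ)).hasSum_iff] at hall
  · convert! hall using 2 with β
    have hprod : ∏ q ∈ Finset.univ.erase p, x q ^ (β + Pi.single p 1 : Fin m → ℕ) q =
        ∏ q ∈ Finset.univ.erase p, x q ^ β q := Finset.prod_congr rfl fun q hq => by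
      simp [Finset.ne_of_mem_erase hq]
    simp only [M, Function.comp_apply, hprod]
    rw [← Finset.mul_prod_erase _ _ (Finset.mem_univ p)]
    simp only [Pi.add_apply, Pi.single_eq_same, Nat.add_sub_cancel, Nat.cast_add, Nat.cast_one]
    ring
  · intro α hα
    have : α p = 0 := by
      by_contra h
      refine hα ⟨α - Pi.single p 1, funext fun q => ?_⟩
      rcases eq_or_ne q p with rfl | hq
      · simp; omega
      · simp [hq]
    simp [this]

/-- The mixed partial derivatives of the sum of a power series with nonnegative coefficients are
again sums of such series. -/
theorem exists_hasSum_mixedPartial (hf : ContDiffOn ℝ (⊤ : ℕ∞) f (openCube m ρ))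
    {c : (Fin m → ℕ) → ℝ} (hc : ∀ α, 0 ≤ c α)
    (hF : ∀ x ∈ openCube m ρ, HasSum (fun α => c α * ∏ p, x p ^ α p) (f x)) (N : ℕ)
    (d : Fin N → Fin m) :
    ∃ c' : (Fin m → ℕ) → ℝ, (∀ α, 0 ≤ c' α) ∧ ∀ x ∈ openCube m ρ,
      HasSum (fun α => c' α * ∏ p, x p ^ α p) (mixedPartial f (openCube m ρ) d x) := by
  induction N with
  | zero => exact ⟨c, hc, by simpa [mixedPartial] using hF⟩
  | succ N ih =>
    obtain ⟨c', hc', hF'⟩ := ih (Fin.tail d)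
    refine ⟨fun β : Fin m → ℕ => c' (β + Pi.single (d 0) 1) * (β (d 0) + 1),
      fun β => mul_nonneg (hc' _) (by positivity), fun x hx => ?_⟩
    refine hasSum_partialDeriv_of_hasSum hc' hF' hx (d 0) ?_
    have h := hf.hasDerivAt_iteratedFDerivWithin_apply_comp (isOpen_openCube m ρ) N
      (fun i => Pi.single (Fin.tail d i) 1) (hasDerivAt_update x (d 0) (x (d 0))) (by simpa using hx)
    rw [Function.update_eq_self] at h
    convert h using 2
    rw [mixedPartial]
    congr 1

end Derivatives


/-- Theorem A.1 (multivariate Bernstein theorem): a smooth function on `(0,ρ)^m` is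
absolutely monotone (all mixed partial derivatives of all orders, including order zero, are
non-negative everywhere) if and only if it is represented on `(0,ρ)^m` by a convergent power
series with non-negative Maclaurin coefficients. Here the mixed partial derivative in the
directions `d 0, …, d (N-1)` is expressed via the `N`-th iterated Fréchet derivative within
the open set, evaluated at the corresponding standard basis vectors. -/
theorem absolutely_monotone_iff_power_series (ρ : EReal) (hρ : 0 < ρ)
    (m : ℕ) (hm : 1 ≤ m) (f : (Fin m → ℝ) → ℝ)
    (hf : ContDiffOn ℝ (⊤ : ℕ∞) f {x : Fin m → ℝ | ∀ p, 0 < x p ∧ (x p : EReal) < ρ}) :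
    (∀ (N : ℕ) (x : Fin m → ℝ), (∀ p, 0 < x p ∧ (x p : EReal) < ρ) →
        ∀ d : Fin N → Fin m,
          0 ≤ iteratedFDerivWithin ℝ N f
                {x : Fin m → ℝ | ∀ p, 0 < x p ∧ (x p : EReal) < ρ} x
                (fun i => Pi.single (d i) 1)) ↔
    (∃ c : (Fin m → ℕ) → ℝ, (∀ α : Fin m → ℕ, 0 ≤ c α) ∧
      ∀ x : Fin m → ℝ, (∀ p, 0 < x p ∧ (x p : EReal) < ρ) →
        HasSum (fun α : Fin m → ℕ => c α * ∏ p, x p ^ α p) (f x)) := by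
  change (∀ (N : ℕ), ∀ x ∈ openCube m ρ, ∀ d : Fin N → Fin m,
      0 ≤ mixedPartial f (openCube m ρ) d x) ↔
    ∃ c : (Fin m → ℕ) → ℝ, (∀ α, 0 ≤ c α) ∧
      ∀ x ∈ openCube m ρ, HasSum (fun α => c α * ∏ p, x p ^ α p) (f x)
  refine ⟨fun h => exists_hasSum_of_mixedPartial_nonneg hf fun N d x hx => h N x hx d, ?_⟩
  rintro ⟨c, hc, hF⟩ N x hx d
  obtain ⟨c', hc', hF'⟩ := exists_hasSum_mixedPartial hf hc hF N d
  exact (hF' x hx).nonneg fun α =>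
    mul_nonneg (hc' α) (Finset.prod_nonneg fun p _ => pow_nonneg (hx p).1.le _)
end
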